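/- Let θ ∈ ℝ and let L^1, L^2, L^3 be the three equally spaced rays with direction angles θ, θ + 2π/3 and θ + 4π/3. Let f be a transcendental meromorphic function on ℂ, and suppose there exist distinct values a_1, a_2, a_3 ∈ ℂ ∪ {∞} such that for each j ∈ {1,2,3} all but finitely many a_j-points of f lie on L^j. Then f has only finitely many critical points (that is, f' has only finitely many zeros and f has only finitely many multiple poles), and the Schwarzian derivative S(f) is a rational function Q satisfying Q(z) ~ a z as z → ∞ for some a ∈ ℂ \ {0}. -/

import Mathlib

open Complex Filter Set Topology

noncomputable section

/-- The open ray emanating from the origin with direction angle `θ`. -/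
def Ray (θ : ℝ) : Set ℂ :=
  {z : ℂ | ∃ t : ℝ, 0 < t ∧ z = (t : ℂ) * Complex.exp ((θ : ℂ) * Complex.I)}

/-- `f` is meromorphic on the open set `U` with pole set `P`. -/
def MeromOn (f : ℂ → ℂ) (P : Set ℂ) (U : Set ℂ) : Prop :=
  P ⊆ U ∧ AnalyticOnNhd ℂ f (U \ P) ∧
    (∀ p ∈ P, Tendsto (fun z => ‖f z‖) (𝓝[≠] p) atTop) ∧
    ∀ z ∈ U, ¬ AccPt z (𝓟 P)

/-- `f` (meromorphic on `ℂ` with pole set `P`) is a rational function. -/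
def IsRationalFn (f : ℂ → ℂ) (P : Set ℂ) : Prop :=
  ∃ p q : Polynomial ℂ, q ≠ 0 ∧ ∀ z ∉ P, q.eval z ≠ 0 → f z = p.eval z / q.eval z

/-- The set of `a`-points of a meromorphic function `f` with pole set `P`, where
`a : Option ℂ` is a point of the Riemann sphere (`Option.none` being `∞`). -/
def aPoints (f : ℂ → ℂ) (P : Set ℂ) : Option ℂ → Set ℂ
  | Option.some a => {z : ℂ | z ∉ P ∧ f z = a}
  | Option.none => P

/-- The Schwarzian derivative `S(f) = (f''/f')' - (1/2) (f''/f')²`. -/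
def Schwarzian (f : ℂ → ℂ) (z : ℂ) : ℂ :=
  deriv (fun w => deriv (deriv f) w / deriv f w) z -
    (1 / 2) * (deriv (deriv f) z / deriv f z) ^ 2

/-- The order of the pole of `f` at `z`: the least `m` such that near `z` (punctured),
`f = h / (· - z)^m` with `h` analytic and nonvanishing at `z`. -/
def poleOrder (f : ℂ → ℂ) (z : ℂ) : ℕ :=
  sInf {m : ℕ | ∃ h : ℂ → ℂ, AnalyticAt ℂ h z ∧ h z ≠ 0 ∧
    ∀ᶠ w in 𝓝[≠] z, f w = h w / (w - z) ^ m}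

section

/-- analytic logarithm on convex open sets -/
lemma exists_log_convex {U : Set ℂ} (hU : IsOpen U) (hc : Convex ℝ U) (hne : U.Nonempty)
    {E : ℂ → ℂ} (hE : DifferentiableOn ℂ E U) (h0 : ∀ z ∈ U, E z ≠ 0) :
    ∃ k : ℂ → ℂ, DifferentiableOn ℂ k U ∧ ∀ z ∈ U, Complex.exp (k z) = E z := by
  have hsc : IsSimplyConnected U := by
    have := hc.contractibleSpace hne
    have : SimplyConnectedSpace U := inferInstance
    exact this
  obtain ⟨k, hk, hk2⟩ := Complex.exists_continuousOn_eqOn_exp_comp hsc hU hE.continuousOn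
    (by rintro ⟨z, hz, h⟩; exact h0 z hz h)
  refine ⟨k, ?_, fun z hz => hk2 hz⟩
  intro z hz
  have hkz : ContinuousAt k z := hk.continuousAt (hU.mem_nhds hz)
  have hEz : DifferentiableAt ℂ E z := (hE z hz).differentiableAt (hU.mem_nhds hz)
  have hd : HasDerivAt (fun w => k z + Complex.log (E w / E z)) (deriv E z / E z / (E z / E z)) z := by
    have h1 : E z / E z ∈ Complex.slitPlane := by rw [div_self (h0 z hz)]; simp
    have := ((hEz.hasDerivAt.div_const (E z)).clog h1)
    simpa using (this.const_add (k z))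
  have heq : (fun w => k z + Complex.log (E w / E z)) =ᶠ[𝓝 z] k := by
    have hnear : ∀ᶠ w in 𝓝 z, ‖k w - k z‖ < 1 := by
      have : Tendsto (fun w => ‖k w - k z‖) (𝓝 z) (𝓝 0) := by
        have := (hkz.sub (continuousAt_const (y := k z))).norm
        simpa [ContinuousAt] using this
      exact this.eventually (gt_mem_nhds one_pos)
    filter_upwards [hnear, hU.mem_nhds hz] with w hw hwU
    have e : E w / E z = Complex.exp (k w - k z) := by
      rw [Complex.exp_sub]
      have a := hk2 hwU
      have b := hk2 hz
      simp only [Function.comp] at a b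
      rw [a, b]
    rw [e, Complex.log_exp]
    · ring
    · have := (Complex.abs_im_le_norm (k w - k z)).trans hw.le
      have := (abs_le.1 this).1
      linarith [Real.pi_gt_three]
    · have := (Complex.abs_im_le_norm (k w - k z)).trans hw.le
      have := (abs_le.1 this).2
      linarith [Real.pi_gt_three]
  exact (hd.congr_of_eventuallyEq heq.symm).differentiableAt.differentiableWithinAt

/-- Bloch-type lemma on the closed version. -/
lemma bloch_aux {g : ℂ → ℂ} {z0 : ℂ} {ρ ρ' : ℝ} (hρ' : 0 < ρ') (hlt : ρ' < ρ)
    (hg : DifferentiableOn ℂ g (Metric.ball z0 ρ))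
    (hno : ∀ w, ∃ p ∈ Metric.ball w 6, p ∉ g '' Metric.ball z0 ρ) :
    ‖deriv g z0‖ * ρ' ≤ 300 := by
  have hg' : DifferentiableOn ℂ (deriv g) (Metric.ball z0 ρ) := hg.deriv Metric.isOpen_ball
  have hsub : Metric.closedBall z0 ρ' ⊆ Metric.ball z0 ρ := Metric.closedBall_subset_ball hlt
  have hcont : ContinuousOn (fun z => ‖deriv g z‖ * (ρ' - ‖z - z0‖)) (Metric.closedBall z0 ρ') := by
    apply ContinuousOn.mul
    · exact (hg'.continuousOn.mono hsub).norm
    · fun_prop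
  obtain ⟨a, ha, hmax⟩ := (isCompact_closedBall z0 ρ').exists_isMaxOn
    ⟨z0, Metric.mem_closedBall_self hρ'.le⟩ hcont
  have hM := hmax (Metric.mem_closedBall_self hρ'.le)
  simp only [mem_ofPred_eq, sub_self, norm_zero, sub_zero] at hM
  refine hM.trans ?_
  by_contra hbig
  push Not at hbig
  set D := ‖deriv g a‖ with hD
  set t := ρ' - ‖a - z0‖ with ht
  have ht0 : 0 ≤ t := by
    have := mem_closedBall_iff_norm.1 ha
    linarith
  have htpos : 0 < t := by
    rcases ht0.eq_or_lt with h | h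
    · rw [← h] at hbig; norm_num at hbig
    · exact h
  have hDpos : 0 < D := by
    by_contra h
    have : D = 0 := le_antisymm (not_lt.1 h) (norm_nonneg _)
    rw [this] at hbig; norm_num at hbig
  have hball : Metric.ball a (t/2) ⊆ Metric.closedBall z0 ρ' := by
    intro z hz
    rw [mem_ball_iff_norm] at hz
    rw [mem_closedBall_iff_norm]
    have : ‖z - z0‖ ≤ ‖z - a‖ + ‖a - z0‖ := by
      calc ‖z - z0‖ = ‖(z - a) + (a - z0)‖ := by ring_nf
        _ ≤ _ := norm_add_le _ _
    linarith
  have hb2 : ∀ z ∈ Metric.ball a (t/2), ‖deriv g z‖ ≤ 2 * D := by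
    intro z hz
    have h1 := hmax (hball hz)
    simp only [mem_ofPred_eq] at h1
    rw [mem_ball_iff_norm] at hz
    have : ‖z - z0‖ ≤ ‖z - a‖ + ‖a - z0‖ := by
      calc ‖z - z0‖ = ‖(z - a) + (a - z0)‖ := by ring_nf
        _ ≤ _ := norm_add_le _ _
    have h2 : t / 2 ≤ ρ' - ‖z - z0‖ := by linarith
    have h3 : ‖deriv g z‖ * (t/2) ≤ D * t :=
      (mul_le_mul_of_nonneg_left h2 (norm_nonneg _)).trans h1
    have : ‖deriv g z‖ * (t/2) ≤ (2 * D) * (t/2) := by linarith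
    exact le_of_mul_le_mul_right this (by positivity)
  have hschwarz : ∀ z ∈ Metric.ball a (t/2), ‖deriv g z - deriv g a‖ ≤ 6 * D / t * ‖z - a‖ := by
    intro z hz
    have := Complex.dist_le_div_mul_dist_of_mapsTo_ball (f := deriv g) (c := a) (R₁ := t/2) (R₂ := 3 * D)
      (hg'.mono (hball.trans hsub)) (by
        intro w hw
        rw [mem_closedBall_iff_norm]
        calc ‖deriv g w - deriv g a‖ ≤ ‖deriv g w‖ + ‖deriv g a‖ := norm_sub_le _ _
          _ ≤ 2 * D + D := add_le_add (hb2 w hw) le_rfl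
          _ = 3 * D := by ring) hz
    rw [dist_eq_norm, dist_eq_norm] at this
    convert this using 2
    field_simp
    norm_num
  have hsm : Metric.closedBall a (t/12) ⊆ Metric.ball a (t/2) :=
    Metric.closedBall_subset_ball (by linarith)
  have hlow : ∀ z ∈ Metric.sphere a (t/12), D * t / 24 ≤ ‖g z - g a‖ := by
    intro z hz
    have hz' : ‖z - a‖ = t / 12 := mem_sphere_iff_norm.1 hz
    have hmv := Convex.norm_image_sub_le_of_norm_hasDerivWithin_le
      (f := fun z => g z - deriv g a * z) (f' := fun z => deriv g z - deriv g a)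
      (s := Metric.closedBall a (t/12)) (C := D / 2) (x := a) (y := z) (by
        intro w hw
        have h1 : HasDerivAt g (deriv g w) w :=
          ((hg w (hsub (hball (hsm hw)))).differentiableAt
            (Metric.isOpen_ball.mem_nhds (hsub (hball (hsm hw))))).hasDerivAt
        have h2 : HasDerivAt (fun z => deriv g a * z) (deriv g a) w := by
          simpa using (hasDerivAt_id w).const_mul (deriv g a)
        exact (h1.sub h2).hasDerivWithinAt) (by
        intro w hw
        refine (hschwarz w (hsm hw)).trans ?_
        rw [mem_closedBall_iff_norm] at hw
        calc 6 * D / t * ‖w - a‖ ≤ 6 * D / t * (t / 12) := by gcongr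
          _ = D / 2 := by field_simp; norm_num) (convex_closedBall _ _)
        (Metric.mem_closedBall_self (by positivity)) (Metric.sphere_subset_closedBall hz)
    have e : deriv g a * (z - a) = (g z - g a) - ((g z - deriv g a * z) - (g a - deriv g a * a)) := by ring
    have := norm_sub_le (g z - g a) ((g z - deriv g a * z) - (g a - deriv g a * a))
    rw [← e, norm_mul, hz'] at this
    rw [hz'] at hmv
    change D * (t/12) ≤ _ at this
    linarith
  have hdc : DiffContOnCl ℂ g (Metric.ball a (t/12)) := by
    apply DifferentiableOn.diffContOnCl
    rw [closure_ball _ (by positivity)]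
    exact hg.mono (hsm.trans (hball.trans hsub))
  have himg := hdc.ball_subset_image_closedBall (by positivity) hlow (by
    have hgd : HasDerivAt g (deriv g a) a :=
      ((hg a (hsub ha)).differentiableAt (Metric.isOpen_ball.mem_nhds (hsub ha))).hasDerivAt
    have := hgd.eventually_ne (c := g a) (norm_pos_iff.1 hDpos)
    exact this.frequently.filter_mono nhdsWithin_le_nhds)
  obtain ⟨p, hp, hp2⟩ := hno (g a)
  apply hp2
  have : p ∈ Metric.ball (g a) (D * t / 24 / 2) := by
    refine Metric.ball_subset_ball ?_ hp
    linarith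
  obtain ⟨w, hw, rfl⟩ := himg this
  exact ⟨w, hsub (hball (hsm hw)), rfl⟩

lemma bloch {g : ℂ → ℂ} {z0 : ℂ} {ρ : ℝ} (hρ : 0 < ρ)
    (hg : DifferentiableOn ℂ g (Metric.ball z0 ρ))
    (hno : ∀ w, ∃ p ∈ Metric.ball w 6, p ∉ g '' Metric.ball z0 ρ) :
    ‖deriv g z0‖ * ρ ≤ 300 := by
  have h : Tendsto (fun r : ℝ => ‖deriv g z0‖ * r) (𝓝[<] ρ) (𝓝 (‖deriv g z0‖ * ρ)) := by
    apply Tendsto.mono_left _ nhdsWithin_le_nhds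
    exact (continuous_const.mul continuous_id).tendsto ρ
  refine le_of_tendsto h ?_
  filter_upwards [Ioo_mem_nhdsLT hρ] with r hr
  exact bloch_aux hr.1 hr.2 hg hno

/-- The net of points where `cosh` is an odd integer. -/
lemma cosh_net (w : ℂ) : ∃ p ∈ Metric.ball w 6, ∃ n : ℤ, Complex.cosh p = 2 * n + 1 := by
  have hre : ∀ a : ℝ, ∃ x : ℝ, |x - a| ≤ 4 ∧ ∃ n : ℕ, Real.cosh x = 2 * n + 1 := by
    have key : ∀ a : ℝ, 0 ≤ a → ∃ x : ℝ, |x - a| ≤ 4 ∧ ∃ n : ℕ, Real.cosh x = 2 * n + 1 := by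
      intro a ha
      set n := ⌊(Real.cosh a - 1) / 2⌋₊ with hn
      have h1 := Real.one_le_cosh a
      have hle : (n : ℝ) ≤ (Real.cosh a - 1) / 2 := Nat.floor_le (by linarith)
      have hlt : (Real.cosh a - 1) / 2 < n + 1 := Nat.lt_floor_add_one _
      have hcont : ContinuousOn Real.cosh (Icc 0 a) := Real.continuous_cosh.continuousOn
      obtain ⟨x, hx, hxc⟩ := intermediate_value_Icc ha hcont
        (show (2 * (n:ℝ) + 1) ∈ Icc (Real.cosh 0) (Real.cosh a) by
          rw [Real.cosh_zero]; constructor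
          · have : (0:ℝ) ≤ n := Nat.cast_nonneg _
            linarith
          · linarith)
      refine ⟨x, ?_, n, hxc⟩
      rw [abs_sub_comm, abs_of_nonneg (by linarith [hx.2])]
      by_contra hgt
      push Not at hgt
      have h4 : Real.cosh (x + 4) ≤ Real.cosh a := by
        rw [Real.cosh_le_cosh, abs_of_nonneg (by linarith [hx.1]), abs_of_nonneg ha]
        linarith
      have h5 : Real.cosh x * 3 ≤ Real.cosh (x + 4) := by
        rw [Real.cosh_add]
        have hs : 0 ≤ Real.sinh x * Real.sinh 4 :=
          mul_nonneg (Real.sinh_nonneg_iff.2 hx.1) (Real.sinh_nonneg_iff.2 (by norm_num))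
        have hc : (3:ℝ) ≤ Real.cosh 4 := by
          rw [Real.cosh_eq]
          have e4 : (4:ℝ) + 4^2/2 ≤ Real.exp 4 := by
            have := Real.quadratic_le_exp_of_nonneg (show (0:ℝ) ≤ 4 by norm_num)
            linarith
          have := Real.exp_pos (-4)
          linarith
        have := Real.cosh_pos x
        nlinarith
      have : (0:ℝ) ≤ n := Nat.cast_nonneg _
      rw [hxc] at h5
      linarith
    intro a
    rcases le_total 0 a with h | h
    · exact key a h
    · obtain ⟨x, hx, n, hn⟩ := key (-a) (by linarith)
      refine ⟨-x, ?_, n, by rw [Real.cosh_neg, hn]⟩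
      rw [← abs_neg]; convert hx using 2; ring
  obtain ⟨x, hx, n, hn⟩ := hre w.re
  set m : ℤ := round (w.im / Real.pi) with hm
  have hmd : |w.im - Real.pi * m| ≤ 2 := by
    have h := abs_sub_round (w.im / Real.pi)
    have hp := Real.pi_pos
    have e : w.im - Real.pi * m = Real.pi * (w.im / Real.pi - m) := by field_simp
    rw [e, abs_mul, abs_of_pos hp]
    have : Real.pi * |w.im / Real.pi - m| ≤ Real.pi * (1/2) := by gcongr
    linarith [Real.pi_lt_four]
  refine ⟨x + (Real.pi * m : ℝ) * I, ?_, ?_⟩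
  · rw [mem_ball_iff_norm]
    set d := (x + (Real.pi * m : ℝ) * I - w : ℂ) with hd
    have h1 : d.re = x - w.re := by simp [hd]
    have h2 : d.im = Real.pi * m - w.im := by simp [hd]
    have h3 : ‖d‖ ^ 2 ≤ 20 := by
      rw [Complex.sq_norm, Complex.normSq_apply, h1, h2]
      have a1 := abs_le.1 hx
      have a2 := abs_le.1 hmd
      nlinarith [a1.1, a1.2, a2.1, a2.2]
    nlinarith [norm_nonneg d]
  · rw [Complex.cosh_add, Complex.cosh_mul_I, Complex.sinh_mul_I]
    have hs : Complex.sin ((Real.pi * m : ℝ) : ℂ) = 0 := by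
      rw [← Complex.ofReal_sin, mul_comm, Real.sin_int_mul_pi]; simp
    have hc : Complex.cos ((Real.pi * m : ℝ) : ℂ) = (-1)^m := by
      rw [← Complex.ofReal_cos, mul_comm, Real.cos_int_mul_pi]; push_cast; rfl
    rw [hs, hc, ← Complex.ofReal_cosh, hn]
    rcases Int.even_or_odd m with h | h
    · refine ⟨n, ?_⟩
      rw [h.neg_one_zpow]; push_cast; ring
    · refine ⟨-n-1, ?_⟩
      rw [h.neg_one_zpow]; push_cast; ring

lemma exists_cosh_root {q : ℂ → ℂ} {z0 : ℂ} {ρ : ℝ} (hρ : 0 < ρ)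
    (hq : DifferentiableOn ℂ q (Metric.ball z0 ρ))
    (hom : ∀ z ∈ Metric.ball z0 ρ, ∀ n : ℤ, q z ≠ 2 * n + 1) :
    ∃ g : ℂ → ℂ, DifferentiableOn ℂ g (Metric.ball z0 ρ) ∧
      ∀ z ∈ Metric.ball z0 ρ, Complex.cosh (g z) = q z := by
  have hne : (Metric.ball z0 ρ).Nonempty := ⟨z0, Metric.mem_ball_self hρ⟩
  obtain ⟨h, hh, hh2⟩ := exists_log_convex Metric.isOpen_ball (convex_ball z0 ρ) hne
    (E := fun z => q z ^ 2 - 1) ((hq.pow 2).sub_const 1) (by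
      intro z hz h0
      have : (q z - 1) * (q z + 1) = 0 := by linear_combination h0
      rcases mul_eq_zero.1 this with h | h
      · exact hom z hz 0 (by push_cast; linear_combination h)
      · exact hom z hz (-1) (by push_cast; linear_combination h))
  set w : ℂ → ℂ := fun z => Complex.exp (h z / 2) with hw
  have hwd : DifferentiableOn ℂ w (Metric.ball z0 ρ) := (hh.div_const 2).cexp
  have hw2 : ∀ z ∈ Metric.ball z0 ρ, w z ^ 2 = q z ^ 2 - 1 := by
    intro z hz
    rw [← hh2 z hz, hw]
    simp only
    rw [← Complex.exp_nat_mul]; congr 1; push_cast; ring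
  obtain ⟨g, hg, hg2⟩ := exists_log_convex Metric.isOpen_ball (convex_ball z0 ρ) hne
    (E := fun z => q z + w z) (hq.add hwd) (by
      intro z hz h0
      have := hw2 z hz
      have : (q z + w z) * (q z - w z) = 1 := by linear_combination -this
      rw [h0] at this; simp at this)
  refine ⟨g, hg, fun z hz => ?_⟩
  have h1 : (q z + w z) * (q z - w z) = 1 := by linear_combination -(hw2 z hz)
  rw [Complex.cosh, Complex.exp_neg, hg2 z hz, eq_comm, inv_eq_of_mul_eq_one_right h1]
  ring

lemma norm_cosh_le (z : ℂ) : ‖Complex.cosh z‖ ≤ Real.exp |z.re| := by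
  rw [Complex.cosh]
  rw [norm_div]
  have h1 : ‖Complex.exp z‖ ≤ Real.exp |z.re| := by
    rw [Complex.norm_exp]; exact Real.exp_le_exp.2 (le_abs_self _)
  have h2 : ‖Complex.exp (-z)‖ ≤ Real.exp |z.re| := by
    rw [Complex.norm_exp]; exact Real.exp_le_exp.2 (by simpa using neg_le_abs z.re)
  have := norm_add_le (Complex.exp z) (Complex.exp (-z))
  rw [show ‖(2:ℂ)‖ = 2 by simp]
  linarith

lemma exp_abs_re_le (z : ℂ) : Real.exp |z.re| ≤ 2 * ‖Complex.cosh z‖ + 1 := by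
  have key : ∀ z : ℂ, 0 ≤ z.re → Real.exp |z.re| ≤ 2 * ‖Complex.cosh z‖ + 1 := by
    intro z hz
    have e : Complex.exp z = 2 * Complex.cosh z - Complex.exp (-z) := by
      rw [Complex.cosh]; ring
    have h1 : ‖Complex.exp z‖ = Real.exp |z.re| := by
      rw [Complex.norm_exp, abs_of_nonneg hz]
    have h2 : ‖Complex.exp (-z)‖ ≤ 1 := by
      rw [Complex.norm_exp]; simpa using hz
    rw [← h1, e]
    refine (norm_sub_le _ _).trans ?_
    rw [norm_mul, show ‖(2:ℂ)‖ = 2 by simp]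
    linarith
  rcases le_total 0 z.re with h | h
  · exact key z h
  · have := key (-z) (by simpa using h)
    simpa using this

/-- constant -/
def CH : ℝ := 12 * Real.exp 300

lemma CH_pos : 1 ≤ CH := by
  unfold CH
  have := Real.add_one_le_exp 300
  linarith

/-- Harnack inequality for functions omitting `2πiℤ`. -/
lemma harnack {k : ℂ → ℂ} {s0 : ℂ} {ρ : ℝ} (hρ : 0 < ρ)
    (hk : DifferentiableOn ℂ k (Metric.ball s0 ρ))
    (hom : ∀ z ∈ Metric.ball s0 ρ, Complex.exp (k z) ≠ 1) {s : ℂ} (hs : ‖s - s0‖ ≤ ρ / 2) :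
    2 + ‖k s‖ ≤ CH * (2 + ‖k s0‖) := by
  have hpi := Real.pi_pos
  set q : ℂ → ℂ := fun z => k z / (Real.pi * I) - 1 with hq
  have hkq : ∀ z, k z = (Real.pi * I) * (q z + 1) := by
    intro z
    simp only [hq]
    have : (Real.pi : ℂ) ≠ 0 := by exact_mod_cast hpi.ne'
    field_simp
    ring
  have hpiI : ‖(Real.pi * I : ℂ)‖ = Real.pi := by
    simp [abs_of_pos hpi]
  obtain ⟨g, hg, hg2⟩ := exists_cosh_root hρ (q := q) ((hk.div_const _).sub_const 1) (by
    intro z hz n h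
    apply hom z hz
    rw [hkq, h, Complex.exp_eq_one_iff]
    exact ⟨n + 1, by push_cast; ring⟩)
  have hderiv : ∀ z ∈ Metric.closedBall s0 (ρ / 2), ‖deriv g z‖ ≤ 600 / ρ := by
    intro z hz
    have hsub : Metric.ball z (ρ / 2) ⊆ Metric.ball s0 ρ := by
      intro w hw
      rw [Metric.mem_ball] at *
      rw [Metric.mem_closedBall] at hz
      linarith [dist_triangle w z s0]
    have := bloch (g := g) (z0 := z) (half_pos hρ) (hg.mono hsub) (by
      intro w
      obtain ⟨p, hp, n, hn⟩ := cosh_net w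
      refine ⟨p, hp, ?_⟩
      rintro ⟨u, hu, rfl⟩
      rw [hg2 u (hsub hu)] at hn
      have := hkq u
      rw [hn] at this
      apply hom u (hsub hu)
      rw [this, Complex.exp_eq_one_iff]
      exact ⟨n + 1, by push_cast; ring⟩)
    rw [le_div_iff₀ hρ]
    linarith
  have hsub : Metric.closedBall s0 (ρ / 2) ⊆ Metric.ball s0 ρ :=
    Metric.closedBall_subset_ball (by linarith)
  have hsm : s ∈ Metric.closedBall s0 (ρ / 2) := mem_closedBall_iff_norm.2 hs
  have hs0m : s0 ∈ Metric.closedBall s0 (ρ / 2) := Metric.mem_closedBall_self (by positivity)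
  have hmv := Convex.norm_image_sub_le_of_norm_deriv_le (f := g) (fun z hz =>
    (hg z (hsub hz)).differentiableAt (Metric.isOpen_ball.mem_nhds (hsub hz))) hderiv
    (convex_closedBall s0 (ρ / 2)) hs0m hsm
  have h300 : ‖g s - g s0‖ ≤ 300 := by
    refine hmv.trans ?_
    calc 600 / ρ * ‖s - s0‖ ≤ 600 / ρ * (ρ / 2) := by gcongr
      _ = 300 := by field_simp; norm_num
  have h1 : |(g s).re| ≤ |(g s0).re| + 300 := by
    have := (Complex.abs_re_le_norm (g s - g s0)).trans h300
    rw [Complex.sub_re] at this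
    have := abs_sub_abs_le_abs_sub (g s).re (g s0).re
    linarith
  have h2 : ‖q s‖ ≤ Real.exp 300 * (2 * ‖q s0‖ + 1) := by
    rw [← hg2 s (hsub hsm), ← hg2 s0 (hsub hs0m)]
    calc _ ≤ Real.exp |(g s).re| := norm_cosh_le _
      _ ≤ Real.exp (|(g s0).re| + 300) := Real.exp_le_exp.2 h1
      _ = Real.exp 300 * Real.exp |(g s0).re| := by rw [Real.exp_add, mul_comm]
      _ ≤ _ := by gcongr; exact exp_abs_re_le _
  have h3 : ‖k s‖ ≤ Real.pi * (‖q s‖ + 1) := by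
    rw [hkq, norm_mul, hpiI]
    gcongr
    refine (norm_add_le _ _).trans ?_
    simp
  have h4 : Real.pi * ‖q s0‖ ≤ ‖k s0‖ + Real.pi := by
    have : (Real.pi * I) * q s0 = k s0 - Real.pi * I := by rw [hkq]; ring
    rw [← hpiI, ← norm_mul, this, hpiI]
    refine (norm_sub_le _ _).trans ?_
    rw [hpiI]
  have h5 : (301 : ℝ) ≤ Real.exp 300 := by
    have := Real.add_one_le_exp 300
    linarith
  unfold CH
  have h6 : Real.pi * ‖q s‖ ≤ Real.exp 300 * (2 * (‖k s0‖ + Real.pi) + Real.pi) := by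
    calc Real.pi * ‖q s‖ ≤ Real.pi * (Real.exp 300 * (2 * ‖q s0‖ + 1)) := by gcongr
      _ = Real.exp 300 * (2 * (Real.pi * ‖q s0‖) + Real.pi) := by ring
      _ ≤ _ := by gcongr
  have h7 := Real.pi_lt_four
  have h8 := norm_nonneg (k s0)
  have h9 : Real.exp 300 * (2 * (‖k s0‖ + Real.pi) + Real.pi) ≤ Real.exp 300 * (2 * ‖k s0‖ + 12) := by
    apply mul_le_mul_of_nonneg_left _ (Real.exp_pos _).le
    linarith
  nlinarith

end

section

/-- Locally uniform convergence of analytic functions on `U` along `l`. -/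
def LU {ι : Type*} (l : Filter ι) (f : ι → ℂ → ℂ) (G : ℂ → ℂ) (U : Set ℂ) : Prop :=
  ∀ z ∈ U, ∃ r > 0, Metric.ball z r ⊆ U ∧
    (∀ᶠ i in l, DifferentiableOn ℂ (f i) (Metric.ball z r)) ∧
    TendstoUniformlyOn f G l (Metric.ball z r)

namespace LU
variable {ι : Type*} {l : Filter ι} {f : ι → ℂ → ℂ} {G : ℂ → ℂ} {U : Set ℂ}

lemma diff [l.NeBot] (h : LU l f G U) : DifferentiableOn ℂ G U := by
  intro z hz
  obtain ⟨r, hr, hrU, hd, ht⟩ := h z hz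
  have := ht.tendstoLocallyUniformlyOn.differentiableOn hd Metric.isOpen_ball
  exact ((this z (Metric.mem_ball_self hr)).differentiableAt
    (Metric.ball_mem_nhds z hr)).differentiableWithinAt

lemma tendsto (h : LU l f G U) [l.NeBot] {u : ι → ℂ} {z : ℂ} (hz : z ∈ U) (hu : Tendsto u l (𝓝 z)) :
    Tendsto (fun i => f i (u i)) l (𝓝 (G z)) := by
  obtain ⟨r, hr, hrU, hd, ht⟩ := h z hz
  have hc : ContinuousAt G z := by
    have := ht.tendstoLocallyUniformlyOn.differentiableOn hd Metric.isOpen_ball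
    exact (this.continuousOn).continuousAt (Metric.ball_mem_nhds z hr)
  have h1 : Tendsto (fun i => G (u i)) l (𝓝 (G z)) := hc.tendsto.comp hu
  rw [Metric.tendsto_nhds] at h1 ⊢
  rw [Metric.tendstoUniformlyOn_iff] at ht
  intro ε hε
  filter_upwards [h1 (ε/2) (by positivity), ht (ε/2) (by positivity),
    hu.eventually (Metric.ball_mem_nhds z hr)] with i h1 h2 h3
  have := h2 (u i) h3
  rw [dist_comm] at this
  linarith [dist_triangle (f i (u i)) (G (u i)) (G z)]

lemma tendsto_const (h : LU l f G U) [l.NeBot] {z : ℂ} (hz : z ∈ U) :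
    Tendsto (fun i => f i z) l (𝓝 (G z)) := h.tendsto hz tendsto_const_nhds

lemma mono (h : LU l f G U) {V : Set ℂ} (hV : IsOpen V) (hVU : V ⊆ U) : LU l f G V := by
  intro z hz
  obtain ⟨r, hr, hrU, hd, ht⟩ := h z (hVU hz)
  obtain ⟨r', hr', hV'⟩ := Metric.isOpen_iff.1 hV z hz
  refine ⟨min r r', lt_min hr hr', ?_, ?_, ?_⟩
  · exact (Metric.ball_subset_ball (min_le_right _ _)).trans hV'
  · filter_upwards [hd] with i hi
    exact hi.mono (Metric.ball_subset_ball (min_le_left _ _))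
  · exact ht.mono (Metric.ball_subset_ball (min_le_left _ _))

lemma deriv [l.NeBot] (h : LU l f G U) : LU l (fun i => deriv (f i)) (deriv G) U := by
  intro z hz
  obtain ⟨r, hr, hrU, hd, ht⟩ := h z hz
  refine ⟨r/2, by positivity, (Metric.ball_subset_ball (by linarith)).trans hrU, ?_, ?_⟩
  · filter_upwards [hd] with i hi
    exact (hi.deriv Metric.isOpen_ball).mono (Metric.ball_subset_ball (by linarith))
  · have h1 := ht.tendstoLocallyUniformlyOn.deriv hd Metric.isOpen_ball
    have h2 := (tendstoLocallyUniformlyOn_iff_forall_isCompact Metric.isOpen_ball).1 h1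
      (Metric.closedBall z (r/2)) (Metric.closedBall_subset_ball (by linarith))
      (isCompact_closedBall _ _)
    exact h2.mono Metric.ball_subset_closedBall

/-- Hurwitz -/
lemma hurwitz [l.NeBot] (h : LU l f G U) (hU : IsOpen U) (hUc : IsPreconnected U)
    (hne : ∀ z ∈ U, ∃ r > 0, ∀ᶠ i in l, ∀ w ∈ Metric.ball z r, f i w ≠ 0)
    {z0 : ℂ} (hz0 : z0 ∈ U) (hG : G z0 = 0) : ∀ z ∈ U, G z = 0 := by
  have hGd := h.diff
  have hGa : AnalyticOnNhd ℂ G U := hGd.analyticOnNhd hU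
  have hev : ∃ᶠ z in 𝓝[≠] z0, G z = 0 := by
    intro hcon
    have hcon : ∀ᶠ z in 𝓝[≠] z0, G z ≠ 0 := hcon
    rw [eventually_nhdsWithin_iff, Metric.eventually_nhds_iff] at hcon
    obtain ⟨e, he, hcon⟩ := hcon
    obtain ⟨r, hr, hrU, hd, ht⟩ := h z0 hz0
    obtain ⟨r1, hr1, hne1⟩ := hne z0 hz0
    set t := min (min r r1) e / 2 with htdef
    have hmin : 0 < min (min r r1) e := lt_min (lt_min hr hr1) he
    have htp : 0 < t := by positivity
    have hA : t < min (min r r1) e := half_lt_self hmin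
    have htr : t < r := hA.trans_le ((min_le_left _ _).trans (min_le_left _ _))
    have htr1 : t < r1 := hA.trans_le ((min_le_left _ _).trans (min_le_right _ _))
    have hte : t < e := hA.trans_le (min_le_right _ _)
    have hsub : Metric.closedBall z0 t ⊆ Metric.ball z0 r := Metric.closedBall_subset_ball htr
    have hcs : ContinuousOn (fun z => ‖G z‖) (Metric.sphere z0 t) :=
      (hGd.continuousOn.mono ((Metric.sphere_subset_closedBall.trans hsub).trans hrU)).norm
    obtain ⟨b, hb, hbmin⟩ := (isCompact_sphere z0 t).exists_isMinOn
      (NormedSpace.sphere_nonempty.2 htp.le) hcs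
    have hb0 : 0 < ‖G b‖ := by
      rw [norm_pos_iff]
      rw [Metric.mem_sphere] at hb
      apply hcon (by rw [hb]; exact hte)
      rintro rfl
      rw [dist_self] at hb; exact htp.ne hb
    set ε := ‖G b‖ with hε
    have h0 := (h.tendsto_const hz0)
    rw [hG, Metric.tendsto_nhds] at h0
    rw [Metric.tendstoUniformlyOn_iff] at ht
    obtain ⟨i, hi1, hi2, hi3, hi4⟩ := ((h0 (ε/2) (by positivity)).and
      ((ht (ε/2) (by positivity)).and (hne1.and hd))).exists
    have hdiff : DiffContOnCl ℂ (fun z => (f i z)⁻¹) (Metric.ball z0 t) := by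
      apply DifferentiableOn.diffContOnCl
      rw [closure_ball _ htp.ne']
      intro w hw
      have hw1 := hi3 w (Metric.closedBall_subset_ball htr1 hw)
      exact ((hi4.mono hsub) w hw).inv hw1
    have hmm := Complex.norm_le_of_forall_mem_frontier_norm_le Metric.isBounded_ball hdiff
      (C := 2 / ε) (by
        intro w hw
        rw [frontier_ball _ htp.ne'] at hw
        have h1 := hi2 w (hsub (Metric.sphere_subset_closedBall hw))
        have h2 : ε ≤ ‖G w‖ := hbmin hw
        rw [dist_eq_norm] at h1
        have h3 := norm_sub_norm_le (G w) (f i w)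
        have h4 : ε / 2 ≤ ‖f i w‖ := by linarith
        rw [norm_inv]
        rw [show (2:ℝ) / ε = (ε/2)⁻¹ by field_simp]
        exact inv_anti₀ (by positivity) h4) (subset_closure (Metric.mem_ball_self htp))
    have hz1 := hi3 z0 (Metric.mem_ball_self hr1)
    rw [norm_inv] at hmm
    rw [dist_zero_right] at hi1
    have h5 : 0 < ‖f i z0‖ := norm_pos_iff.2 hz1
    have h6 : (ε/2)⁻¹ < ‖f i z0‖⁻¹ := inv_strictAnti₀ h5 hi1
    rw [show (ε/2)⁻¹ = 2 / ε by field_simp] at h6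
    linarith
  exact hGa.eqOn_zero_of_preconnected_of_frequently_eq_zero hUc hz0 hev

end LU

/-- Montel along an ultrafilter. -/
lemma montel_uf {ι : Type*} (u : Ultrafilter ι) {f : ι → ℂ → ℂ} {U : Set ℂ}
    (h : ∀ z ∈ U, ∃ r > 0, Metric.ball z r ⊆ U ∧ ∃ C : ℝ,
      ∀ᶠ i in (u : Filter ι), DifferentiableOn ℂ (f i) (Metric.ball z r) ∧
        ∀ w ∈ Metric.ball z r, ‖f i w‖ ≤ C) :
    ∃ G, LU (u : Filter ι) f G U := by
  have hlim : ∀ z ∈ U, ∃ y, Tendsto (fun i => f i z) u (𝓝 y) := by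
    intro z hz
    obtain ⟨r, hr, hrU, C, hC⟩ := h z hz
    have hcpt := isCompact_closedBall (0:ℂ) C
    have : ((u.map fun i => f i z : Ultrafilter ℂ) : Filter ℂ) ≤ 𝓟 (Metric.closedBall (0:ℂ) C) := by
      rw [le_principal_iff, Ultrafilter.coe_map, mem_map]
      filter_upwards [hC] with i hi
      simpa using hi.2 z (Metric.mem_ball_self hr)
    obtain ⟨y, -, hy⟩ := isCompact_iff_ultrafilter_le_nhds.1 hcpt _ this
    exact ⟨y, hy⟩
  choose! G hG using hlim
  refine ⟨G, fun z hz => ?_⟩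
  obtain ⟨r, hr, hrU, C, hC⟩ := h z hz
  have hsub2 : Metric.ball z (r/2) ⊆ Metric.ball z r := Metric.ball_subset_ball (by linarith)
  refine ⟨r/2, by positivity, hsub2.trans hrU, ?_, ?_⟩
  · filter_upwards [hC] with i hi
    exact hi.1.mono hsub2
  have hCp : 0 ≤ C := by
    obtain ⟨i, hi⟩ := hC.exists
    exact (norm_nonneg _).trans (hi.2 z (Metric.mem_ball_self hr))
  set L := 2 * C / (r/2) + 1 with hL
  have hLp : 0 < L := by positivity
  have hlip : ∀ᶠ i in (u : Filter ι), ∀ w ∈ Metric.ball z (r/2), ∀ w' ∈ Metric.ball w (r/2),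
      ‖f i w' - f i w‖ ≤ L * ‖w' - w‖ := by
    filter_upwards [hC] with i hi w hw w' hw'
    have hs : Metric.ball w (r/2) ⊆ Metric.ball z r := by
      intro v hv
      rw [Metric.mem_ball] at *
      linarith [dist_triangle v w z]
    have := Complex.dist_le_div_mul_dist_of_mapsTo_ball (f := f i) (c := w) (R₁ := r/2) (R₂ := 2 * C)
      (hi.1.mono hs) (by
        intro v hv
        rw [mem_closedBall_iff_norm]
        have h1 := hi.2 v (hs hv)
        have h2 := hi.2 w (hsub2 hw)
        linarith [norm_sub_le (f i v) (f i w)]) hw'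
    rw [dist_eq_norm, dist_eq_norm] at this
    refine this.trans ?_
    gcongr
    linarith
  have hlipG : ∀ w ∈ Metric.ball z (r/2), ∀ w' ∈ Metric.ball w (r/2), w' ∈ Metric.ball z (r/2) →
      ‖G w' - G w‖ ≤ L * ‖w' - w‖ := by
    intro w hw w' hw' hw2
    have h1 := ((hG w' (hrU (hsub2 hw2))).sub (hG w (hrU (hsub2 hw)))).norm
    refine le_of_tendsto h1 ?_
    filter_upwards [hlip] with i hi
    exact hi w hw w' hw'
  rw [Metric.tendstoUniformlyOn_iff]
  intro ε hε
  have htb : TotallyBounded (Metric.ball z (r/2)) :=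
    (isCompact_closedBall z (r/2)).totallyBounded.subset Metric.ball_subset_closedBall
  obtain ⟨t, ht, htf, hcov⟩ := (totallyBounded_iff_subset.1 htb) _
    (Metric.dist_mem_uniformity (lt_min (show 0 < r/2 by positivity) (show 0 < ε/4/L by positivity)))
  have hnet : ∀ᶠ i in (u : Filter ι), ∀ y ∈ t, dist (f i y) (G y) < ε/4 := by
    rw [Filter.eventually_all_finite htf]
    intro y hy
    exact (Metric.tendsto_nhds.1 (hG y (hrU (hsub2 (ht hy))))) (ε/4) (by positivity)
  filter_upwards [hnet, hlip] with i hi1 hi2 w hw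
  obtain ⟨y, hy, hwy⟩ := mem_iUnion₂.1 (hcov hw)
  have hwy : dist w y < min (r/2) (ε/4/L) := hwy
  have hw1 : w ∈ Metric.ball y (r/2) := hwy.trans_le (min_le_left _ _)
  have hw2 : L * ‖w - y‖ ≤ ε/4 := by
    have : ‖w - y‖ < ε/4/L := by rw [← dist_eq_norm]; exact hwy.trans_le (min_le_right _ _)
    calc L * ‖w - y‖ ≤ L * (ε/4/L) := by gcongr
      _ = ε/4 := by field_simp
  have a1 := hi2 y (ht hy) w hw1
  have a2 := hlipG y (ht hy) w hw1 hw
  have a3 := hi1 y hy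
  rw [dist_eq_norm] at a3 ⊢
  have e : G w - f i w = (G w - G y) - (f i y - G y) - (f i w - f i y) := by ring
  rw [e]
  linarith [norm_sub_le ((G w - G y) - (f i y - G y)) (f i w - f i y),
    norm_sub_le (G w - G y) (f i y - G y)]

/-- Bounded along an ultrafilter, or tends to infinity. -/
lemma uf_real_dichotomy {ι : Type*} (u : Ultrafilter ι) (b : ι → ℝ) :
    (∃ C, ∀ᶠ i in (u : Filter ι), b i ≤ C) ∨ Tendsto b u atTop := by
  by_cases h : ∃ C, ∀ᶠ i in (u : Filter ι), b i ≤ C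
  · exact Or.inl h
  · right
    rw [tendsto_atTop]
    intro C
    push Not at h
    have := h C
    exact this.mono fun i hi => hi.le

lemma uf_tendsto_of_bdd {ι : Type*} (u : Ultrafilter ι) (f : ι → ℂ) {C : ℝ}
    (h : ∀ᶠ i in (u : Filter ι), ‖f i‖ ≤ C) : ∃ y, ‖y‖ ≤ C ∧ Tendsto f u (𝓝 y) := by
  have : ((u.map f : Ultrafilter ℂ) : Filter ℂ) ≤ 𝓟 (Metric.closedBall (0:ℂ) C) := by
    rw [le_principal_iff, Ultrafilter.coe_map, mem_map]
    filter_upwards [h] with i hi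
    simpa using hi
  obtain ⟨y, h1, hy⟩ := isCompact_iff_ultrafilter_le_nhds.1 (isCompact_closedBall (0:ℂ) C) _ this
  exact ⟨y, by simpa using h1, hy⟩

end

section

def TT (ρ : ℝ) : Set ℂ := {s | ρ < s.re ∧ |s.im| < 2 * Real.pi / 3}
def DD : Set ℂ := {s | |s.im| < 2 * Real.pi / 3}
def SP : Set ℂ := {s | 0 < s.im ∧ s.im < 2 * Real.pi / 3}
def SM : Set ℂ := {s | -(2 * Real.pi / 3) < s.im ∧ s.im < 0}
def mp : ℂ := ((Real.pi / 3 : ℝ) : ℂ) * I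
def mm : ℂ := ((-(Real.pi / 3) : ℝ) : ℂ) * I

/-- functions on half strips omitting `2πiℤ` off the real axis -/
structure KF (ρ : ℝ) (k : ℂ → ℂ) : Prop where
  diff : DifferentiableOn ℂ k (TT ρ)
  om : ∀ s ∈ TT ρ, Complex.exp (k s) = 1 → s.im = 0

def BB (k : ℂ → ℂ) (x : ℝ) : ℝ := (2 + ‖k (x + mp)‖) + (2 + ‖k (x + mm)‖)

@[simp] lemma mp_re : mp.re = 0 := by simp [mp]
@[simp] lemma mp_im : mp.im = Real.pi / 3 := by simp [mp]
@[simp] lemma mm_re : mm.re = 0 := by simp [mm]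
@[simp] lemma mm_im : mm.im = -(Real.pi / 3) := by simp [mm]

lemma BB_pos (k : ℂ → ℂ) (x : ℝ) : 4 ≤ BB k x := by
  unfold BB; linarith [norm_nonneg (k (x + mp)), norm_nonneg (k (x + mm))]

lemma chain_halving {u : ℝ → ℝ} {h C : ℝ} {N : ℕ} (hh : 0 < h) (hC : 1 ≤ C) (hN : C ≤ 2 ^ N)
    (hu : ∀ y, 0 ≤ u y)
    (H : ∀ y, 0 < y → y ≤ h → ∀ y', y / 2 ≤ y' → y' ≤ y → u y' ≤ C * u y) :
    ∀ y, 0 < y → y ≤ h → u y ≤ C * (h / y) ^ N * u h := by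
  have key : ∀ n : ℕ, ∀ y, h / 2 ^ n ≤ y → y ≤ h → u y ≤ C ^ n * u h := by
    intro n
    induction n with
    | zero =>
      intro y h1 h2
      have : y = h := le_antisymm h2 (by simpa using h1)
      simp [this]
    | succ n ih =>
      intro y h1 h2
      have hy0 : 0 < y := lt_of_lt_of_le (by positivity) h1
      by_cases hy : y ≤ h / 2
      · have a := H (2 * y) (by linarith) (by linarith) y (by linarith) (by linarith)
        have b := ih (2 * y) (by rw [pow_succ] at h1; rw [div_le_iff₀ (by positivity)] at h1 ⊢; linarith) (by linarith)
        calc u y ≤ C * u (2 * y) := a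
          _ ≤ C * (C ^ n * u h) := by gcongr
          _ = _ := by ring
      · have a := H h hh le_rfl y (by linarith) h2
        calc u y ≤ C * u h := a
          _ ≤ C ^ (n+1) * u h := by
            gcongr
            · exact hu h
            · exact le_self_pow₀ hC (by omega)
  intro y hy0 hyh
  obtain ⟨n, hn1, hn2⟩ := exists_nat_pow_near (show (1:ℝ) ≤ h / y by rw [le_div_iff₀ hy0]; linarith)
    (show (1:ℝ) < 2 by norm_num)
  have a := key (n+1) y (by rw [div_lt_iff₀ hy0] at hn2; rw [div_le_iff₀ (by positivity)]; linarith) hyh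
  refine a.trans ?_
  gcongr
  · exact hu h
  calc C ^ (n+1) = C * C ^ n := by ring
    _ ≤ C * (2 ^ N) ^ n := by gcongr
    _ = C * (2 ^ n) ^ N := by rw [← pow_mul, ← pow_mul, mul_comm N n]
    _ ≤ C * (h / y) ^ N := by gcongr

lemma KF.har {ρ : ℝ} {k : ℂ → ℂ} (hk : KF ρ k) {s0 : ℂ} {η : ℝ} (hx : ρ + 2 ≤ s0.re) (hη : 0 < η)
    (h1 : η ≤ |s0.im|) (h2 : |s0.im| ≤ 2 * Real.pi / 3 - η) {s : ℂ} (hs : ‖s - s0‖ ≤ η / 2) :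
    2 + ‖k s‖ ≤ CH * (2 + ‖k s0‖) := by
  have hpi := Real.pi_lt_four
  have hsub : ∀ w ∈ Metric.ball s0 η, w ∈ TT ρ ∧ w.im ≠ 0 := by
    intro w hw
    rw [mem_ball_iff_norm] at hw
    have a := (Complex.abs_re_le_norm (w - s0)).trans_lt hw
    have b := (Complex.abs_im_le_norm (w - s0)).trans_lt hw
    rw [Complex.sub_re] at a
    rw [Complex.sub_im] at b
    have b1 := abs_sub_abs_le_abs_sub w.im s0.im
    have b2 := abs_sub_abs_le_abs_sub s0.im w.im
    rw [abs_sub_comm] at b2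
    refine ⟨⟨?_, ?_⟩, ?_⟩
    · have := (abs_lt.1 a).1
      linarith
    · linarith
    · intro h0
      rw [h0] at b2; simp at b2
      rw [h0] at b; simp at b; linarith
  exact harnack hη (hk.diff.mono fun w hw => (hsub w hw).1)
    (fun w hw h => (hsub w hw).2 (hk.om w (hsub w hw).1 h)) hs

lemma exists_NH : ∃ N : ℕ, CH ≤ 2 ^ N ∧ 2 * Real.log CH ≤ N ∧ 1 ≤ N := by
  obtain ⟨n, hn⟩ := pow_unbounded_of_one_lt CH (show (1:ℝ) < 2 by norm_num)
  obtain ⟨m, hm⟩ := exists_nat_ge (2 * Real.log CH)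
  refine ⟨n + m + 1, hn.le.trans ?_, ?_, by omega⟩
  · exact pow_le_pow_right₀ (by norm_num) (by omega)
  · push_cast; linarith [(Nat.cast_nonneg n : (0:ℝ) ≤ n)]

def NH : ℕ := Classical.choose exists_NH
lemma NH1 : CH ≤ 2 ^ NH := (Classical.choose_spec exists_NH).1
lemma NH2 : 2 * Real.log CH ≤ NH := (Classical.choose_spec exists_NH).2.1
lemma NH3 : 1 ≤ NH := (Classical.choose_spec exists_NH).2.2

lemma KF.chain {ρ : ℝ} {k : ℂ → ℂ} (hk : KF ρ k) {p : ℝ → ℂ}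
    (hp : ∀ η, 0 < η → η ≤ Real.pi / 3 → ρ + 2 ≤ (p η).re ∧ η ≤ |(p η).im| ∧
      |(p η).im| ≤ 2 * Real.pi / 3 - η)
    (hl : ∀ η η', ‖p η - p η'‖ ≤ |η - η'|) {η : ℝ} (h0 : 0 < η) (h1 : η ≤ Real.pi / 3) :
    2 + ‖k (p η)‖ ≤ CH * (2 / η) ^ NH * (2 + ‖k (p (Real.pi / 3))‖) := by
  have := chain_halving (u := fun η => 2 + ‖k (p η)‖) (h := Real.pi / 3) (C := CH) (N := NH)
    (by positivity) CH_pos NH1 (fun y => by positivity) (by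
      intro y hy0 hy1 y' h2 h3
      obtain ⟨a, b, c⟩ := hp y hy0 hy1
      apply hk.har a hy0 b c
      refine (hl _ _).trans ?_
      rw [abs_le]; constructor <;> linarith) η h0 h1
  refine this.trans ?_
  have := CH_pos
  have := Real.pi_lt_four
  gcongr
  linarith

lemma KF.horiz {ρ : ℝ} {k : ℂ → ℂ} (hk : KF ρ k) {x x' : ℝ} (hx : ρ + 2 ≤ x) (h : |x' - x| ≤ 1/2) :
    2 + ‖k (x' + mp)‖ ≤ CH * (2 + ‖k (x + mp)‖) ∧ 2 + ‖k (x' + mm)‖ ≤ CH * (2 + ‖k (x + mm)‖) := by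
  have hpi := Real.pi_gt_three
  have e : ∀ m : ℂ, ((x':ℂ) + m) - (x + m) = ((x' - x : ℝ) : ℂ) := by intro m; push_cast; ring
  constructor
  · apply hk.har (η := 1) (by simpa using hx) one_pos
    · simp; rw [abs_of_pos (by positivity)]; linarith
    · simp; rw [abs_of_pos (by positivity)]; linarith
    · rw [e, Complex.norm_real]; exact h
  · apply hk.har (η := 1) (by simpa using hx) one_pos
    · simp; rw [abs_of_pos (by positivity)]; linarith
    · simp; rw [abs_of_pos (by positivity)]; linarith
    · rw [e, Complex.norm_real]; exact h

lemma KF.horizB {ρ : ℝ} {k : ℂ → ℂ} (hk : KF ρ k) {x x' : ℝ} (hx : ρ + 2 ≤ x) (h : |x' - x| ≤ 1/2) :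
    BB k x' ≤ CH * BB k x := by
  obtain ⟨a, b⟩ := hk.horiz hx h
  unfold BB; linarith

lemma KF.vert {ρ : ℝ} {k : ℂ → ℂ} (hk : KF ρ k) {x y η : ℝ} (hx : ρ + 2 ≤ x) (h0 : 0 < η)
    (h1 : η ≤ Real.pi / 3) (hy : |y| = η ∨ |y| = 2 * Real.pi / 3 - η) :
    2 + ‖k (x + y * I)‖ ≤ CH * (2 / η) ^ NH * BB k x := by
  have hpi := Real.pi_pos
  have hBp : 2 + ‖k (x + mp)‖ ≤ BB k x := by unfold BB; linarith [norm_nonneg (k (x + mm))]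
  have hBm : 2 + ‖k (x + mm)‖ ≤ BB k x := by unfold BB; linarith [norm_nonneg (k (x + mp))]
  have hC := CH_pos
  have key : ∀ τ : ℝ → ℝ, (∀ η, 0 < η → η ≤ Real.pi / 3 → η ≤ |τ η| ∧ |τ η| ≤ 2 * Real.pi / 3 - η) →
      (∀ η η', |τ η - τ η'| ≤ |η - η'|) → (τ (Real.pi / 3) = Real.pi / 3 ∨ τ (Real.pi/3) = -(Real.pi/3)) →
      2 + ‖k (x + (τ η : ℝ) * I)‖ ≤ CH * (2 / η) ^ NH * BB k x := by
    intro τ t1 t2 t3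
    have := hk.chain (p := fun η => x + (τ η : ℝ) * I) (by
      intro η a b
      simp only [add_re, ofReal_re, mul_re, I_re, mul_zero, ofReal_im, I_im, mul_one, sub_self,
        add_zero, add_im, mul_im, zero_add, zero_mul]
      exact ⟨hx, t1 η a b⟩) (by
      intro η η'
      have : ((x:ℂ) + (τ η : ℝ) * I) - (x + (τ η' : ℝ) * I) = ((τ η - τ η' : ℝ) : ℂ) * I := by push_cast; ring
      simp only [this, norm_mul, Complex.norm_real, norm_I, mul_one]
      exact t2 η η') h0 h1
    refine this.trans ?_
    gcongr
    rcases t3 with t | t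
    · simp only [t]; exact hBp
    · simp only [t]; exact hBm
  rcases hy with hy | hy
  · rcases abs_cases y with ⟨a, b⟩ | ⟨a, b⟩
    · have e : y = η := by linarith
      rw [e]
      exact key (fun η => η) (by intro η a b; rw [abs_of_pos a]; constructor <;> linarith) (by simp) (by simp)
    · have e : y = -η := by linarith
      rw [e]
      refine key (fun η => -η) (by intro η a b; rw [abs_neg, abs_of_pos a]; constructor <;> linarith) (fun a b => ?_) (by simp)
      rw [abs_sub_comm]; apply le_of_eq; congr 1; ring
  · rcases abs_cases y with ⟨a, b⟩ | ⟨a, b⟩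
    · have e : y = 2 * Real.pi / 3 - η := by linarith
      rw [e]
      refine key (fun η => 2 * Real.pi / 3 - η) (by intro η a b; rw [abs_of_pos (by linarith)]; constructor <;> linarith) (fun a b => ?_) ?_
      · rw [abs_sub_comm]; apply le_of_eq; congr 1; ring
      · left; ring
    · have e : y = η - 2 * Real.pi / 3 := by linarith
      rw [e]
      refine key (fun η => η - 2 * Real.pi / 3) (by intro η a b; rw [abs_of_neg (by linarith)]; constructor <;> linarith) (fun a b => ?_) ?_
      · apply le_of_eq; congr 1; ring
      · right; ring

/-- bound near the real axis -/
lemma KF.mid {ρ : ℝ} {k : ℂ → ℂ} (hk : KF ρ k) {x : ℝ} (hx : ρ + 3 ≤ x) {s : ℂ} (hs : ‖s - x‖ ≤ 1/4) :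
    ‖k s‖ ≤ (16/3) ^ NH * (CH * 2 ^ NH * (CH * BB k x)) := by
  have hC := CH_pos
  have hB := BB_pos k x
  have hpi := Real.pi_gt_three
  have hsub : Metric.closedBall (x:ℂ) (1/2) ⊆ TT ρ := by
    intro w hw
    rw [mem_closedBall_iff_norm] at hw
    have a := (Complex.abs_re_le_norm (w - x)).trans hw
    have b := (Complex.abs_im_le_norm (w - x)).trans hw
    simp at a b
    refine ⟨?_, ?_⟩
    · have := (abs_le.1 a).1
      linarith
    · linarith
  have hd : DiffContOnCl ℂ (fun w => ((w - x) ^ 2 - 1/4) ^ NH * k w) (Metric.ball (x:ℂ) (1/2)) := by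
    apply DifferentiableOn.diffContOnCl
    rw [closure_ball _ (by norm_num)]
    apply DifferentiableOn.mul (by fun_prop) (hk.diff.mono hsub)
  have hmm := Complex.norm_le_of_forall_mem_frontier_norm_le Metric.isBounded_ball hd
    (C := CH * 2 ^ NH * (CH * BB k x)) (by
      intro w hw
      rw [frontier_ball _ (by norm_num), mem_sphere_iff_norm] at hw
      have hn : ‖(w - x) ^ 2 - 1/4‖ = |w.im| := by
        have h2 : (w - x).re ^ 2 + (w - x).im ^ 2 = 1/4 := by
          have := Complex.sq_norm (w - x)
          rw [hw, Complex.normSq_apply] at this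
          linarith
        have h3 : (w - x).im = w.im := by simp
        have : ‖(w - x) ^ 2 - 1/4‖ ^ 2 = |w.im| ^ 2 := by
          rw [Complex.sq_norm, Complex.normSq_apply, sq_abs]
          have e1 : ((w - x) ^ 2 - 1/4).re = (w-x).re ^ 2 - (w - x).im ^ 2 - 1/4 := by
            rw [Complex.sub_re, pow_two, Complex.mul_re]; norm_num; ring
          have e2 : ((w - x) ^ 2 - 1/4).im = 2 * (w-x).re * (w - x).im := by
            rw [Complex.sub_im, pow_two, Complex.mul_im]; norm_num; ring
          rw [e1, e2, ← h3]
          have h4 : (w-x).re ^ 2 = 1/4 - (w - x).im ^ 2 := by linarith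
          have : (2 * (w-x).re * (w - x).im) * (2 * (w-x).re * (w - x).im) = 4 * (w-x).re ^ 2 * (w - x).im ^ 2 := by ring
          rw [this, h4]; ring
        exact (pow_left_inj₀ (norm_nonneg _) (abs_nonneg _) two_ne_zero).1 this
      rw [norm_mul, norm_pow, hn]
      by_cases h0 : w.im = 0
      · rw [h0]; simp [show NH ≠ 0 by have := NH3; omega]; positivity
      · have a := (Complex.abs_re_le_norm (w - x)).trans hw.le
        have b := (Complex.abs_im_le_norm (w - x)).trans hw.le
        simp at a b
        have h0' : 0 < |w.im| := abs_pos.2 h0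
        have hre : ρ + 2 ≤ w.re := by have := (abs_le.1 a).1; linarith
        have v := hk.vert (y := w.im) (η := |w.im|) hre h0' (by linarith) (Or.inl rfl)
        rw [Complex.re_add_im] at v
        have hor := hk.horizB (x := x) (x' := w.re) (by linarith) (by linarith)
        have v2 : ‖k w‖ ≤ CH * (2 / |w.im|) ^ NH * (CH * BB k x) := by
          calc ‖k w‖ ≤ CH * (2 / |w.im|) ^ NH * BB k w.re := by linarith
            _ ≤ _ := by gcongr
        calc |w.im| ^ NH * ‖k w‖ ≤ |w.im| ^ NH * (CH * (2 / |w.im|) ^ NH * (CH * BB k x)) := by gcongr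
          _ = CH * 2 ^ NH * (CH * BB k x) := by
            rw [div_pow]; field_simp) (z := s) (subset_closure (by
            rw [mem_ball_iff_norm]; linarith))
  rw [norm_mul, norm_pow] at hmm
  have hlow : (3/16 : ℝ) ≤ ‖(s - x) ^ 2 - 1/4‖ := by
    have h1 : ‖(s - x) ^ 2‖ ≤ 1/16 := by
      rw [norm_pow]
      calc ‖s - x‖ ^ 2 ≤ (1/4) ^ 2 := by gcongr
        _ = _ := by norm_num
    have h2 := norm_sub_norm_le (1/4 : ℂ) ((s - x)^2)
    rw [norm_sub_rev] at h2
    have : ‖(1/4 : ℂ)‖ = 1/4 := by simp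
    rw [this] at h2
    linarith
  have h3 : (3/16 : ℝ) ^ NH * ‖k s‖ ≤ CH * 2 ^ NH * (CH * BB k x) := by
    refine le_trans ?_ hmm
    gcongr
  calc ‖k s‖ = (16/3) ^ NH * ((3/16) ^ NH * ‖k s‖) := by
        rw [← mul_assoc, ← mul_pow]; norm_num
    _ ≤ _ := by gcongr

def CB : ℝ := 2 * (8 * 6) ^ NH * (CH * (CH * CH))

lemma CB_pos : 0 < CB := by
  have := CH_pos
  unfold CB; positivity

lemma KF.box {ρ : ℝ} {k : ℂ → ℂ} (hk : KF ρ k) {x y : ℝ} (hx : ρ + 3 ≤ x) (hy : |y| < 2 * Real.pi / 3) :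
    2 + ‖k (x + y * I)‖ ≤ 2 * (8 * 6) ^ NH * (CH * CH) * ((2 * Real.pi / 3 - |y|)⁻¹) ^ NH * BB k x := by
  have hC := CH_pos
  have hB := BB_pos k x
  have hpi := Real.pi_gt_three
  have hpi2 := Real.pi_lt_d2
  set d := 2 * Real.pi / 3 - |y| with hd
  have hdp : 0 < d := by linarith
  have hd3 : d ≤ 3 := by have := abs_nonneg y; linarith
  have h3 : (1/3 : ℝ) ≤ d⁻¹ := by
    rw [one_div]; exact inv_anti₀ hdp hd3
  have hCC : CH ≤ CH * CH := by nlinarith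
  rcases lt_or_ge |y| (1/4) with h | h
  · have m := hk.mid hx (s := x + y * I) (by simp; linarith)
    have h32 : (32/3 : ℝ) ^ NH ≤ 16 ^ NH * 1 ^ NH := by
      rw [one_pow, mul_one]; gcongr; norm_num
    have e : (16/3 : ℝ) ^ NH * (CH * 2 ^ NH * (CH * BB k x)) = (32/3) ^ NH * (CH * CH) * BB k x := by
      rw [show (32/3 : ℝ) = 16/3 * 2 by norm_num, mul_pow]; ring
    rw [e] at m
    have h4 : (32/3 : ℝ) ^ NH ≤ (8 * 6) ^ NH * d⁻¹ ^ NH := by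
      rw [← mul_pow]; gcongr; linarith
    have h5 : 1 ≤ (32/3 : ℝ) ^ NH := one_le_pow₀ (by norm_num)
    have h6 : 1 ≤ CH * CH := by nlinarith
    have h7 : 2 ≤ (32/3 : ℝ) ^ NH * (CH * CH) * BB k x := by
      have : 1 ≤ (32/3 : ℝ) ^ NH * (CH * CH) := one_le_mul_of_one_le_of_one_le h5 h6
      nlinarith
    calc 2 + ‖k (x + y * I)‖ ≤ 2 * ((32/3 : ℝ) ^ NH * (CH * CH) * BB k x) := by linarith
      _ ≤ 2 * (((8 * 6) ^ NH * d⁻¹ ^ NH) * (CH * CH) * BB k x) := by gcongr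
      _ = _ := by ring
  · have fin : ∀ η : ℝ, 0 < η → η⁻¹ ≤ 24 * d⁻¹ → CH * (2 / η) ^ NH * BB k x ≤
        2 * (8 * 6) ^ NH * (CH * CH) * d⁻¹ ^ NH * BB k x := by
      intro η h0 h1
      have : (2 / η) ^ NH ≤ (8 * 6) ^ NH * d⁻¹ ^ NH := by
        rw [← mul_pow, div_eq_mul_inv]
        exact pow_le_pow_left₀ (by positivity) (by linarith) _
      calc CH * (2 / η) ^ NH * BB k x ≤ CH * ((8 * 6) ^ NH * d⁻¹ ^ NH) * BB k x := by gcongr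
        _ ≤ (2 * (CH * CH)) * ((8 * 6) ^ NH * d⁻¹ ^ NH) * BB k x := by gcongr; linarith
        _ = _ := by ring
    rcases le_or_gt |y| (Real.pi / 3) with h' | h'
    · refine (hk.vert (by linarith) (η := |y|) (by linarith) h' (Or.inl rfl)).trans (fin _ (by linarith) ?_)
      have : |y|⁻¹ ≤ 4 := by
        rw [show (4:ℝ) = (1/4)⁻¹ by norm_num]
        exact inv_anti₀ (by norm_num) h
      linarith
    · refine (hk.vert (by linarith) (η := d) hdp (by linarith) (Or.inr (by linarith))).trans (fin _ hdp ?_)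
      have : 0 < d⁻¹ := by positivity
      linarith

lemma KF.horizB_iter {ρ : ℝ} {k : ℂ → ℂ} (hk : KF ρ k) (n : ℕ) : ∀ {x x' : ℝ}, ρ + 2 ≤ x → ρ + 2 ≤ x' →
    |x' - x| ≤ n / 2 → BB k x' ≤ CH ^ n * BB k x := by
  have hC := CH_pos
  induction n with
  | zero =>
    intro x x' h1 h2 h3
    have : x' = x := by
      have : |x' - x| ≤ 0 := by simpa using h3
      have := abs_nonpos_iff.1 this
      linarith
    simp [this]
  | succ n ih =>
    intro x x' h1 h2 h3
    push_cast at h3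
    obtain ⟨x1, a, b, c⟩ : ∃ x1 : ℝ, ρ + 2 ≤ x1 ∧ |x1 - x| ≤ n / 2 ∧ |x' - x1| ≤ 1/2 := by
      have hn : (0:ℝ) ≤ n := Nat.cast_nonneg n
      have h4 := abs_le.1 h3
      have hpos : (0:ℝ) < n + 1 := by linarith
      refine ⟨x' - (x' - x) / (n+1), ?_, ?_, ?_⟩
      · have : x' - (x' - x) / (n+1) = (n * x' + x) / (n+1) := by field_simp; ring
        rw [this, le_div_iff₀ hpos]
        nlinarith
      · have : x' - (x' - x) / (n+1) - x = (x' - x) * (n / (n+1)) := by field_simp; ring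
        rw [this, abs_mul, abs_of_nonneg (show (0:ℝ) ≤ n / (n+1) by positivity)]
        calc |x' - x| * (n / (n+1)) ≤ (n+1)/2 * (n/(n+1)) := by gcongr
          _ = n / 2 := by field_simp
      · have : x' - (x' - (x' - x) / (n+1)) = (x' - x) / (n+1) := by ring
        rw [this, abs_div, abs_of_pos hpos, div_le_iff₀ hpos]
        linarith
    calc BB k x' ≤ CH * BB k x1 := hk.horizB a c
      _ ≤ CH * (CH ^ n * BB k x) := by gcongr; exact ih h1 a b
      _ = _ := by ring

lemma KF.horizB_exp {ρ : ℝ} {k : ℂ → ℂ} (hk : KF ρ k) {x t : ℝ} (h1 : ρ + 2 ≤ x) (h2 : ρ + 2 ≤ x + t) :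
    BB k (x + t) ≤ CH * Real.exp (NH * |t|) * BB k x := by
  have hC := CH_pos
  have h := hk.horizB_iter (⌈2 * |t|⌉₊) (x := x) (x' := x + t) h1 h2 (by
    have := Nat.le_ceil (2 * |t|)
    rw [show x + t - x = t by ring]; linarith)
  refine h.trans ?_
  have hB := BB_pos k x
  gcongr
  have h3 := (Nat.ceil_lt_add_one (show 0 ≤ 2 * |t| by positivity)).le
  have hl : 0 ≤ Real.log CH := Real.log_nonneg hC
  have e : CH ^ ⌈2 * |t|⌉₊ = Real.exp (Real.log CH * ⌈2 * |t|⌉₊) := by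
    rw [mul_comm (Real.log CH), Real.exp_nat_mul, Real.exp_log (by linarith)]
  rw [e]
  calc Real.exp (Real.log CH * ⌈2 * |t|⌉₊) ≤ Real.exp (Real.log CH + NH * |t|) := by
        apply Real.exp_le_exp.2
        have := NH2
        have h4 : Real.log CH * ⌈2 * |t|⌉₊ ≤ Real.log CH * (2 * |t| + 1) := by gcongr
        have h5 : 2 * Real.log CH * |t| ≤ NH * |t| := by gcongr
        linarith
    _ = _ := by rw [Real.exp_add, Real.exp_log (by linarith)]

/-- The main local bound. -/
lemma KF.bound {ρ : ℝ} {k : ℂ → ℂ} (hk : KF ρ k) {x : ℝ} {s : ℂ} (hs : s ∈ DD) (h1 : ρ + 3 ≤ x)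
    (h2 : ρ + 3 ≤ x + s.re) :
    2 + ‖k (x + s)‖ ≤ CB * ((2 * Real.pi / 3 - |s.im|)⁻¹) ^ NH * Real.exp (NH * |s.re|) * BB k x := by
  have hC := CH_pos
  have hs' : |s.im| < 2 * Real.pi / 3 := hs
  have a := hk.box (x := x + s.re) (y := s.im) h2 hs
  have b := hk.horizB_exp (x := x) (t := s.re) (by linarith) (by linarith)
  have e : ((x + s.re : ℝ) : ℂ) + s.im * I = x + s := by
    push_cast; rw [add_assoc, Complex.re_add_im]
  rw [e] at a
  refine a.trans ?_
  have : 0 < (2 * Real.pi / 3 - |s.im|)⁻¹ := inv_pos.2 (by linarith)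
  calc _ ≤ 2 * (8 * 6) ^ NH * (CH * CH) * ((2 * Real.pi / 3 - |s.im|)⁻¹) ^ NH * (CH * Real.exp (NH * |s.re|) * BB k x) := by gcongr
    _ = _ := by unfold CB; ring

end

section

def sh (k : ℂ → ℂ) (x : ℝ) : ℤ := round ((k (x + mp)).im / (2 * Real.pi))
def kx (k : ℂ → ℂ) (x : ℝ) (s : ℂ) : ℂ := k (x + s) - sh k x * (2 * Real.pi * I)
def bx (k : ℂ → ℂ) (x : ℝ) : ℝ := |(k (x + mp)).re|

lemma isOpen_TT (ρ : ℝ) : IsOpen (TT ρ) := by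
  apply IsOpen.and
  · exact isOpen_lt continuous_const Complex.continuous_re
  · exact isOpen_lt (Complex.continuous_im.abs) continuous_const
lemma isOpen_DD : IsOpen DD := isOpen_lt (Complex.continuous_im.abs) continuous_const
lemma isOpen_SP : IsOpen SP :=
  (isOpen_lt continuous_const Complex.continuous_im).and (isOpen_lt Complex.continuous_im continuous_const)
lemma isOpen_SM : IsOpen SM :=
  (isOpen_lt continuous_const Complex.continuous_im).and (isOpen_lt Complex.continuous_im continuous_const)
lemma convex_im (a b : ℝ) : Convex ℝ {s : ℂ | a < s.im ∧ s.im < b} :=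
  (convex_halfSpace_im_gt a).inter (convex_halfSpace_im_lt b)
lemma convex_SP : Convex ℝ SP := convex_im _ _
lemma convex_SM : Convex ℝ SM := convex_im _ _
lemma DD_eq : DD = {s : ℂ | -(2 * Real.pi / 3) < s.im ∧ s.im < 2 * Real.pi / 3} := by
  ext s; simp only [DD, mem_ofPred_eq, abs_lt]
lemma convex_DD : Convex ℝ DD := by rw [DD_eq]; exact convex_im _ _
lemma convex_TT (ρ : ℝ) : Convex ℝ (TT ρ) := by
  have : TT ρ = {s : ℂ | ρ < s.re} ∩ DD := by ext s; simp [TT, DD]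
  rw [this]; exact (convex_halfSpace_re_gt ρ).inter convex_DD
lemma SP_sub : SP ⊆ DD := by
  intro s hs
  have h1 := hs.1
  have h2 := hs.2
  show |s.im| < _
  rw [abs_lt]; constructor <;> linarith
lemma SM_sub : SM ⊆ DD := by
  intro s hs
  have h1 := hs.1
  have h2 := hs.2
  show |s.im| < _
  rw [abs_lt]; constructor <;> linarith
lemma mp_mem : mp ∈ SP := by
  have := Real.pi_pos
  simp only [SP, mem_ofPred_eq, mp_im]; constructor <;> linarith
lemma mm_mem : mm ∈ SM := by
  have := Real.pi_pos
  simp only [SM, mem_ofPred_eq, mm_im]; constructor <;> linarith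

lemma exp_kx (k : ℂ → ℂ) (x : ℝ) (s : ℂ) : Complex.exp (kx k x s) = Complex.exp (k (x + s)) := by
  unfold kx
  rw [Complex.exp_sub, Complex.exp_int_mul_two_pi_mul_I, div_one]

lemma kx_re (k : ℂ → ℂ) (x : ℝ) (s : ℂ) : (kx k x s).re = (k (x + s)).re := by
  simp [kx]

lemma kx_mp_im (k : ℂ → ℂ) (x : ℝ) : |(kx k x mp).im| ≤ Real.pi := by
  have hpi := Real.pi_pos
  have h := abs_sub_round ((k (x + mp)).im / (2 * Real.pi))
  have e : (kx k x mp).im = 2 * Real.pi * ((k (x + mp)).im / (2 * Real.pi) - sh k x) := by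
    simp [kx]; field_simp
  rw [e, abs_mul, abs_of_pos (by positivity)]
  unfold sh
  calc 2 * Real.pi * _ ≤ 2 * Real.pi * (1/2) := by gcongr
    _ = _ := by ring

lemma KF.shift {ρ : ℝ} {k : ℂ → ℂ} (hk : KF ρ k) (n : ℤ) : KF ρ (fun s => k s - n * (2 * Real.pi * I)) := by
  refine ⟨hk.diff.sub_const _, fun s hs h => hk.om s hs ?_⟩
  rwa [Complex.exp_sub, Complex.exp_int_mul_two_pi_mul_I, div_one] at h

def Bs (k : ℂ → ℂ) (x : ℝ) : ℝ := (2 + ‖kx k x mp‖) + (2 + ‖kx k x mm‖)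

lemma Bs_pos (k : ℂ → ℂ) (x : ℝ) : 4 ≤ Bs k x := by
  unfold Bs; linarith [norm_nonneg (kx k x mp), norm_nonneg (kx k x mm)]

lemma KF.kx_bound {ρ : ℝ} {k : ℂ → ℂ} (hk : KF ρ k) {x : ℝ} {s : ℂ} (hs : s ∈ DD) (h1 : ρ + 3 ≤ x)
    (h2 : ρ + 3 ≤ x + s.re) :
    ‖kx k x s‖ ≤ CB * ((2 * Real.pi / 3 - |s.im|)⁻¹) ^ NH * Real.exp (NH * |s.re|) * Bs k x := by
  have := (hk.shift (sh k x)).bound hs h1 h2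
  have e : BB (fun s => k s - (sh k x : ℤ) * (2 * Real.pi * I)) x = Bs k x := rfl
  rw [e] at this
  have : 2 + ‖kx k x s‖ ≤ _ := this
  linarith

/-- The growth bound function. -/
def GB (M : ℝ) (s : ℂ) : ℝ := CB * ((2 * Real.pi / 3 - |s.im|)⁻¹) ^ NH * Real.exp (NH * |s.re|) * M

lemma GB_cont (M : ℝ) {s : ℂ} (hs : s ∈ DD) : ContinuousAt (GB M) s := by
  have hs' : |s.im| < 2 * Real.pi / 3 := hs
  unfold GB
  apply ContinuousAt.mul _ continuousAt_const
  apply ContinuousAt.mul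
  · apply ContinuousAt.mul continuousAt_const
    apply ContinuousAt.pow
    apply ContinuousAt.inv₀
    · fun_prop
    · linarith
  · fun_prop

lemma KF.lu {ρ : ℝ} {k : ℂ → ℂ} (hk : KF ρ k) (u : Ultrafilter ℝ) (hu : (u : Filter ℝ) ≤ atTop)
    (c : ℝ → ℝ) (M : ℝ) (hc : ∀ᶠ x in (u : Filter ℝ), 0 < c x ∧ Bs k x ≤ M * c x) :
    ∃ G, LU (u : Filter ℝ) (fun x s => kx k x s / c x) G DD ∧ ∀ s ∈ DD, ‖G s‖ ≤ GB M s := by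
  have hbd : ∀ s ∈ DD, ∀ x, ρ + 3 ≤ x → ρ + 3 ≤ x + s.re → 0 < c x → Bs k x ≤ M * c x →
      ‖kx k x s / c x‖ ≤ GB M s := by
    intro s hs x h1 h2 h3 h4
    have := hk.kx_bound hs h1 h2
    have hs' : |s.im| < 2 * Real.pi / 3 := hs
    have hi : 0 < (2 * Real.pi / 3 - |s.im|)⁻¹ := inv_pos.2 (by linarith)
    have := CB_pos
    rw [norm_div, Complex.norm_real, Real.norm_of_nonneg h3.le, div_le_iff₀ h3]
    unfold GB
    calc ‖kx k x s‖ ≤ CB * ((2 * Real.pi / 3 - |s.im|)⁻¹) ^ NH * Real.exp (NH * |s.re|) * Bs k x := by assumption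
      _ ≤ CB * ((2 * Real.pi / 3 - |s.im|)⁻¹) ^ NH * Real.exp (NH * |s.re|) * (M * c x) := by gcongr
      _ = _ := by ring
  have hM : ∃ G, LU (u : Filter ℝ) (fun x s => kx k x s / c x) G DD := by
    apply montel_uf
    intro s hs
    obtain ⟨r1, hr1, hsub1⟩ := Metric.isOpen_iff.1 isOpen_DD s hs
    have hc1 := GB_cont M hs
    have hlt : ∀ᶠ w in 𝓝 s, GB M w < GB M s + 1 := hc1.eventually (gt_mem_nhds (by linarith))
    obtain ⟨r2, hr2, hsub2⟩ := Metric.eventually_nhds_iff.1 hlt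
    refine ⟨min r1 r2, lt_min hr1 hr2, (Metric.ball_subset_ball (min_le_left _ _)).trans hsub1, GB M s + 1, ?_⟩
    have hx : ∀ᶠ x in (u : Filter ℝ), ρ + 3 + |s.re| + r1 ≤ x := hu (eventually_ge_atTop _)
    filter_upwards [hc, hx] with x hcx hx
    have hre : ∀ w ∈ Metric.ball s (min r1 r2), ρ + 3 ≤ x + w.re ∧ w ∈ DD := by
      intro w hw
      refine ⟨?_, hsub1 (Metric.ball_subset_ball (min_le_left _ _) hw)⟩
      have h1 : ‖w - s‖ < r1 := by
        rw [← dist_eq_norm]; exact lt_of_lt_of_le hw (min_le_left _ _)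
      have h2 := (Complex.abs_re_le_norm (w - s)).trans h1.le
      rw [Complex.sub_re] at h2
      have h3 := (abs_le.1 h2).1
      have h4 := neg_abs_le s.re
      linarith
    constructor
    · apply DifferentiableOn.div_const
      unfold kx
      apply DifferentiableOn.sub_const
      have : (fun s : ℂ => k (x + s)) = k ∘ (fun s : ℂ => x + s) := rfl
      rw [this]
      apply hk.diff.comp (by fun_prop)
      intro w hw
      obtain ⟨a, b⟩ := hre w hw
      refine ⟨by simp; linarith, by simpa [DD] using b⟩
    · intro w hw
      obtain ⟨a, b⟩ := hre w hw
      refine (hbd w b x ?_ a hcx.1 hcx.2).trans (hsub2 (lt_of_lt_of_le hw (min_le_right _ _))).le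
      linarith [abs_nonneg s.re]
  obtain ⟨G, hG⟩ := hM
  refine ⟨G, hG, fun s hs => ?_⟩
  refine le_of_tendsto (hG.tendsto_const hs).norm ?_
  have hx : ∀ᶠ x in (u : Filter ℝ), ρ + 3 + |s.re| ≤ x := hu (eventually_ge_atTop _)
  filter_upwards [hc, hx] with x hcx hx
  apply hbd s hs x _ _ hcx.1 hcx.2
  · linarith [abs_nonneg s.re]
  · linarith [neg_abs_le s.re]

/-- limits of rescaled functions avoid the imaginary axis off the real line -/
lemma KF.avoid {ρ : ℝ} {k : ℂ → ℂ} (hk : KF ρ k) {l : Filter ℝ} [l.NeBot] (hl : l ≤ atTop)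
    {c : ℝ → ℝ} (hc : Tendsto c l atTop) {G : ℂ → ℂ}
    (hG : LU l (fun x s => kx k x s / c x) G DD) {s0 : ℂ} (hs0 : s0 ∈ SP ∪ SM) (hre : (G s0).re = 0) :
    ∀ s ∈ DD, G s = G s0 := by
  set τ : ℝ := (G s0).im with hτ
  have hGs : G s0 = τ * I := by
    apply Complex.ext <;> simp [hre, hτ]
  have main : ∀ V : Set ℂ, IsOpen V → Convex ℝ V → V ⊆ DD → (∀ s ∈ V, s.im ≠ 0) → s0 ∈ V →
      ∀ s ∈ DD, G s = G s0 := by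
    intro V hVo hVc hVD hV0 hsV
    set n : ℝ → ℤ := fun x => ⌊τ * c x / (2 * Real.pi)⌋ with hn
    have hpi := Real.pi_pos
    have hnt : Tendsto (fun x => ((n x : ℝ) * (2 * Real.pi) / c x : ℝ)) l (𝓝 τ) := by
      have hlow : ∀ᶠ x in l, τ - 2 * Real.pi / c x ≤ (n x : ℝ) * (2 * Real.pi) / c x := by
        filter_upwards [hc.eventually_gt_atTop 0] with x hx
        have := (Int.lt_floor_add_one (τ * c x / (2 * Real.pi))).le
        rw [div_le_iff₀ (by positivity)] at this
        rw [le_div_iff₀ hx, sub_mul, div_mul_cancel₀ _ hx.ne']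
        linarith
      have hup : ∀ᶠ x in l, (n x : ℝ) * (2 * Real.pi) / c x ≤ τ := by
        filter_upwards [hc.eventually_gt_atTop 0] with x hx
        have := Int.floor_le (τ * c x / (2 * Real.pi))
        rw [le_div_iff₀ (by positivity)] at this
        rw [div_le_iff₀ hx]
        linarith
      have h0 : Tendsto (fun x => τ - 2 * Real.pi / c x) l (𝓝 τ) := by
        have := (hc.const_div_atTop (2 * Real.pi)).const_sub τ
        simpa using this
      exact tendsto_of_tendsto_of_tendsto_of_le_of_le' h0 tendsto_const_nhds hlow hup
    have hLU : LU l (fun x s => kx k x s / c x - ((n x : ℝ) * (2 * Real.pi) / c x : ℝ) * I) (fun s => G s - τ * I) V := by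
      have hV := hG.mono hVo hVD
      intro z hz
      obtain ⟨r, hr, hrU, hd, ht⟩ := hV z hz
      refine ⟨r, hr, hrU, ?_, ?_⟩
      · filter_upwards [hd] with x hx
        exact hx.sub_const _
      · have h2 : TendstoUniformlyOn (fun x (_ : ℂ) => (((n x : ℝ) * (2 * Real.pi) / c x : ℝ) : ℂ) * I) (fun _ => (τ : ℂ) * I) l (Metric.ball z r) := by
          rw [Metric.tendstoUniformlyOn_iff]
          intro ε hε
          have h3 : Tendsto (fun x => (((n x : ℝ) * (2 * Real.pi) / c x : ℝ) : ℂ) * I) l (𝓝 (τ * I)) :=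
            ((Complex.continuous_ofReal.tendsto τ).comp hnt).mul_const I
          filter_upwards [Metric.tendsto_nhds.1 h3 ε hε] with x hx w _
          rw [dist_comm]; exact hx
        exact ht.sub h2
    have hz := hLU.hurwitz hVo hVc.isPreconnected (by
      intro z hz
      obtain ⟨r, hr, hrV⟩ := Metric.isOpen_iff.1 hVo z hz
      refine ⟨r, hr, ?_⟩
      have hx : ∀ᶠ x in l, ρ + |z.re| + r ≤ x := hl (eventually_ge_atTop _)
      filter_upwards [hx, hc.eventually_gt_atTop 0] with x hx hcx w hw h0
      have h1 : ‖w - z‖ < r := by rw [← dist_eq_norm]; exact hw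
      have h2 := (Complex.abs_re_le_norm (w - z)).trans_lt h1
      rw [Complex.sub_re] at h2
      have h3 := (abs_lt.1 h2).1
      have h4 := neg_abs_le z.re
      have hT : (x : ℂ) + w ∈ TT ρ := ⟨by simp; linarith, by simpa [DD] using hVD (hrV hw)⟩
      have hcx' : (c x : ℂ) ≠ 0 := by exact_mod_cast hcx.ne'
      have : kx k x w = n x * (2 * Real.pi * I) := by
        push_cast at h0
        field_simp at h0
        linear_combination h0
      have h5 : Complex.exp (k (x + w)) = 1 := by
        rw [← exp_kx, this, Complex.exp_int_mul_two_pi_mul_I]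
      have := hk.om _ hT h5
      apply hV0 w (hrV hw)
      simpa using this) hsV (by simp [hGs])
    have hGa : AnalyticOnNhd ℂ G DD := hG.diff.analyticOnNhd isOpen_DD
    have hca : AnalyticOnNhd ℂ (fun _ : ℂ => G s0) DD := analyticOnNhd_const
    have := hGa.eqOn_of_preconnected_of_eventuallyEq hca convex_DD.isPreconnected (hVD hsV)
      (Filter.eventually_of_mem (hVo.mem_nhds hsV) (fun s hs => by
        have := hz s hs
        rw [hGs]; linear_combination this))
    exact fun s hs => this hs
  rcases hs0 with h | h
  · exact main SP isOpen_SP convex_SP SP_sub (fun s hs => hs.1.ne') h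
  · exact main SM isOpen_SM convex_SM SM_sub (fun s hs => hs.2.ne) h

/-- data for type H -/
structure HD (u : Filter ℝ) (k : ℂ → ℂ) (H : ℂ → ℂ) (M : ℝ) : Prop where
  top : Tendsto (bx k) u atTop
  lu : LU u (fun x s => kx k x s / bx k x) H DD
  bd : ∀ s ∈ DD, ‖H s‖ ≤ GB M s
  re : ∀ s ∈ SP ∪ SM, (H s).re ≠ 0
  nm : |(H mp).re| = 1
  im : (H mp).im = 0

lemma KF.dich {ρ : ℝ} {k : ℂ → ℂ} (hk : KF ρ k) (u : Ultrafilter ℝ) (hu : (u : Filter ℝ) ≤ atTop) :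
    (∃ K, LU (u : Filter ℝ) (kx k) K DD) ∨ ∃ H M, HD (u : Filter ℝ) k H M := by
  rcases uf_real_dichotomy u (Bs k) with ⟨C, hC⟩ | hB
  · left
    obtain ⟨G, hG, -⟩ := hk.lu u hu (fun _ => 1) C (by
      filter_upwards [hC] with x hx
      exact ⟨one_pos, by simpa using hx⟩)
    refine ⟨G, ?_⟩
    simpa using hG
  · right
    obtain ⟨G, hG, -⟩ := hk.lu u hu (Bs k) 1 (Eventually.of_forall fun x => ⟨by linarith [Bs_pos k x], by simp⟩)
    have hmp := hG.tendsto_const (SP_sub mp_mem)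
    have hmm := hG.tendsto_const (SM_sub mm_mem)
    have himz : (G mp).im = 0 := by
      have h1 : Tendsto (fun x => (kx k x mp / Bs k x).im) u (𝓝 (G mp).im) :=
        (Complex.continuous_im.tendsto _).comp hmp
      have h2 : Tendsto (fun x => (kx k x mp / Bs k x).im) u (𝓝 0) := by
        apply squeeze_zero_norm (a := fun x => Real.pi / Bs k x)
        · intro x
          have hb := Bs_pos k x
          rw [Complex.div_ofReal_im, norm_div, Real.norm_eq_abs, Real.norm_of_nonneg (by linarith)]
          gcongr
          exact kx_mp_im k x
        · exact hB.const_div_atTop _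
      exact tendsto_nhds_unique h1 h2
    have hsum : ‖G mp‖ + ‖G mm‖ = 1 := by
      have h1 := hmp.norm.add hmm.norm
      have h2 : Tendsto (fun x => ‖kx k x mp / Bs k x‖ + ‖kx k x mm / Bs k x‖) u (𝓝 1) := by
        have h3 : Tendsto (fun x => 1 - 4 / Bs k x) u (𝓝 1) := by
          have := (hB.const_div_atTop 4).const_sub 1
          simpa using this
        refine h3.congr fun x => ?_
        have hb := Bs_pos k x
        rw [norm_div, norm_div, Complex.norm_real, Real.norm_of_nonneg (by linarith : 0 ≤ Bs k x)]
        have : Bs k x ≠ 0 := by linarith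
        field_simp
        unfold Bs; ring
      exact tendsto_nhds_unique h1 h2
    have hrene : (G mp).re ≠ 0 := by
      intro h0
      have := hk.avoid hu hB hG (Or.inl mp_mem) h0 mm (SM_sub mm_mem)
      have hz : G mp = 0 := Complex.ext h0 himz
      rw [this, hz] at hsum
      simp at hsum
    have hbB : Tendsto (fun x => bx k x / Bs k x) u (𝓝 |(G mp).re|) := by
      have h1 : Tendsto (fun x => |(kx k x mp / Bs k x).re|) u (𝓝 |(G mp).re|) :=
        ((Complex.continuous_re.tendsto _).comp hmp).abs
      refine h1.congr fun x => ?_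
      have hb := Bs_pos k x
      rw [Complex.div_ofReal_re, abs_div, abs_of_pos (by linarith : 0 < Bs k x), kx_re]
      rfl
    set β := |(G mp).re| with hβ
    have hβp : 0 < β := abs_pos.2 hrene
    have hev : ∀ᶠ x in (u : Filter ℝ), β / 2 < bx k x / Bs k x := hbB.eventually (lt_mem_nhds (by linarith))
    have hbd : ∀ᶠ x in (u : Filter ℝ), 0 < bx k x ∧ Bs k x ≤ (2/β) * bx k x := by
      filter_upwards [hev] with x hx
      have hb := Bs_pos k x
      rw [lt_div_iff₀ (by linarith)] at hx
      refine ⟨lt_trans (by positivity) hx, ?_⟩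
      rw [div_mul_eq_mul_div, le_div_iff₀ hβp]
      linarith
    have htop : Tendsto (bx k) u atTop := by
      have h1 : Tendsto (fun x => (β/2) * Bs k x) u atTop := hB.const_mul_atTop (by positivity)
      apply tendsto_atTop_mono' _ _ h1
      filter_upwards [hbd] with x hx
      have := hx.2
      rw [div_mul_eq_mul_div, le_div_iff₀ hβp] at this
      linarith
    obtain ⟨H, hH, hHb⟩ := hk.lu u hu (bx k) (2/β) hbd
    have hHmp := hH.tendsto_const (SP_sub mp_mem)
    have hnm : |(H mp).re| = 1 := by
      have h1 : Tendsto (fun x => |(kx k x mp / bx k x).re|) u (𝓝 |(H mp).re|) :=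
        ((Complex.continuous_re.tendsto _).comp hHmp).abs
      refine tendsto_nhds_unique h1 (tendsto_const_nhds.congr' ?_)
      filter_upwards [hbd] with x hx
      rw [Complex.div_ofReal_re, abs_div, kx_re, abs_of_pos hx.1]
      exact (div_self hx.1.ne').symm
    refine ⟨H, 2/β, htop, hH, hHb, ?_, hnm, ?_⟩
    · intro s hs h0
      have h1 := hk.avoid hu htop hH hs h0 mp (SP_sub mp_mem)
      rw [h1, h0] at hnm
      simp at hnm
    · have h1 : Tendsto (fun x => (kx k x mp / bx k x).im) u (𝓝 (H mp).im) :=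
        (Complex.continuous_im.tendsto _).comp hHmp
      have h2 : Tendsto (fun x => (kx k x mp / bx k x).im) u (𝓝 0) := by
        apply squeeze_zero_norm' (a := fun x => Real.pi / bx k x)
        · filter_upwards [hbd] with x hx
          rw [Complex.div_ofReal_im, norm_div, Real.norm_eq_abs, Real.norm_of_nonneg hx.1.le]
          gcongr
          · exact hx.1.le
          · exact kx_mp_im k x
        · exact htop.const_div_atTop _
      exact tendsto_nhds_unique h1 h2

end

section

lemma LU.sub_const {ι : Type*} {l : Filter ι} {f : ι → ℂ → ℂ} {G : ℂ → ℂ} {U : Set ℂ}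
    (h : LU l f G U) (c : ℂ) : LU l (fun i s => f i s - c) (fun s => G s - c) U := by
  intro z hz
  obtain ⟨r, hr, hrU, hd, ht⟩ := h z hz
  refine ⟨r, hr, hrU, ?_, ?_⟩
  · filter_upwards [hd] with x hx
    exact hx.sub_const _
  · rw [Metric.tendstoUniformlyOn_iff] at ht ⊢
    intro ε hε
    filter_upwards [ht ε hε] with i hi w hw
    simpa using hi w hw

lemma KF.avoidN {ρ : ℝ} {k : ℂ → ℂ} (hk : KF ρ k) {l : Filter ℝ} [l.NeBot] (hl : l ≤ atTop)
    {K : ℂ → ℂ} (hG : LU l (kx k) K DD) {s0 : ℂ} (hs0 : s0 ∈ SP ∪ SM) (hre : Complex.exp (K s0) = 1) :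
    ∀ s ∈ DD, K s = K s0 := by
  obtain ⟨n, hn⟩ := Complex.exp_eq_one_iff.1 hre
  have main : ∀ V : Set ℂ, IsOpen V → Convex ℝ V → V ⊆ DD → (∀ s ∈ V, s.im ≠ 0) → s0 ∈ V →
      ∀ s ∈ DD, K s = K s0 := by
    intro V hVo hVc hVD hV0 hsV
    have hz := ((hG.mono hVo hVD).sub_const (K s0)).hurwitz hVo hVc.isPreconnected (by
      intro z hz
      obtain ⟨r, hr, hrV⟩ := Metric.isOpen_iff.1 hVo z hz
      refine ⟨r, hr, ?_⟩
      have hx : ∀ᶠ x in l, ρ + |z.re| + r ≤ x := hl (eventually_ge_atTop _)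
      filter_upwards [hx] with x hx w hw h0
      have h1 : ‖w - z‖ < r := by rw [← dist_eq_norm]; exact hw
      have h2 := (Complex.abs_re_le_norm (w - z)).trans_lt h1
      rw [Complex.sub_re] at h2
      have h3 := (abs_lt.1 h2).1
      have h4 := neg_abs_le z.re
      have hT : (x : ℂ) + w ∈ TT ρ := ⟨by simp; linarith, by simpa [DD] using hVD (hrV hw)⟩
      have h5 : Complex.exp (k (x + w)) = 1 := by
        rw [← exp_kx, sub_eq_zero.1 h0, hre]
      have := hk.om _ hT h5
      apply hV0 w (hrV hw)
      simpa using this) hsV (by simp)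
    have hGa : AnalyticOnNhd ℂ K DD := hG.diff.analyticOnNhd isOpen_DD
    have hca : AnalyticOnNhd ℂ (fun _ : ℂ => K s0) DD := analyticOnNhd_const
    have := hGa.eqOn_of_preconnected_of_eventuallyEq hca convex_DD.isPreconnected (hVD hsV)
      (Filter.eventually_of_mem (hVo.mem_nhds hsV) (fun s hs => by
        have := hz s hs
        linear_combination this))
    exact fun s hs => this hs
  rcases hs0 with h | h
  · exact main SP isOpen_SP convex_SP SP_sub (fun s hs => hs.1.ne') h
  · exact main SM isOpen_SM convex_SM SM_sub (fun s hs => hs.2.ne) h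

def ToTop (u : Filter ℝ) (k : ℂ → ℂ) (V : Set ℂ) : Prop :=
  ∀ s0 ∈ V, ∀ σ : ℝ → ℂ, Tendsto σ u (𝓝 s0) → Tendsto (fun x : ℝ => (k (x + σ x)).re) u atTop
def ToBot (u : Filter ℝ) (k : ℂ → ℂ) (V : Set ℂ) : Prop :=
  ∀ s0 ∈ V, ∀ σ : ℝ → ℂ, Tendsto σ u (𝓝 s0) → Tendsto (fun x : ℝ => (k (x + σ x)).re) u atBot
def To1 (u : Filter ℝ) (k : ℂ → ℂ) (V : Set ℂ) : Prop :=
  ∀ s0 ∈ V, ∀ σ : ℝ → ℂ, Tendsto σ u (𝓝 s0) →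
    Tendsto (fun x : ℝ => Complex.exp (k (x + σ x))) u (𝓝 1)

def HV (u : Filter ℝ) (v : ℝ → ℂ) (c : Fin 4) : Prop :=
  (c = 0 ∧ Tendsto v u (𝓝 0)) ∨ (c = 1 ∧ Tendsto v u (𝓝 1)) ∨
  (c = 2 ∧ Tendsto (fun x => ‖v x‖) u atTop) ∨
  (c = 3 ∧ ∃ y : ℂ, y ≠ 0 ∧ y ≠ 1 ∧ Tendsto v u (𝓝 y))

lemma HV.unique {u : Filter ℝ} [u.NeBot] {v : ℝ → ℂ} {c d : Fin 4} (h1 : HV u v c) (h2 : HV u v d) :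
    c = d := by
  rcases h1 with ⟨rfl, h1⟩ | ⟨rfl, h1⟩ | ⟨rfl, h1⟩ | ⟨rfl, y, hy0, hy1, h1⟩ <;>
  rcases h2 with ⟨rfl, h2⟩ | ⟨rfl, h2⟩ | ⟨rfl, h2⟩ | ⟨rfl, y', hy0', hy1', h2⟩
  all_goals first
    | rfl
    | (exfalso; exact not_tendsto_nhds_of_tendsto_atTop h1 _ h2.norm)
    | (exfalso; exact not_tendsto_nhds_of_tendsto_atTop h2 _ h1.norm)
    | (exfalso; have := tendsto_nhds_unique h1 h2; simp_all)

def nextV : Fin 4 → Fin 4 := ![1, 2, 0, 3]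
def aval : Fin 6 → Fin 4 := ![0, 1, 2, 3, 2, 0]
def bval : Fin 6 → Fin 4 := ![0, 1, 2, 3, 0, 2]

lemma HV.next {u : Filter ℝ} [u.NeBot] {v w : ℝ → ℂ} {c : Fin 4} (h1 : HV u v c)
    (hvw : ∀ᶠ x in u, w x * (1 - v x) = 1) : HV u w (nextV c) := by
  have hw : ∀ᶠ x in u, w x = (1 - v x)⁻¹ := by
    filter_upwards [hvw] with x hx
    exact eq_inv_of_mul_eq_one_left hx
  rcases h1 with ⟨rfl, h1⟩ | ⟨rfl, h1⟩ | ⟨rfl, h1⟩ | ⟨rfl, y, hy0, hy1, h1⟩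
  · right; left
    refine ⟨rfl, ?_⟩
    have := (h1.const_sub 1).inv₀ (by simp)
    refine (this.congr' ?_).trans (by simp)
    filter_upwards [hw] with x hx using hx.symm
  · right; right; left
    refine ⟨rfl, ?_⟩
    have h2 : Tendsto (fun x => ‖1 - v x‖) u (𝓝[>] 0) := by
      rw [tendsto_nhdsWithin_iff]
      refine ⟨by simpa using (h1.const_sub 1).norm, ?_⟩
      filter_upwards [hvw] with x hx
      rw [mem_Ioi, norm_pos_iff]
      intro h0; rw [h0] at hx; simp at hx
    have h3 := tendsto_inv_nhdsGT_zero.comp h2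
    refine h3.congr' ?_
    filter_upwards [hw] with x hx
    rw [hx]; simp
  · left
    refine ⟨rfl, ?_⟩
    rw [tendsto_zero_iff_norm_tendsto_zero]
    have h2 : Tendsto (fun x => ‖1 - v x‖) u atTop := by
      apply tendsto_atTop_mono _ (tendsto_atTop_add_const_right _ (-1) h1)
      intro x
      have := norm_sub_norm_le (v x) 1
      rw [norm_sub_rev] at this
      simp at this
      linarith
    refine (tendsto_inv_atTop_zero.comp h2).congr' ?_
    filter_upwards [hw] with x hx
    rw [hx]; simp
  · right; right; right
    refine ⟨rfl, (1 - y)⁻¹, inv_ne_zero (sub_ne_zero.2 hy1.symm), ?_, ?_⟩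
    · intro h
      rw [inv_eq_one] at h
      apply hy0; linear_combination -h
    · have := (h1.const_sub 1).inv₀ (sub_ne_zero.2 hy1.symm)
      refine this.congr' ?_
      filter_upwards [hw] with x hx using hx.symm

lemma HV_zero_of_bot {u : Filter ℝ} {v : ℝ → ℂ} (h : Tendsto (fun x => (v x).re) u atBot) :
    HV u (fun x => Complex.exp (v x)) 0 := by
  left
  refine ⟨rfl, ?_⟩
  rw [tendsto_zero_iff_norm_tendsto_zero]
  simp only [Complex.norm_exp]
  exact Real.tendsto_exp_atBot.comp h
lemma HV_inf_of_top {u : Filter ℝ} {v : ℝ → ℂ} (h : Tendsto (fun x => (v x).re) u atTop) :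
    HV u (fun x => Complex.exp (v x)) 2 := by
  right; right; left
  refine ⟨rfl, ?_⟩
  simp only [Complex.norm_exp]
  exact Real.tendsto_exp_atTop.comp h

def HK (u : Filter ℝ) (k : ℂ → ℂ) (c : Fin 6) : Prop :=
  (c = 0 ∧ ToBot u k DD) ∨ (c = 1 ∧ To1 u k DD) ∨ (c = 2 ∧ ToTop u k DD) ∨
  (c = 3 ∧ ∃ K, LU u (kx k) K DD ∧ ∀ s ∈ SP ∪ SM, Complex.exp (K s) ≠ 1) ∨
  (c = 4 ∧ ToTop u k SP ∧ ToBot u k SM ∧ ∃ H M, HD u k H M) ∨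
  (c = 5 ∧ ToBot u k SP ∧ ToTop u k SM)

lemma HK.a {u : Filter ℝ} [u.NeBot] {k : ℂ → ℂ} {c : Fin 6} (h : HK u k c) :
    HV u (fun x : ℝ => Complex.exp (k (x + mp))) (aval c) ∧
    HV u (fun x : ℝ => Complex.exp (k (x + mm))) (bval c) := by
  have tp : Tendsto (fun _ : ℝ => mp) u (𝓝 mp) := tendsto_const_nhds
  have tm : Tendsto (fun _ : ℝ => mm) u (𝓝 mm) := tendsto_const_nhds
  have dp := SP_sub mp_mem
  have dm := SM_sub mm_mem
  rcases h with ⟨rfl, h⟩ | ⟨rfl, h⟩ | ⟨rfl, h⟩ | ⟨rfl, K, hK, hne⟩ | ⟨rfl, h, h', -⟩ | ⟨rfl, h, h'⟩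
  · exact ⟨HV_zero_of_bot (h _ dp _ tp), HV_zero_of_bot (h _ dm _ tm)⟩
  · exact ⟨Or.inr (Or.inl ⟨rfl, h _ dp _ tp⟩), Or.inr (Or.inl ⟨rfl, h _ dm _ tm⟩)⟩
  · exact ⟨HV_inf_of_top (h _ dp _ tp), HV_inf_of_top (h _ dm _ tm)⟩
  · have key : ∀ s ∈ SP ∪ SM, HV u (fun x : ℝ => Complex.exp (k (x + s))) 3 := by
      intro s hs
      have hsD : s ∈ DD := hs.elim (fun h => SP_sub h) (fun h => SM_sub h)
      right; right; right
      refine ⟨rfl, Complex.exp (K s), Complex.exp_ne_zero _, hne s hs, ?_⟩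
      have := (Complex.continuous_exp.tendsto _).comp (hK.tendsto_const hsD)
      refine this.congr fun x => ?_
      simp [exp_kx]
    exact ⟨key _ (Or.inl mp_mem), key _ (Or.inr mm_mem)⟩
  · exact ⟨HV_inf_of_top (h _ mp_mem _ tp), HV_zero_of_bot (h' _ mm_mem _ tm)⟩
  · exact ⟨HV_zero_of_bot (h _ mp_mem _ tp), HV_inf_of_top (h' _ mm_mem _ tm)⟩

lemma HD.top_of_pos {u : Filter ℝ} [u.NeBot] {k H : ℂ → ℂ} {M : ℝ} (h : HD u k H M) {s0 : ℂ} (hs : s0 ∈ DD)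
    (hp : 0 < (H s0).re) (σ : ℝ → ℂ) (hσ : Tendsto σ u (𝓝 s0)) :
    Tendsto (fun x : ℝ => (k (x + σ x)).re) u atTop := by
  have h1 := (Complex.continuous_re.tendsto _).comp (h.lu.tendsto hs hσ)
  have h2 := h1.pos_mul_atTop hp h.top
  refine h2.congr' ?_
  filter_upwards [h.top.eventually_gt_atTop 0] with x hx
  simp only [Function.comp]
  rw [Complex.div_ofReal_re, kx_re, div_mul_cancel₀ _ hx.ne']

lemma HD.bot_of_neg {u : Filter ℝ} [u.NeBot] {k H : ℂ → ℂ} {M : ℝ} (h : HD u k H M) {s0 : ℂ} (hs : s0 ∈ DD)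
    (hp : (H s0).re < 0) (σ : ℝ → ℂ) (hσ : Tendsto σ u (𝓝 s0)) :
    Tendsto (fun x : ℝ => (k (x + σ x)).re) u atBot := by
  have h1 := (Complex.continuous_re.tendsto _).comp (h.lu.tendsto hs hσ)
  have h2 := h1.neg_mul_atTop hp h.top
  refine h2.congr' ?_
  filter_upwards [h.top.eventually_gt_atTop 0] with x hx
  simp only [Function.comp]
  rw [Complex.div_ofReal_re, kx_re, div_mul_cancel₀ _ hx.ne']

lemma sign_const {V : Set ℂ} (hV : IsPreconnected V) {g : ℂ → ℝ} (hg : ContinuousOn g V)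
    (hne : ∀ s ∈ V, g s ≠ 0) : (∀ s ∈ V, 0 < g s) ∨ (∀ s ∈ V, g s < 0) := by
  by_contra hcon
  push Not at hcon
  obtain ⟨⟨a, ha, ha'⟩, b, hb, hb'⟩ := hcon
  obtain ⟨c, hc, hc'⟩ := hV.intermediate_value ha hb hg ⟨ha', hb'⟩
  exact hne c hc hc'

lemma DD_cases {s : ℂ} (hs : s ∈ DD) : s ∈ SP ∨ s ∈ SM ∨ s.im = 0 := by
  have h : |s.im| < 2 * Real.pi / 3 := hs
  have := abs_lt.1 h
  rcases lt_trichotomy s.im 0 with h | h | h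
  · exact Or.inr (Or.inl ⟨this.1, h⟩)
  · exact Or.inr (Or.inr h)
  · exact Or.inl ⟨h, this.2⟩

/-- positivity of the real part extends across the real axis -/
lemma pos_ext {H : ℂ → ℂ} (hH : DifferentiableOn ℂ H DD) (hpos : ∀ s ∈ SP ∪ SM, 0 < (H s).re) :
    ∀ s ∈ DD, 0 < (H s).re := by
  have hge : ∀ s ∈ DD, 0 ≤ (H s).re := by
    intro s hs
    rcases DD_cases hs with h | h | h
    · exact (hpos s (Or.inl h)).le
    · exact (hpos s (Or.inr h)).le
    · have hc : ContinuousAt H s := hH.continuousOn.continuousAt (isOpen_DD.mem_nhds hs)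
      have ht : Tendsto (fun t : ℝ => (s + t * I : ℂ)) (𝓝[>] 0) (𝓝 s) := by
        apply Tendsto.mono_left _ nhdsWithin_le_nhds
        have : Continuous (fun t : ℝ => (s + t * I : ℂ)) := by fun_prop
        simpa using this.tendsto 0
      have h2 := (Complex.continuous_re.tendsto _).comp (hc.tendsto.comp ht)
      refine ge_of_tendsto h2 ?_
      have hp := Real.pi_pos
      filter_upwards [Ioo_mem_nhdsGT (show (0:ℝ) < 2 * Real.pi / 3 by positivity)] with t ht
      refine (hpos _ (Or.inl ?_)).le
      simp only [SP, mem_ofPred_eq, add_im, mul_im, ofReal_re, I_im, mul_one, ofReal_im, I_re, mul_zero, add_zero, h, zero_add]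
      exact ht
  intro s hs
  rcases (hge s hs).lt_or_eq with h | h
  · exact h
  exfalso
  have hmax : IsMaxOn (norm ∘ fun z => Complex.exp (-H z)) DD s := by
    intro z hz
    simp only [Function.comp, mem_ofPred_eq, Complex.norm_exp, neg_re, Real.exp_le_exp]
    rw [← h]; linarith [hge z hz]
  have := Complex.norm_eqOn_of_isPreconnected_of_isMaxOn convex_DD.isPreconnected isOpen_DD
    (hH.neg.cexp) hs hmax (SP_sub mp_mem)
  simp only [Function.comp, Function.const, Complex.norm_exp, Real.exp_eq_exp, Pi.neg_apply, neg_re] at this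
  have h3 := hpos mp (Or.inl mp_mem)
  linarith

lemma KF.kind {ρ : ℝ} {k : ℂ → ℂ} (hk : KF ρ k) (u : Ultrafilter ℝ) (hu : (u : Filter ℝ) ≤ atTop) :
    ∃ c, HK (u : Filter ℝ) k c := by
  rcases hk.dich u hu with ⟨K, hK⟩ | ⟨H, M, hH⟩
  · by_cases h : ∀ s ∈ SP ∪ SM, Complex.exp (K s) ≠ 1
    · exact ⟨3, Or.inr (Or.inr (Or.inr (Or.inl ⟨rfl, K, hK, h⟩)))⟩
    · push Not at h
      obtain ⟨s0, hs0, h1⟩ := h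
      refine ⟨1, Or.inr (Or.inl ⟨rfl, fun s hs σ hσ => ?_⟩)⟩
      have h2 := hk.avoidN hu hK hs0 h1 s hs
      have h3 := (Complex.continuous_exp.tendsto _).comp (hK.tendsto hs hσ)
      rw [h2, h1] at h3
      refine h3.congr fun x => ?_
      simp [exp_kx]
  · have hd := hH.lu.diff
    have hcont : ContinuousOn (fun s => (H s).re) DD := Complex.continuous_re.comp_continuousOn hd.continuousOn
    have h1 := sign_const convex_SP.isPreconnected (hcont.mono SP_sub) (fun s hs => hH.re s (Or.inl hs))
    have h2 := sign_const convex_SM.isPreconnected (hcont.mono SM_sub) (fun s hs => hH.re s (Or.inr hs))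
    rcases h1 with h1 | h1 <;> rcases h2 with h2 | h2
    · refine ⟨2, Or.inr (Or.inr (Or.inl ⟨rfl, fun s hs σ hσ => hH.top_of_pos hs ?_ σ hσ⟩))⟩
      exact pos_ext hd (fun s hs => hs.elim (h1 s) (h2 s)) s hs
    · exact ⟨4, Or.inr (Or.inr (Or.inr (Or.inr (Or.inl ⟨rfl, fun s hs σ hσ => hH.top_of_pos (SP_sub hs) (h1 s hs) σ hσ,
        fun s hs σ hσ => hH.bot_of_neg (SM_sub hs) (h2 s hs) σ hσ, H, M, hH⟩))))⟩
    · exact ⟨5, Or.inr (Or.inr (Or.inr (Or.inr (Or.inr ⟨rfl, fun s hs σ hσ => hH.bot_of_neg (SP_sub hs) (h1 s hs) σ hσ,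
        fun s hs σ hσ => hH.top_of_pos (SM_sub hs) (h2 s hs) σ hσ⟩))))⟩
    · refine ⟨0, Or.inl ⟨rfl, fun s hs σ hσ => hH.bot_of_neg hs ?_ σ hσ⟩⟩
      have := pos_ext (H := fun s => - H s) hd.neg (fun s hs => by
        simp only [neg_re]
        have := hs.elim (h1 s) (h2 s)
        linarith) s hs
      simp only [neg_re] at this
      linarith

/-- the three functions -/
structure Sys (ρ : ℝ) (k : ZMod 3 → ℂ → ℂ) : Prop where
  kf : ∀ j, KF ρ (k j)
  rel : ∀ j s, s ∈ TT ρ → 0 < s.im →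
    Complex.exp (k (j + 1) (s - ((2 * Real.pi / 3 : ℝ) : ℂ) * I)) * (1 - Complex.exp (k j s)) = 1

lemma mp_sub : mp - ((2 * Real.pi / 3 : ℝ) : ℂ) * I = mm := by
  unfold mp mm
  rw [← sub_mul]; congr 1; push_cast; ring

lemma mem_TT {ρ x : ℝ} {s : ℂ} (hs : s ∈ DD) (hx : ρ < x + s.re) : (x : ℂ) + s ∈ TT ρ :=
  ⟨by simpa using hx, by simpa [DD] using hs⟩

lemma Sys.step {ρ : ℝ} {k : ZMod 3 → ℂ → ℂ} (hk : Sys ρ k) {u : Filter ℝ} [u.NeBot] (hu : u ≤ atTop)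
    (j : ZMod 3) {c d : Fin 6} (h1 : HK u (k j) c) (h2 : HK u (k (j+1)) d) :
    nextV (aval c) = bval d := by
  refine HV.unique (HV.next h1.a.1 ?_) h2.a.2
  have : ∀ᶠ x : ℝ in u, ρ < x := hu (eventually_gt_atTop ρ)
  filter_upwards [this] with x hx
  have := hk.rel j (x + mp) (mem_TT (SP_sub mp_mem) (by simpa using hx)) (by simp; positivity)
  rw [add_sub_assoc, mp_sub] at this
  exact this

lemma comb : ∀ a b c : Fin 6, nextV (aval a) = bval b → nextV (aval b) = bval c → nextV (aval c) = bval a →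
    (a = 3 ∧ b = 3 ∧ c = 3) ∨ (a = 4 ∧ b = 4 ∧ c = 4) ∨ (a = 1 ∧ b = 2 ∧ c = 0) ∨
    (a = 0 ∧ b = 1 ∧ c = 2) ∨ (a = 2 ∧ b = 0 ∧ c = 1) := by decide

/-- the trichotomy for systems -/
lemma Sys.tri {ρ : ℝ} {k : ZMod 3 → ℂ → ℂ} (hk : Sys ρ k) (u : Ultrafilter ℝ) (hu : (u : Filter ℝ) ≤ atTop) :
    (∀ j, HK (u : Filter ℝ) (k j) 3) ∨ (∀ j, HK (u : Filter ℝ) (k j) 4) ∨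
    ∃ j, HK (u : Filter ℝ) (k j) 1 ∧ HK (u : Filter ℝ) (k (j+1)) 2 ∧ HK (u : Filter ℝ) (k (j+2)) 0 := by
  obtain ⟨a, ha⟩ := (hk.kf 0).kind u hu
  obtain ⟨b, hb⟩ := (hk.kf 1).kind u hu
  obtain ⟨c, hc⟩ := (hk.kf 2).kind u hu
  have h1 := hk.step hu 0 ha (by simpa using hb)
  have h2 := hk.step hu 1 hb (show HK _ (k (1+1)) c from hc)
  have h3 := hk.step hu 2 hc (show HK _ (k (2+1)) a from ha)
  rcases comb a b c h1 h2 h3 with ⟨rfl, rfl, rfl⟩ | ⟨rfl, rfl, rfl⟩ | ⟨rfl, rfl, rfl⟩ | ⟨rfl, rfl, rfl⟩ | ⟨rfl, rfl, rfl⟩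
  · left; intro j; fin_cases j <;> assumption
  · right; left; intro j; fin_cases j <;> assumption
  · right; right; exact ⟨0, ha, hb, hc⟩
  · right; right; exact ⟨1, hb, hc, ha⟩
  · right; right; exact ⟨2, hc, ha, hb⟩

end

section

/-- entire functions of polynomial growth on arbitrarily large circles are polynomials -/
lemma entire_poly {g : ℂ → ℂ} (hg : Differentiable ℂ g) {C : ℝ} {N : ℕ}
    (h : ∃ᶠ r : ℝ in atTop, ∀ z : ℂ, ‖z‖ = r → ‖g z‖ ≤ C * r ^ N) :
    ∃ p : Polynomial ℂ, p.natDegree ≤ N ∧ ∀ z, g z = p.eval z := by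
  have hz : ∀ n : ℕ, N < n → iteratedDeriv n g 0 = 0 := by
    intro n hn
    by_contra hne
    have hpos : 0 < ‖iteratedDeriv n g 0‖ := norm_pos_iff.2 hne
    have hev : ∀ᶠ r : ℝ in atTop, 1 ≤ r ∧ n.factorial * |C| / ‖iteratedDeriv n g 0‖ < r :=
      (eventually_ge_atTop 1).and (eventually_gt_atTop _)
    obtain ⟨r, hr, hr1, hr2⟩ := (h.and_eventually hev).exists
    have hr0 : 0 < r := by linarith
    have := Complex.norm_iteratedDeriv_le_of_forall_mem_sphere_norm_le (c := 0) (R := r) n hr0 hg.diffContOnCl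
      (fun z hz => hr z (by simpa using hz))
    rw [le_div_iff₀ (by positivity)] at this
    rw [div_lt_iff₀ hpos] at hr2
    have h3 : r ^ (N+1) ≤ r ^ n := pow_le_pow_right₀ hr1 hn
    have h4 : ‖iteratedDeriv n g 0‖ * r ^ (N+1) ≤ n.factorial * (C * r ^ N) :=
      (mul_le_mul_of_nonneg_left h3 hpos.le).trans this
    have h5 : (n.factorial : ℝ) * (C * r ^ N) ≤ n.factorial * |C| * r ^ N := by
      rw [mul_assoc]; gcongr; exact le_abs_self C
    have h6 : ‖iteratedDeriv n g 0‖ * r ^ (N+1) = (r * ‖iteratedDeriv n g 0‖) * r ^ N := by ring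
    have h7 : 0 < r ^ N := by positivity
    rw [h6] at h4
    have := le_of_mul_le_mul_right (h4.trans h5) h7
    linarith
  refine ⟨∑ n ∈ Finset.range (N+1), Polynomial.monomial n ((n.factorial : ℂ)⁻¹ * iteratedDeriv n g 0), ?_, ?_⟩
  · apply Polynomial.natDegree_sum_le_of_forall_le
    intro i hi
    exact (Polynomial.natDegree_monomial_le _).trans (by simpa [Nat.lt_succ_iff] using hi)
  · intro z
    have h1 := Complex.taylorSeries_eq_of_entire' (c := 0) (z := z) hg
    rw [← h1, Polynomial.eval_finsetSum, tsum_eq_sum (s := Finset.range (N+1))]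
    · apply Finset.sum_congr rfl
      intro n hn
      simp
    · intro n hn
      rw [hz n (by simpa using hn)]; simp

/-- functions on the punctured plane of polynomial growth are Laurent polynomials -/
lemma laurent_poly {Φ : ℂ → ℂ} (hd : DifferentiableOn ℂ Φ {0}ᶜ) {C : ℝ} {N : ℕ}
    (hb : ∀ v ≠ 0, ‖Φ v‖ ≤ C * (‖v‖ ^ N + ‖v‖⁻¹ ^ N)) :
    ∃ p : Polynomial ℂ, p.natDegree ≤ 2 * N ∧ ∀ v ≠ 0, v ^ N * Φ v = p.eval v := by
  have hC0 : 0 ≤ C := by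
    have := (norm_nonneg _).trans (hb 1 one_ne_zero)
    norm_num at this; linarith
  have hb' : ∀ v ≠ 0, ‖v ^ N * Φ v‖ ≤ C * (‖v‖ ^ (2 * N) + 1) := by
    intro v hv
    have hv' : 0 < ‖v‖ := norm_pos_iff.2 hv
    rw [norm_mul, norm_pow]
    calc ‖v‖ ^ N * ‖Φ v‖ ≤ ‖v‖ ^ N * (C * (‖v‖ ^ N + ‖v‖⁻¹ ^ N)) := by gcongr; exact hb v hv
      _ = _ := by rw [inv_pow]; field_simp; ring
  set Ψ : ℂ → ℂ := fun v => v ^ N * Φ v with hΨ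
  have hΨd : DifferentiableOn ℂ Ψ {0}ᶜ := by
    apply DifferentiableOn.mul (by fun_prop) hd
  have hup := Complex.differentiableOn_update_limUnder_of_bddAbove (f := Ψ) (s := Metric.ball 0 1) (c := 0)
    (Metric.ball_mem_nhds _ one_pos) (hΨd.mono (fun z hz => hz.2)) (by
      refine ⟨C * 2, ?_⟩
      rintro _ ⟨v, ⟨hv1, hv2⟩, rfl⟩
      have hv1' : ‖v‖ < 1 := by simpa using hv1
      refine (hb' v hv2).trans ?_
      gcongr
      have : ‖v‖ ^ (2 * N) ≤ 1 := pow_le_one₀ (norm_nonneg _) hv1'.le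
      linarith)
  set g := Function.update Ψ 0 (limUnder (𝓝[≠] 0) Ψ) with hgdef
  have hgeq : ∀ v ≠ 0, g v = Ψ v := fun v hv => Function.update_of_ne hv _ _
  have hg : Differentiable ℂ g := by
    intro z
    by_cases hz : z = 0
    · subst hz; exact hup.differentiableAt (Metric.ball_mem_nhds _ one_pos)
    · have h1 : DifferentiableAt ℂ Ψ z := hΨd.differentiableAt (isOpen_compl_singleton.mem_nhds hz)
      refine h1.congr_of_eventuallyEq ?_
      filter_upwards [isOpen_compl_singleton.mem_nhds hz] with w hw using hgeq w hw
  obtain ⟨p, hp1, hp2⟩ := entire_poly (g := g) (C := C * 2) (N := 2 * N) hg (by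
    apply Eventually.frequently
    filter_upwards [eventually_ge_atTop 1] with r hr z hz
    have hz0 : z ≠ 0 := by rintro rfl; simp at hz; linarith
    rw [hgeq z hz0, ← hz]
    refine (hb' z hz0).trans ?_
    have : 1 ≤ ‖z‖ ^ (2 * N) := one_le_pow₀ (by rw [hz]; exact hr)
    nlinarith)
  exact ⟨p, hp1, fun v hv => by rw [← hp2, hgeq v hv]⟩

lemma poly_lim (p : Polynomial ℂ) (n : ℕ) (hn : p.natDegree ≤ n) {w : ℂ} (hw : w ≠ 0) :
    Tendsto (fun R : ℝ => p.eval ((R : ℂ) * w) / ((R : ℂ) * w) ^ n) atTop (𝓝 (p.coeff n)) := by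
  have hl : ∀ R : ℝ, R ≠ 0 → p.eval ((R : ℂ) * w) / ((R : ℂ) * w) ^ n =
      ∑ i ∈ Finset.range (n+1), p.coeff i * ((((R : ℂ) * w)⁻¹) ^ (n - i)) := by
    intro R hR
    have hR' : (R : ℂ) * w ≠ 0 := mul_ne_zero (by exact_mod_cast hR) hw
    rw [Polynomial.eval_eq_sum_range' (Nat.lt_succ_of_le hn), Finset.sum_div]
    apply Finset.sum_congr rfl
    intro i hi
    have : n = i + (n - i) := by have := Finset.mem_range.1 hi; omega
    rw [inv_pow, eq_comm, ← div_eq_mul_inv, div_eq_div_iff (pow_ne_zero _ hR') (pow_ne_zero _ hR')]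
    conv_lhs => rw [this, pow_add]
    ring
  have hlim : Tendsto (fun R : ℝ => ((R : ℂ) * w)⁻¹) atTop (𝓝 0) := by
    have : Tendsto (fun R : ℝ => ((R : ℂ))⁻¹ * w⁻¹) atTop (𝓝 (0 * w⁻¹)) := by
      apply Tendsto.mul_const
      have h := (Complex.continuous_ofReal.tendsto 0).comp tendsto_inv_atTop_zero
      simpa [Function.comp_def] using h
    simpa [mul_comm] using this
  have h2 : Tendsto (fun R : ℝ => ∑ i ∈ Finset.range (n+1), p.coeff i * ((((R : ℂ) * w)⁻¹) ^ (n - i))) atTop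
      (𝓝 (∑ i ∈ Finset.range (n+1), p.coeff i * ((0:ℂ) ^ (n - i)))) := by
    apply tendsto_finsetSum
    intro i _
    exact (hlim.pow _).const_mul _
  rw [Finset.sum_range_succ, Finset.sum_eq_zero] at h2
  · simp only [zero_add, tsub_self, pow_zero, mul_one] at h2
    refine h2.congr' ?_
    filter_upwards [eventually_ne_atTop 0] with R hR using (hl R hR).symm
  · intro i hi
    have := Finset.mem_range.1 hi
    rw [zero_pow (by omega), mul_zero]

lemma rot_nonneg {a : ℂ} {n : ℕ} (hn : 2 ≤ n)
    (h : ∀ θ : ℝ, 0 < θ → θ < Real.pi → 0 ≤ (a * Complex.exp ((n * θ : ℝ) * I)).re) : a = 0 := by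
  have hpi := Real.pi_pos
  have hn' : (2:ℝ) ≤ n := by exact_mod_cast hn
  have hn0 : (0:ℝ) < n := by linarith
  have hz : ∀ θ : ℝ, 0 < θ → θ < Real.pi / 2 → (a * Complex.exp ((n * θ : ℝ) * I)).re = 0 := by
    intro θ h0 h1
    have h2 := h θ h0 (by linarith)
    have hlt : Real.pi / n ≤ Real.pi / 2 := by gcongr
    have h3 := h (θ + Real.pi / n) (by positivity) (by linarith)
    have e : Complex.exp ((n * (θ + Real.pi / n) : ℝ) * I) = - Complex.exp ((n * θ : ℝ) * I) := by
      have : ((n * (θ + Real.pi / n) : ℝ) : ℂ) * I = (n * θ : ℝ) * I + Real.pi * I := by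
        have : (n * (θ + Real.pi / n) : ℝ) = n * θ + Real.pi := by field_simp
        rw [this]; push_cast; ring
      rw [this, Complex.exp_add, Complex.exp_pi_mul_I]; ring
    rw [e, mul_neg, neg_re] at h3
    linarith
  have key : ∀ t : ℝ, 0 < t → t < Real.pi → (a * Complex.exp ((t : ℝ) * I)).re = 0 := by
    intro t h0 h1
    have := hz (t / n) (by positivity) (by rw [div_lt_div_iff₀ hn0 two_pos]; nlinarith)
    rwa [mul_div_cancel₀ _ hn0.ne'] at this
  have h1 := key (Real.pi / 2) (by positivity) (by linarith)
  have h2 := key (Real.pi / 4) (by positivity) (by linarith)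
  rw [Complex.mul_re, Complex.exp_ofReal_mul_I_re, Complex.exp_ofReal_mul_I_im] at h1 h2
  rw [Real.cos_pi_div_two, Real.sin_pi_div_two] at h1
  rw [Real.cos_pi_div_four, Real.sin_pi_div_four] at h2
  have h3 : a.im = 0 := by linarith
  have h4 : a.re = 0 := by
    rw [h3] at h2
    have : (0:ℝ) < √2 / 2 := by positivity
    have h2' : a.re * (√2 / 2) = 0 := by linarith
    exact (mul_eq_zero.1 h2').resolve_right this.ne'
  exact Complex.ext h4 h3

/-- half-plane positivity gives linear growth at infinity -/
lemma laurent_lin {Φ : ℂ → ℂ} (hd : DifferentiableOn ℂ Φ {0}ᶜ) {C : ℝ} {N : ℕ}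
    (hb : ∀ v ≠ 0, ‖Φ v‖ ≤ C * (‖v‖ ^ N + ‖v‖⁻¹ ^ N)) (hp : ∀ v : ℂ, 0 < v.im → 0 ≤ (Φ v).re) :
    ∃ C', 0 ≤ C' ∧ ∀ v : ℂ, 1 ≤ ‖v‖ → ‖Φ v‖ ≤ C' * ‖v‖ := by
  obtain ⟨p, hp1, hp2⟩ := laurent_poly hd hb
  have hdeg : ∀ n, N + 2 ≤ n → p.natDegree ≤ n → p.coeff n = 0 := by
    intro n hn hpn
    apply rot_nonneg (n := n - N) (by omega)
    intro θ h0 h1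
    have hw : Complex.exp (θ * I) ≠ 0 := Complex.exp_ne_zero _
    have hl := poly_lim p n hpn hw
    have h2 := (Complex.continuous_re.tendsto _).comp (hl.mul_const (Complex.exp (((n - N : ℕ) * θ : ℝ) * I)))
    refine ge_of_tendsto h2 ?_
    filter_upwards [eventually_gt_atTop 0] with R hR
    have hv : (R : ℂ) * Complex.exp (θ * I) ≠ 0 := mul_ne_zero (by exact_mod_cast hR.ne') hw
    have hR' : (R:ℂ) ≠ 0 := by exact_mod_cast hR.ne'
    have h3 := hp ((R : ℂ) * Complex.exp (θ * I)) (by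
      rw [Complex.im_ofReal_mul, Complex.exp_ofReal_mul_I_im]
      exact mul_pos hR (Real.sin_pos_of_pos_of_lt_pi h0 h1))
    obtain ⟨d, rfl⟩ : ∃ d, n = N + d := ⟨n - N, by omega⟩
    have e : Complex.exp (((N + d - N : ℕ) * θ : ℝ) * I) = Complex.exp (θ * I) ^ d := by
      rw [← Complex.exp_nat_mul]; congr 1
      rw [Nat.add_sub_cancel_left]; push_cast; ring
    simp only [Function.comp]
    rw [e, ← hp2 _ hv]
    have e2 : ((R : ℂ) * Complex.exp (θ * I)) ^ N * Φ ((R : ℂ) * Complex.exp (θ * I)) /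
        ((R : ℂ) * Complex.exp (θ * I)) ^ (N + d) * Complex.exp (θ * I) ^ d =
        Φ ((R : ℂ) * Complex.exp (θ * I)) / ((R ^ d : ℝ) : ℂ) := by
      rw [pow_add, mul_div_mul_left _ _ (pow_ne_zero _ hv), mul_pow]
      push_cast
      field_simp
    rw [e2, Complex.div_ofReal_re]
    positivity
  have hdeg2 : p.natDegree ≤ N + 1 := by
    by_contra hcon
    push Not at hcon
    have := hdeg p.natDegree (by omega) le_rfl
    have h0 : p = 0 := Polynomial.leadingCoeff_eq_zero.1 this
    rw [h0] at hcon; simp at hcon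
  refine ⟨∑ i ∈ Finset.range (N + 2), ‖p.coeff i‖, by positivity, fun v hv => ?_⟩
  have hv0 : v ≠ 0 := by rintro rfl; norm_num at hv
  have h1 : ‖v ^ N * Φ v‖ ≤ (∑ i ∈ Finset.range (N + 2), ‖p.coeff i‖) * ‖v‖ ^ (N+1) := by
    rw [hp2 v hv0, Polynomial.eval_eq_sum_range' (show p.natDegree < N + 2 by omega), Finset.sum_mul]
    refine (norm_sum_le _ _).trans (Finset.sum_le_sum fun i hi => ?_)
    rw [norm_mul, norm_pow]
    have := Finset.mem_range.1 hi
    gcongr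
    omega
  rw [norm_mul, norm_pow, pow_succ, mul_comm, mul_comm (‖v‖ ^ N) ‖v‖, ← mul_assoc] at h1
  exact le_of_mul_le_mul_right h1 (by positivity)

/-- structure of the limit functions in the plane -/
lemma laurent_one {Φ : ℂ → ℂ} (hd : DifferentiableOn ℂ Φ {0}ᶜ) {C : ℝ} {N : ℕ}
    (hb : ∀ v ≠ 0, ‖Φ v‖ ≤ C * (‖v‖ ^ N + ‖v‖⁻¹ ^ N)) (hp : ∀ v : ℂ, 0 < v.im → 0 ≤ (Φ v).re)
    (hodd : ∀ v ≠ 0, Φ (-v) = - Φ v) :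
    ∃ a b : ℂ, ∀ v ≠ 0, Φ v = a * v + b * v⁻¹ := by
  obtain ⟨C1, hC1, h1⟩ := laurent_lin hd hb hp
  obtain ⟨C2, hC2, h2⟩ := laurent_lin (Φ := fun v => Φ (-v⁻¹)) (C := C) (N := N) (by
    apply hd.comp
    · intro v hv
      exact (differentiableAt_inv hv).neg.differentiableWithinAt
    · intro v hv
      simpa using hv) (by
    intro v hv
    have := hb (-v⁻¹) (by simpa using hv)
    simpa [add_comm] using this) (by
    intro v hv
    apply hp
    rw [neg_im, Complex.inv_im, neg_div, neg_neg]
    have : v ≠ 0 := by rintro rfl; simp at hv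
    have : 0 < Complex.normSq v := Complex.normSq_pos.2 this
    positivity)
  obtain ⟨p, hp1, hp2⟩ := laurent_poly (Φ := Φ) (C := C1 + C2) (N := 1) hd (by
    intro v hv
    have hv' : 0 < ‖v‖ := norm_pos_iff.2 hv
    simp only [pow_one]
    by_cases h : 1 ≤ ‖v‖
    · have := h1 v h
      have h3 : 0 ≤ C2 * ‖v‖ := by positivity
      have h4 : 0 ≤ (C1 + C2) * ‖v‖⁻¹ := by positivity
      nlinarith
    · have := h2 (-v⁻¹) (by
        rw [norm_neg, norm_inv]; exact (one_le_inv₀ hv').2 (by linarith))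
      simp only [norm_neg, norm_inv, inv_neg, inv_inv, neg_neg] at this
      have h3 : 0 ≤ C1 * ‖v‖⁻¹ := by positivity
      have h4 : 0 ≤ (C1 + C2) * ‖v‖ := by positivity
      nlinarith)
  have hform : ∀ v ≠ 0, Φ v = p.coeff 2 * v + p.coeff 1 + p.coeff 0 * v⁻¹ := by
    intro v hv
    have := hp2 v hv
    rw [Polynomial.eval_eq_sum_range' (show p.natDegree < 3 by omega)] at this
    simp only [Finset.sum_range_succ, Finset.sum_range_zero, pow_one, pow_zero] at this
    field_simp
    linear_combination this
  refine ⟨p.coeff 2, p.coeff 0, fun v hv => ?_⟩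
  have h3 := hodd v hv
  rw [hform v hv, hform (-v) (by simpa using hv), inv_neg] at h3
  rw [hform v hv]
  have : p.coeff 1 = 0 := by linear_combination h3 / 2
  rw [this, add_zero]

def PhiH (H : ℂ → ℂ) (v : ℂ) : ℂ :=
  open Classical in
  if v ∈ slitPlane then H ((2/3 : ℝ) * Complex.log v) else - H ((2/3 : ℝ) * Complex.log (-v))

lemma neg_slit {v : ℂ} (hv : v ≠ 0) (h : v ∉ slitPlane) : -v ∈ slitPlane := by
  rw [Complex.mem_slitPlane_iff] at h ⊢
  push Not at h
  left
  rw [neg_re]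
  rcases h.1.lt_or_eq with h1 | h1
  · linarith
  · exact absurd (Complex.ext h1 h.2) hv

lemma log_mem_DD {v : ℂ} (hv : v ∈ slitPlane) : ((2/3 : ℝ) * Complex.log v : ℂ) ∈ DD := by
  have h1 := (Complex.mem_slitPlane_iff_arg.1 hv).1
  have : |Complex.arg v| < Real.pi :=
    abs_lt.2 ⟨Complex.neg_pi_lt_arg v, lt_of_le_of_ne (Complex.arg_le_pi v) h1⟩
  show |((2/3 : ℝ) * Complex.log v : ℂ).im| < 2 * Real.pi / 3
  rw [Complex.im_ofReal_mul, Complex.log_im, abs_mul, abs_of_pos (by norm_num : (0:ℝ) < 2/3)]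
  linarith

lemma antiper_log {H : ℂ → ℂ} (hap : ∀ s ∈ SM, H (s + ((2 * Real.pi / 3 : ℝ) : ℂ) * I) = - H s) {v : ℂ} (hv : 0 < v.im) :
    H ((2/3 : ℝ) * Complex.log v) = - H ((2/3 : ℝ) * Complex.log (-v)) := by
  have hv0 : v ≠ 0 := by rintro rfl; simp at hv
  have e : Complex.log v = Complex.log (-v) + Real.pi * I := by
    rw [Complex.log, Complex.log, Complex.arg_neg_eq_arg_sub_pi_of_im_pos hv, norm_neg]
    push_cast; ring
  have h1 := Complex.arg_lt_pi_iff.2 (Or.inr hv.ne')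
  have h0 : 0 < v.arg := lt_of_le_of_ne (Complex.arg_nonneg_iff.2 hv.le) (by
    intro h; have := Complex.arg_eq_zero_iff.1 h.symm; linarith [this.2])
  rw [← hap]
  · congr 1; rw [e]; push_cast; ring
  · have e2 : (((2/3 : ℝ) * Complex.log (-v) : ℂ)).im = 2/3 * (v.arg - Real.pi) := by
      rw [Complex.im_ofReal_mul, Complex.log_im, Complex.arg_neg_eq_arg_sub_pi_of_im_pos hv]
    constructor
    · rw [e2]; linarith
    · rw [e2]; linarith

lemma PhiH_slit (H : ℂ → ℂ) {v : ℂ} (hv : v ∈ slitPlane) : PhiH H v = H ((2/3 : ℝ) * Complex.log v) := by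
  unfold PhiH; rw [if_pos hv]

lemma PhiH_neg {H : ℂ → ℂ} (hap : ∀ s ∈ SM, H (s + ((2 * Real.pi / 3 : ℝ) : ℂ) * I) = - H s) {v : ℂ}
    (hv : -v ∈ slitPlane) : PhiH H v = - H ((2/3 : ℝ) * Complex.log (-v)) := by
  by_cases h : v ∈ slitPlane
  · rw [PhiH_slit H h]
    rcases lt_trichotomy v.im 0 with h1 | h1 | h1
    · have := antiper_log hap (v := -v) (by simpa using h1)
      rw [neg_neg] at this
      rw [this, neg_neg]
    · exfalso
      rw [Complex.mem_slitPlane_iff] at h hv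
      simp [h1] at h hv
      linarith
    · exact antiper_log hap h1
  · unfold PhiH; rw [if_neg h]

lemma strip_form {H : ℂ → ℂ} (hd : DifferentiableOn ℂ H DD) {M : ℝ} (hbd : ∀ s ∈ DD, ‖H s‖ ≤ GB M s)
    (hap : ∀ s ∈ SM, H (s + ((2 * Real.pi / 3 : ℝ) : ℂ) * I) = - H s) (hpos : ∀ s ∈ SP, 0 < (H s).re) :
    ∃ a b : ℂ, ∀ s ∈ DD, H s = a * Complex.exp ((3/2 : ℝ) * s) + b * Complex.exp (-((3/2 : ℝ) * s)) := by
  have hpi := Real.pi_pos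
  have hodd : ∀ v ≠ 0, PhiH H (-v) = - PhiH H v := by
    intro v hv
    by_cases h : v ∈ slitPlane
    · rw [PhiH_slit H h, PhiH_neg hap (v := -v) (by simpa using h), neg_neg]
    · have := neg_slit hv h
      rw [PhiH_slit H this, PhiH_neg hap this, neg_neg]
  have hdl : ∀ v ∈ slitPlane, DifferentiableAt ℂ (fun v => H ((2/3 : ℝ) * Complex.log v)) v := by
    intro v hv
    have h1 : DifferentiableAt ℂ H ((2/3 : ℝ) * Complex.log v) :=
      hd.differentiableAt (isOpen_DD.mem_nhds (log_mem_DD hv))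
    have h2 : DifferentiableAt ℂ (fun v : ℂ => ((2/3 : ℝ) : ℂ) * Complex.log v) v :=
      (differentiableAt_id.clog hv).const_mul _
    exact h1.comp v h2
  have hdiff : DifferentiableOn ℂ (PhiH H) {0}ᶜ := by
    intro v hv
    apply DifferentiableAt.differentiableWithinAt
    by_cases h : v ∈ slitPlane
    · refine (hdl v h).congr_of_eventuallyEq ?_
      filter_upwards [Complex.isOpen_slitPlane.mem_nhds h] with w hw using PhiH_slit H hw
    · have hn := neg_slit hv h
      have h2 : DifferentiableAt ℂ (fun v => - H ((2/3 : ℝ) * Complex.log (-v))) v := by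
        have := (hdl (-v) hn).comp v (differentiableAt_id.neg)
        exact this.neg
      refine h2.congr_of_eventuallyEq ?_
      have hc : ∀ᶠ w in 𝓝 v, -w ∈ slitPlane :=
        continuous_neg.continuousAt.eventually (Complex.isOpen_slitPlane.mem_nhds hn)
      filter_upwards [hc] with w hw using PhiH_neg hap hw
  set C := CB * ((3 / Real.pi)) ^ NH * |M| with hC
  have hbr : ∀ v : ℂ, v ≠ 0 → 0 ≤ v.re → ‖PhiH H v‖ ≤ C * (‖v‖ ^ NH + ‖v‖⁻¹ ^ NH) := by
    intro v hv hre
    have hs : v ∈ slitPlane := by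
      rw [Complex.mem_slitPlane_iff]
      by_contra hcon
      push Not at hcon
      exact hv (Complex.ext (le_antisymm hcon.1 hre) hcon.2)
    rw [PhiH_slit H hs]
    refine (hbd _ (log_mem_DD hs)).trans ?_
    have hCB := CB_pos
    have hv' : 0 < ‖v‖ := norm_pos_iff.2 hv
    have harg := Complex.abs_arg_le_pi_div_two_iff.2 hre
    unfold GB
    rw [Complex.im_ofReal_mul, Complex.re_ofReal_mul, Complex.log_im, Complex.log_re, hC, abs_mul, abs_mul,
      abs_of_pos (by norm_num : (0:ℝ) < 2/3)]
    have h1 : (2 * Real.pi / 3 - 2 / 3 * |v.arg|)⁻¹ ≤ 3 / Real.pi := by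
      rw [show 3 / Real.pi = (Real.pi / 3)⁻¹ by rw [inv_div]]
      apply inv_anti₀ (by positivity); linarith
    have h0 : 0 ≤ (2 * Real.pi / 3 - 2 / 3 * |v.arg|)⁻¹ := by
      apply inv_nonneg.2; linarith
    have h2 : Real.exp (NH * (2 / 3 * |Real.log ‖v‖|)) ≤ ‖v‖ ^ NH + ‖v‖⁻¹ ^ NH := by
      have e1 : ‖v‖ ^ NH = Real.exp (NH * Real.log ‖v‖) := by
        rw [Real.exp_nat_mul, Real.exp_log hv']
      have e2 : ‖v‖⁻¹ ^ NH = Real.exp (NH * -Real.log ‖v‖) := by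
        rw [Real.exp_nat_mul, Real.exp_neg, Real.exp_log hv']
      have h3 : Real.exp (NH * (2 / 3 * |Real.log ‖v‖|)) ≤ Real.exp (NH * |Real.log ‖v‖|) := by
        apply Real.exp_le_exp.2
        gcongr
        linarith [abs_nonneg (Real.log ‖v‖)]
      refine h3.trans ?_
      rw [e1, e2]
      rcases abs_cases (Real.log ‖v‖) with ⟨h, -⟩ | ⟨h, -⟩ <;> rw [h]
      · linarith [Real.exp_pos (NH * -Real.log ‖v‖)]
      · linarith [Real.exp_pos (NH * Real.log ‖v‖)]
    calc _ ≤ CB * (2 * Real.pi / 3 - 2 / 3 * |v.arg|)⁻¹ ^ NH * Real.exp (NH * (2 / 3 * |Real.log ‖v‖|)) * |M| :=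
          mul_le_mul_of_nonneg_left (le_abs_self M) (by positivity)
      _ ≤ CB * (3 / Real.pi) ^ NH * (‖v‖ ^ NH + ‖v‖⁻¹ ^ NH) * |M| := by
          gcongr
      _ = _ := by ring
  have hb : ∀ v ≠ 0, ‖PhiH H v‖ ≤ C * (‖v‖ ^ NH + ‖v‖⁻¹ ^ NH) := by
    intro v hv
    rcases le_total 0 v.re with h | h
    · exact hbr v hv h
    · have := hbr (-v) (by simpa using hv) (by simpa using h)
      rw [hodd v hv] at this
      simpa using this
  obtain ⟨a, b, hab⟩ := laurent_one hdiff hb (by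
    intro v hv
    have hs : v ∈ slitPlane := Or.inr hv.ne'
    rw [PhiH_slit H hs]
    have h1 := Complex.arg_lt_pi_iff.2 (Or.inr hv.ne')
    have h0 : 0 < v.arg := lt_of_le_of_ne (Complex.arg_nonneg_iff.2 hv.le) (by
      intro h; have := Complex.arg_eq_zero_iff.1 h.symm; linarith [this.2])
    refine (hpos _ ⟨?_, ?_⟩).le
    · rw [Complex.im_ofReal_mul, Complex.log_im]; positivity
    · rw [Complex.im_ofReal_mul, Complex.log_im]; linarith) hodd
  refine ⟨a, b, fun s hs => ?_⟩
  have hs' : |s.im| < 2 * Real.pi / 3 := hs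
  have hs2 := abs_lt.1 hs'
  have hlog : Complex.log (Complex.exp ((3/2 : ℝ) * s)) = (3/2 : ℝ) * s := by
    apply Complex.log_exp
    · rw [Complex.im_ofReal_mul]; linarith
    · rw [Complex.im_ofReal_mul]; linarith
  have hsl : Complex.exp ((3/2 : ℝ) * s) ∈ slitPlane := by
    rw [Complex.mem_slitPlane_iff_arg]
    refine ⟨?_, Complex.exp_ne_zero _⟩
    rw [← Complex.log_im, hlog, Complex.im_ofReal_mul]
    linarith
  have := hab _ (Complex.exp_ne_zero ((3/2 : ℝ) * s))
  rw [PhiH_slit H hsl, hlog, ← Complex.exp_neg] at this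
  rw [← this]
  congr 1
  rw [← mul_assoc, ← Complex.ofReal_mul]; norm_num

end

section

/-- the shift by `2πi/3` -/
def ww : ℂ := ((2 * Real.pi / 3 : ℝ) : ℂ) * I
@[simp] lemma ww_re : ww.re = 0 := by simp [ww]
@[simp] lemma ww_im : ww.im = 2 * Real.pi / 3 := by
  unfold ww; rw [Complex.im_ofReal_mul]; simp

/-- normalized limits in the oscillating case -/
structure HX (u : Filter ℝ) (k : ℂ → ℂ) (H : ℂ → ℂ) (M : ℝ) : Prop extends HD u k H M where
  pos : ∀ s ∈ SP, 0 < (H s).re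
  neg : ∀ s ∈ SM, (H s).re < 0
  one : H mp = 1
  tt : Tendsto (fun x : ℝ => (k (x + mp)).re) u atTop
  tp : ToTop u k SP

lemma HK.hx {u : Filter ℝ} [u.NeBot] {k : ℂ → ℂ} (h : HK u k 4) : ∃ H M, HX u k H M := by
  rcases h with ⟨h0, -⟩ | ⟨h0, -⟩ | ⟨h0, -⟩ | ⟨h0, -⟩ | ⟨-, h1, h2, H, M, hH⟩ | ⟨h0, -⟩
  · exact absurd h0 (by decide)
  · exact absurd h0 (by decide)
  · exact absurd h0 (by decide)
  · exact absurd h0 (by decide)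
  · have ht := h1 mp mp_mem (fun _ => mp) tendsto_const_nhds
    have hb := h2 mm mm_mem (fun _ => mm) tendsto_const_nhds
    have hd := hH.lu.diff
    have hcont : ContinuousOn (fun s => (H s).re) DD := Complex.continuous_re.comp_continuousOn hd.continuousOn
    have hp : 0 ≤ (H mp).re := by
      have := (Complex.continuous_re.tendsto _).comp (hH.lu.tendsto_const (SP_sub mp_mem))
      refine ge_of_tendsto this ?_
      filter_upwards [ht.eventually_ge_atTop 0] with x hx
      simp only [Function.comp]
      rw [Complex.div_ofReal_re, kx_re]
      unfold bx; positivity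
    have hm : (H mm).re ≤ 0 := by
      have := (Complex.continuous_re.tendsto _).comp (hH.lu.tendsto_const (SM_sub mm_mem))
      refine le_of_tendsto this ?_
      filter_upwards [hb.eventually_le_atBot 0] with x hx
      simp only [Function.comp]
      rw [Complex.div_ofReal_re, kx_re]
      unfold bx; exact div_nonpos_of_nonpos_of_nonneg hx (abs_nonneg _)
    refine ⟨H, M, hH, ?_, ?_, ?_, ht, h1⟩
    · rcases sign_const convex_SP.isPreconnected (hcont.mono SP_sub) (fun s hs => hH.re s (Or.inl hs)) with h | h
      · exact h
      · have := h mp mp_mem; linarith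
    · rcases sign_const convex_SM.isPreconnected (hcont.mono SM_sub) (fun s hs => hH.re s (Or.inr hs)) with h | h
      · have := h mm mm_mem; linarith
      · exact h
    · have h3 := hH.nm
      rw [abs_of_nonneg hp] at h3
      exact Complex.ext (by simpa using h3) (by simpa using hH.im)
  · exact absurd h0 (by decide)

lemma re_zero_const {V : Set ℂ} (hV : IsOpen V) (hc : Convex ℝ V) {g : ℂ → ℂ} (hg : DifferentiableOn ℂ g V)
    (h0 : ∀ s ∈ V, (g s).re = 0) {s0 : ℂ} (hs0 : s0 ∈ V) (hz : g s0 = 0) : ∀ s ∈ V, g s = 0 := by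
  obtain ⟨c, hc⟩ := (hg.analyticOnNhd hV).eq_const_of_re_eq_const h0 hV ⟨⟨s0, hs0⟩, hc.isPreconnected⟩
  intro s hs
  rw [hc s hs, ← hc s0 hs0, hz]

lemma conj_DD {s : ℂ} (hs : s ∈ DD) : (starRingEnd ℂ) s ∈ DD := by
  have : |s.im| < 2 * Real.pi / 3 := hs
  show |((starRingEnd ℂ) s).im| < _
  simpa using this

lemma HX.refl {u : Filter ℝ} [u.NeBot] {k H : ℂ → ℂ} {M : ℝ} (h : HX u k H M) :
    ∀ s ∈ DD, H ((starRingEnd ℂ) s) = - (starRingEnd ℂ) (H s) := by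
  have hd := h.lu.diff
  have hpi := Real.pi_pos
  have hre : ∀ s ∈ DD, s.im = 0 → (H s).re = 0 := by
    intro s hs h0
    have hc : ContinuousAt H s := hd.continuousOn.continuousAt (isOpen_DD.mem_nhds hs)
    have ht : ∀ ε : ℝ, Tendsto (fun t : ℝ => (s + (ε * t : ℝ) * I : ℂ)) (𝓝[>] 0) (𝓝 s) := by
      intro ε
      apply Tendsto.mono_left _ nhdsWithin_le_nhds
      have : Continuous (fun t : ℝ => (s + (ε * t : ℝ) * I : ℂ)) := by fun_prop
      simpa using this.tendsto 0
    apply le_antisymm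
    · have h2 := (Complex.continuous_re.tendsto _).comp (hc.tendsto.comp (ht (-1)))
      refine le_of_tendsto h2 ?_
      filter_upwards [Ioo_mem_nhdsGT (show (0:ℝ) < 2 * Real.pi / 3 by positivity)] with t ht
      have h1 := ht.1
      have h2 := ht.2
      refine (h.neg _ ⟨?_, ?_⟩).le
      · rw [add_im, Complex.im_ofReal_mul, I_im, h0]; linarith
      · rw [add_im, Complex.im_ofReal_mul, I_im, h0]; linarith
    · have h2 := (Complex.continuous_re.tendsto _).comp (hc.tendsto.comp (ht 1))
      refine ge_of_tendsto h2 ?_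
      filter_upwards [Ioo_mem_nhdsGT (show (0:ℝ) < 2 * Real.pi / 3 by positivity)] with t ht
      have h1 := ht.1
      have h2 := ht.2
      refine (h.pos _ ⟨?_, ?_⟩).le
      · rw [add_im, Complex.im_ofReal_mul, I_im, h0]; linarith
      · rw [add_im, Complex.im_ofReal_mul, I_im, h0]; linarith
  have hd2 : DifferentiableOn ℂ (fun s => - (starRingEnd ℂ) (H ((starRingEnd ℂ) s))) DD := by
    intro s hs
    have h1 : DifferentiableAt ℂ H ((starRingEnd ℂ) s) := hd.differentiableAt (isOpen_DD.mem_nhds (conj_DD hs))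
    have := h1.conj_conj
    simp only [Complex.conj_conj] at this
    exact this.neg.differentiableWithinAt
  have h0D : (0:ℂ) ∈ DD := by show |(0:ℂ).im| < _; simp; positivity
  have key : EqOn H (fun s => - (starRingEnd ℂ) (H ((starRingEnd ℂ) s))) DD := by
    apply (hd.analyticOnNhd isOpen_DD).eqOn_of_preconnected_of_frequently_eq (hd2.analyticOnNhd isOpen_DD)
      convex_DD.isPreconnected h0D
    have ht : Tendsto (fun t : ℝ => (t : ℂ)) (𝓝[>] 0) (𝓝[≠] 0) := by
      rw [tendsto_nhdsWithin_iff]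
      constructor
      · apply Tendsto.mono_left _ nhdsWithin_le_nhds
        simpa using Complex.continuous_ofReal.tendsto 0
      · filter_upwards [self_mem_nhdsWithin] with t ht
        simpa using (ne_of_gt ht)
    apply ht.frequently
    apply Eventually.frequently
    filter_upwards with t
    have h1 := hre t (by show |(t:ℂ).im| < _; simp; positivity) (by simp)
    rw [Complex.conj_ofReal]
    apply Complex.ext
    · simp [h1]
    · simp
  intro s hs
  have := key (conj_DD hs)
  simpa using this

lemma ww_conj : (starRingEnd ℂ) ww = - ww := by
  unfold ww; rw [map_mul, Complex.conj_ofReal, Complex.conj_I, mul_neg]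

lemma ww_SP {s : ℂ} (hs : s ∈ SP) : s - ww ∈ SM := by
  have h1 := hs.1
  have h2 := hs.2
  constructor
  · rw [sub_im, ww_im]; linarith
  · rw [sub_im, ww_im]; linarith

lemma exp_compare {e f : ℂ} (h : Complex.exp f * (1 - Complex.exp e) = 1) (he : 1 ≤ e.re) :
    |f.re + e.re| ≤ 1 := by
  have h1 : Complex.exp (f + e) * (Complex.exp (-e) - 1) = 1 := by
    rw [Complex.exp_add, mul_assoc, mul_sub, ← Complex.exp_add]; simpa using h
  have h2 := congrArg norm h1
  rw [norm_mul, Complex.norm_exp, norm_one, add_re] at h2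
  have h3 : ‖Complex.exp (-e)‖ ≤ 1/2 := by
    rw [Complex.norm_exp, neg_re]
    have : Real.exp (-e.re) ≤ Real.exp (-1) := Real.exp_le_exp.2 (by linarith)
    have h4 : Real.exp (-1) ≤ 1/2 := by
      rw [Real.exp_neg]
      have := Real.add_one_le_exp (1:ℝ)
      rw [one_div]; exact inv_anti₀ two_pos (by linarith)
    linarith
  have h4 : ‖Complex.exp (-e) - 1‖ ≤ 3/2 := by
    refine (norm_sub_le _ _).trans ?_
    rw [norm_one]; linarith
  have h5 : 1/2 ≤ ‖Complex.exp (-e) - 1‖ := by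
    have := norm_sub_norm_le (1:ℂ) (Complex.exp (-e))
    rw [norm_sub_rev, norm_one] at this; linarith
  have hp := Real.exp_pos (f.re + e.re)
  have e1 := Real.exp_one_gt_d9
  have a1 : Real.exp (f.re + e.re) ≤ Real.exp 1 := by nlinarith
  have a2 : Real.exp (-1) ≤ Real.exp (f.re + e.re) := by
    rw [Real.exp_neg]
    have : (Real.exp 1)⁻¹ ≤ 1/2 := by rw [one_div]; exact inv_anti₀ two_pos (by linarith)
    nlinarith
  rw [Real.exp_le_exp] at a1 a2
  exact abs_le.2 ⟨by linarith, a1⟩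

lemma Sys.relw {ρ : ℝ} {k : ZMod 3 → ℂ → ℂ} (hk : Sys ρ k) (j : ZMod 3) {s : ℂ} (hs : s ∈ TT ρ) (h0 : 0 < s.im) :
    Complex.exp (k (j + 1) (s - ww)) * (1 - Complex.exp (k j s)) = 1 := hk.rel j s hs h0

lemma Sys.pair {ρ : ℝ} {k : ZMod 3 → ℂ → ℂ} (hk : Sys ρ k) {u : Filter ℝ} [u.NeBot] (hu : u ≤ atTop)
    {j : ZMod 3} {H H' : ℂ → ℂ} {M M' : ℝ} (h1 : HX u (k j) H M) (h2 : HX u (k (j+1)) H' M') :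
    ∀ s ∈ SP, (H' (s - ww)).re = - (H s).re := by
  have hb : ∀ᶠ x in u, 0 < bx (k (j+1)) x := h2.top.eventually_gt_atTop 0
  have hb1 : ∀ᶠ x in u, 0 < bx (k j) x := h1.top.eventually_gt_atTop 0
  have key : ∀ s ∈ SP, Tendsto (fun x : ℝ => (k j (x + s)).re / bx (k (j+1)) x) u (𝓝 (-(H' (s - ww)).re)) := by
    intro s hs
    have hlim := ((Complex.continuous_re.tendsto _).comp (h2.lu.tendsto_const (SM_sub (ww_SP hs)))).neg
    have ht := h1.tp s hs (fun _ => s) tendsto_const_nhds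
    have hx : ∀ᶠ x : ℝ in u, ρ + |s.re| < x := hu (eventually_gt_atTop _)
    have hd : Tendsto (fun x : ℝ => ((k (j+1) (x + (s - ww))).re + (k j (x + s)).re) / bx (k (j+1)) x) u (𝓝 0) := by
      apply squeeze_zero_norm' (a := fun x => (bx (k (j+1)) x)⁻¹) _ (tendsto_inv_atTop_zero.comp h2.top)
      filter_upwards [hb, ht.eventually_ge_atTop 1, hx] with x hbx h1 hx
      rw [norm_div, Real.norm_of_nonneg hbx.le, ← one_div]
      gcongr
      rw [Real.norm_eq_abs]
      apply exp_compare _ h1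
      have := hk.relw j (s := x + s) (mem_TT (SP_sub hs) (by linarith [neg_abs_le s.re])) (by simpa using hs.1)
      rwa [add_sub_assoc] at this
    have := hd.add hlim
    rw [zero_add] at this
    refine this.congr fun x => ?_
    simp only [Function.comp]
    rw [Complex.div_ofReal_re, kx_re]; ring
  have hq : Tendsto (fun x => bx (k j) x / bx (k (j+1)) x) u (𝓝 1) := by
    have := key mp mp_mem
    have e : mp - ww = (starRingEnd ℂ) mp := by
      unfold mp ww
      simp only [map_mul, Complex.conj_ofReal, Complex.conj_I]
      push_cast; ring
    rw [e, h2.refl mp (SP_sub mp_mem), h2.one] at this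
    simp only [map_one, neg_re, one_re, neg_neg] at this
    refine this.congr' ?_
    filter_upwards [h1.tt.eventually_gt_atTop 0] with x hx
    unfold bx; rw [abs_of_pos hx]
  intro s hs
  have h3 := ((Complex.continuous_re.tendsto _).comp (h1.lu.tendsto_const (SP_sub hs))).mul hq
  have h4 : Tendsto (fun x : ℝ => (k j (x + s)).re / bx (k (j+1)) x) u (𝓝 ((H s).re * 1)) := by
    refine h3.congr' ?_
    filter_upwards [hb, hb1] with x h5 h6
    simp only [Function.comp]
    rw [Complex.div_ofReal_re, kx_re]; field_simp
  have := tendsto_nhds_unique (key s hs) h4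
  linarith

lemma zmod3 (j : ZMod 3) : j + 1 + 1 + 1 = j := by revert j; decide

def RR (s : ℂ) : ℂ := (starRingEnd ℂ) s + ww
lemma RR_SP {s : ℂ} (hs : s ∈ SP) : RR s ∈ SP := by
  have h1 := hs.1
  have h2 := hs.2
  unfold RR
  constructor
  · rw [add_im, ww_im, Complex.conj_im]; linarith
  · rw [add_im, ww_im, Complex.conj_im]; linarith
lemma RR_RR (s : ℂ) : RR (RR s) = s := by
  unfold RR
  have := ww_conj
  rw [map_add, this, Complex.conj_conj]; ring

lemma Sys.pair' {ρ : ℝ} {k : ZMod 3 → ℂ → ℂ} (hk : Sys ρ k) {u : Filter ℝ} [u.NeBot] (hu : u ≤ atTop)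
    {j : ZMod 3} {H H' : ℂ → ℂ} {M M' : ℝ} (h1 : HX u (k j) H M) (h2 : HX u (k (j+1)) H' M') :
    ∀ s ∈ SP, (H' (RR s)).re = (H s).re := by
  intro s hs
  have h3 := hk.pair hu h1 h2 s hs
  have h4 := h2.refl _ (SM_sub (ww_SP hs))
  have : (starRingEnd ℂ) (s - ww) = RR s := by
    unfold RR
    have := ww_conj
    rw [map_sub, this]; ring
  rw [this] at h4
  rw [h4, neg_re, Complex.conj_re, h3, neg_neg]

lemma Sys.HX_form {ρ : ℝ} {k : ZMod 3 → ℂ → ℂ} (hk : Sys ρ k) {u : Filter ℝ} [u.NeBot] (hu : u ≤ atTop)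
    (hall : ∀ j, HK u (k j) 4) {j : ZMod 3} {H : ℂ → ℂ} {M : ℝ} (h0 : HX u (k j) H M) :
    ∃ a b : ℝ, a + b = 1 ∧
      ∀ s ∈ DD, H s = -(a * I) * Complex.exp ((3/2 : ℝ) * s) + (b * I) * Complex.exp (-((3/2 : ℝ) * s)) := by
  have hpi := Real.pi_pos
  obtain ⟨H1, M1, h1⟩ := (hall (j+1)).hx
  obtain ⟨H2, M2, h2⟩ := (hall (j+1+1)).hx
  have h0' : HX u (k (j+1+1+1)) H M := by
    have : j + 1 + 1 + 1 = j := zmod3 j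
    rw [this]; exact h0
  have hRR : ∀ s ∈ SP, (H (RR s)).re = (H s).re := by
    intro s hs
    have a1 := hk.pair' hu h0 h1 s hs
    have a2 := hk.pair' hu h1 h2 (RR s) (RR_SP hs)
    have a3 := hk.pair' hu h2 h0' s hs
    rw [RR_RR] at a2
    rw [a3, a2, a1]
  have hap : ∀ s ∈ SM, H (s + ((2 * Real.pi / 3 : ℝ) : ℂ) * I) = - H s := by
    have hSM : ∀ s ∈ SM, s + ww ∈ SP := by
      intro s hs
      have h1 := hs.1
      have h2 := hs.2
      constructor
      · rw [add_im, ww_im]; linarith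
      · rw [add_im, ww_im]; linarith
    have hd := h0.lu.diff
    have hd1 : DifferentiableOn ℂ (fun s => H (s + ww) + H s) SM := by
      apply DifferentiableOn.add _ (hd.mono SM_sub)
      exact hd.comp (by fun_prop) (fun s hs => SP_sub (hSM s hs))
    have := re_zero_const isOpen_SM convex_SM hd1 (by
      intro s hs
      have hc : (starRingEnd ℂ) s ∈ SP := by
        have h1 := hs.1
        have h2 := hs.2
        constructor
        · rw [Complex.conj_im]; linarith
        · rw [Complex.conj_im]; linarith
      have b1 := hRR ((starRingEnd ℂ) s) hc
      have b2 := h0.refl s (SM_sub hs)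
      have b3 : RR ((starRingEnd ℂ) s) = s + ww := by unfold RR; rw [Complex.conj_conj]
      rw [b3, b2] at b1
      rw [add_re, b1]; simp) mm_mem (by
      have e : mm + ww = mp := by unfold mp mm ww; push_cast; ring
      have e2 : mm = (starRingEnd ℂ) mp := by
        unfold mp mm
        simp only [map_mul, Complex.conj_ofReal, Complex.conj_I]
        push_cast; ring
      simp only [e]
      rw [e2, h0.refl mp (SP_sub mp_mem), h0.one]; simp)
    intro s hs
    have := this s hs
    exact eq_neg_of_add_eq_zero_left this
  obtain ⟨a, b, hab⟩ := strip_form h0.lu.diff h0.bd hap h0.pos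
  have hre : ∀ t : ℝ, (a * Complex.exp ((3/2 : ℝ) * (t:ℂ)) + b * Complex.exp (-((3/2 : ℝ) * (t:ℂ)))).re = 0 := by
    intro t
    have hD : (t:ℂ) ∈ DD := by show |(t:ℂ).im| < _; simp; positivity
    rw [← hab t hD]
    have := h0.refl t hD
    rw [Complex.conj_ofReal] at this
    have := congrArg Complex.re this
    simp at this
    linarith
  have h00 := hre 0
  have h01 := hre (2/3)
  have e1 : ((3/2 : ℝ) : ℂ) * ((2/3 : ℝ) : ℂ) = ((1:ℝ) : ℂ) := by rw [← Complex.ofReal_mul]; norm_num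
  rw [e1, ← Complex.ofReal_neg, ← Complex.ofReal_exp, ← Complex.ofReal_exp, add_re, Complex.re_mul_ofReal,
    Complex.re_mul_ofReal] at h01
  simp at h00
  have hb0 : b.re = -a.re := by linarith
  have ha0 : a.re = 0 := by
    rw [hb0] at h01
    have hlt : Real.exp (-1) < Real.exp 1 := Real.exp_lt_exp.2 (by norm_num)
    have : a.re * (Real.exp 1 - Real.exp (-1)) = 0 := by linarith
    exact (mul_eq_zero.1 this).resolve_right (by linarith)
  have hb0' : b.re = 0 := by rw [hb0, ha0, neg_zero]
  have hone := hab mp (SP_sub mp_mem)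
  have e2 : Complex.exp ((3/2 : ℝ) * mp) = I := by
    have : ((3/2 : ℝ) : ℂ) * mp = Real.pi / 2 * I := by unfold mp; push_cast; ring
    rw [this, Complex.exp_pi_div_two_mul_I]
  rw [Complex.exp_neg, e2, h0.one, Complex.inv_I] at hone
  have h3 := congrArg Complex.re hone
  simp at h3
  refine ⟨-a.im, b.im, by linarith, fun s hs => ?_⟩
  have ea : a = -(((-a.im : ℝ) : ℂ) * I) := by apply Complex.ext <;> simp [ha0]
  have eb : b = (b.im : ℂ) * I := by apply Complex.ext <;> simp [hb0']
  rw [← ea, ← eb]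
  exact hab s hs

end

section

lemma contr_lim {e : ℝ → ℝ} {M : ℝ} (hM : ∀ᶠ x in atTop, |e x| ≤ M)
    (h : ∀ δ > 0, ∀ᶠ x in atTop, |e x| ≤ |e (x - 1)| / 2 + δ) : Tendsto e atTop (𝓝 0) := by
  rw [Metric.tendsto_nhds]
  intro ε hε
  obtain ⟨X, hX⟩ := eventually_atTop.1 (hM.and (h (ε/4) (by positivity)))
  have hM0 : 0 ≤ M := (abs_nonneg _).trans (hX X le_rfl).1
  have key : ∀ n : ℕ, ∀ x, X + n ≤ x → |e x| ≤ M / 2 ^ n + 2 * (ε/4) := by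
    intro n
    induction n with
    | zero =>
      intro x hx
      have := (hX x (by simpa using hx)).1
      simp; linarith
    | succ n ih =>
      intro x hx
      push_cast at hx
      have h1 := (hX x (by have : (0:ℝ) ≤ n := by positivity
                           linarith)).2
      have h2 := ih (x - 1) (by linarith)
      have : M / 2 ^ (n+1) = (M / 2 ^ n) / 2 := by rw [pow_succ]; field_simp
      rw [this]; linarith
  obtain ⟨n, hn⟩ := exists_pow_lt_of_lt_one (show 0 < ε / 4 / (M + 1) by positivity) (show (1/2 : ℝ) < 1 by norm_num)
  filter_upwards [eventually_ge_atTop (X + n)] with x hx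
  rw [Real.dist_eq, sub_zero]
  have h1 := key n x hx
  have h2 : M / 2 ^ n < ε / 4 := by
    rw [lt_div_iff₀ (by positivity)] at hn
    have : M / 2 ^ n = (1/2)^n * M := by rw [one_div, inv_pow]; ring
    rw [this]
    have : (0:ℝ) < (1/2)^n := by positivity
    linarith
  linarith

lemma ratio_lim {m : ℝ → ℝ} {X0 lam : ℝ} (hc : ContinuousOn m (Ici X0)) (htop : Tendsto m atTop atTop)
    (hl : 2 ≤ lam) (hr : Tendsto (fun x => (m (x + 1) + m (x - 1)) / m x) atTop (𝓝 (lam + 1 / lam))) :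
    Tendsto (fun x => m (x + 1) / m x) atTop (𝓝 lam) := by
  have hl0 : 0 < lam := by linarith
  have hm0 : ∀ᶠ x in atTop, 0 < m x := htop.eventually_gt_atTop 0
  obtain ⟨X1, hX1⟩ := eventually_atTop.1 hm0
  have h9 : ∀ᶠ x in atTop, 9/4 < (m (x + 1) + m (x - 1)) / m x := by
    apply hr.eventually (lt_mem_nhds _)
    have : 0 < 1 / lam := by positivity
    by_cases h : lam ≤ 9/4
    · have : 4/9 ≤ 1 / lam := by rw [le_div_iff₀ hl0]; linarith
      linarith
    · linarith
  obtain ⟨X2, hX2⟩ := eventually_atTop.1 h9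
  set X := max X0 (max (X1 + 1) X2) with hXdef
  have hXa : X0 ≤ X := le_max_left _ _
  have hXb : X1 + 1 ≤ X := (le_max_left _ _).trans (le_max_right _ _)
  have hXc : X2 ≤ X := (le_max_right _ _).trans (le_max_right _ _)
  obtain ⟨B, hB⟩ := (isCompact_Icc (a := X) (b := X + 1)).bddAbove_image (f := m)
    (hc.mono (fun x hx => hXa.trans hx.1))
  have hB' : ∀ x, X ≤ x → x ≤ X + 1 → m x ≤ B := fun x h1 h2 => hB ⟨x, ⟨h1, h2⟩, rfl⟩
  have key : ∀ n : ℕ, ∀ x, X ≤ x → x ≤ X + 1 + n → m (x + 1) ≤ m x → m x ≤ B := by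
    intro n
    induction n with
    | zero => intro x h1 h2 _; exact hB' x h1 (by simpa using h2)
    | succ n ih =>
      intro x h1 h2 h3
      push_cast at h2
      by_cases h4 : x ≤ X + 1
      · exact hB' x h1 h4
      · push Not at h4
        have h5 := hX2 x (by linarith)
        rw [lt_div_iff₀ (hX1 x (by linarith))] at h5
        have h6 := hX1 x (by linarith)
        have h7 : m x ≤ m (x - 1) := by linarith
        refine h7.trans (ih (x - 1) (by linarith) (by linarith) ?_)
        rwa [sub_add_cancel]
  have hq : ∀ᶠ x in atTop, m x < m (x + 1) := by
    filter_upwards [htop.eventually_gt_atTop B, eventually_ge_atTop X] with x h1 h2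
    by_contra hcon
    obtain ⟨n, hn⟩ := exists_nat_ge (x - X - 1)
    have := key n x h2 (by linarith) (not_lt.1 hcon)
    linarith
  have hq1 : ∀ᶠ x in atTop, m (x - 1) < m x := by
    have := (tendsto_atTop_add_const_right atTop (-1 : ℝ) tendsto_id).eventually hq
    filter_upwards [this] with x hx
    simpa [sub_eq_add_neg] using hx
  have hm1 : ∀ᶠ x in atTop, 0 < m (x - 1) := by
    have := (tendsto_atTop_add_const_right atTop (-1 : ℝ) tendsto_id).eventually hm0
    filter_upwards [this] with x hx
    simpa [sub_eq_add_neg] using hx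
  have h0 : Tendsto (fun x => m (x + 1) / m x - lam) atTop (𝓝 0) := by
    apply contr_lim (M := lam + (lam + 1 / lam + 1))
    · have h3 : ∀ᶠ x in atTop, (m (x + 1) + m (x - 1)) / m x < lam + 1 / lam + 1 :=
        hr.eventually (gt_mem_nhds (by linarith))
      filter_upwards [h3, hm0, hm1, hq] with x h3 h4 h5 h6
      have h7 : m (x+1) / m x ≤ (m (x + 1) + m (x - 1)) / m x := by gcongr; linarith
      have h8 : 0 < m (x+1) / m x := div_pos (by linarith) h4
      rw [abs_le]; constructor <;> linarith
    · intro δ hδ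
      have h3 : ∀ᶠ x in atTop, |(m (x + 1) + m (x - 1)) / m x - (lam + 1/lam)| < δ := by
        have := (Metric.tendsto_nhds.1 hr) δ hδ
        simpa [Real.dist_eq] using this
      filter_upwards [h3, hm0, hm1, hq1] with x h3 h4 h5 h6
      simp only [sub_add_cancel]
      have e : m (x+1) / m x - lam = ((m (x + 1) + m (x - 1)) / m x - (lam + 1/lam)) +
          (m x / m (x-1) - lam) * ((lam * (m x / m (x-1)))⁻¹) := by
        field_simp
        ring
      rw [e]
      have h7 : |(m x / m (x-1) - lam) * ((lam * (m x / m (x-1)))⁻¹)| ≤ |m x / m (x-1) - lam| / 2 := by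
        have h8 : 1 ≤ m x / m (x-1) := by rw [le_div_iff₀ h5]; linarith
        have h9 : 2 ≤ lam * (m x / m (x-1)) := by nlinarith
        rw [abs_mul, abs_inv, abs_of_pos (show 0 < lam * (m x / m (x-1)) by linarith), div_eq_mul_inv (|m x / m (x-1) - lam|) 2]
        gcongr
      have := abs_add_le ((m (x + 1) + m (x - 1)) / m x - (lam + 1/lam)) ((m x / m (x-1) - lam) * ((lam * (m x / m (x-1)))⁻¹))
      linarith
  simpa using h0.add_const lam

/-- main exponent -/
def lam : ℝ := Real.exp (3/2)
lemma lam_ge : 2 ≤ lam := by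
  have := Real.add_one_le_exp (3/2 : ℝ); unfold lam; linarith

/-- the limit function -/
def WW (s : ℂ) : ℂ := -I * Complex.exp ((3/2 : ℝ) * s)

/-- the conclusion of the analysis of the oscillating case -/
def Osc (k : ZMod 3 → ℂ → ℂ) : Prop :=
  ∀ u : Ultrafilter ℝ, (u : Filter ℝ) ≤ atTop → ∀ j, HK (u : Filter ℝ) (k j) 4

lemma tendsto_uf {f : ℝ → ℝ} {l : Filter ℝ} (h : ∀ u : Ultrafilter ℝ, (u : Filter ℝ) ≤ atTop → Tendsto f u l) :
    Tendsto f atTop l := by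
  rw [tendsto_iff_ultrafilter]
  exact fun u hu => h u hu

lemma h_val {a b t : ℝ} :
    (-(a * I) * Complex.exp ((3/2 : ℝ) * (t + mp)) + (b * I) * Complex.exp (-((3/2 : ℝ) * (t + mp)))) =
      ((a * Real.exp (3/2 * t) + b * Real.exp (-(3/2 * t)) : ℝ) : ℂ) := by
  have e2 : Complex.exp ((3/2 : ℝ) * mp) = I := by
    have : ((3/2 : ℝ) : ℂ) * mp = Real.pi / 2 * I := by unfold mp; push_cast; ring
    rw [this, Complex.exp_pi_div_two_mul_I]
  rw [mul_add, neg_add, Complex.exp_add, Complex.exp_add, Complex.exp_neg ((3/2 : ℝ) * mp), e2, Complex.inv_I]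
  push_cast
  linear_combination (-a * Complex.exp (3/2 * t) - b * Complex.exp (-(3/2 * t))) * Complex.I_mul_I

lemma re_mp_cont {ρ : ℝ} {k : ℂ → ℂ} (hk : KF ρ k) : ContinuousOn (bx k) (Ici (ρ + 1)) := by
  unfold bx
  apply ContinuousOn.abs
  apply Complex.continuous_re.comp_continuousOn
  apply hk.diff.continuousOn.comp (by fun_prop)
  intro x hx
  have : ρ + 1 ≤ x := hx
  exact mem_TT (SP_sub mp_mem) (by simp; linarith)

lemma HX.ratio {u : Filter ℝ} [u.NeBot] {k H : ℂ → ℂ} {M : ℝ} (h : HX u k H M) (t : ℝ)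
    (htt : Tendsto (fun x : ℝ => (k ((x + t : ℝ) + mp)).re) u atTop) :
    Tendsto (fun x : ℝ => bx k (x + t) / bx k x) u (𝓝 (H (t + mp)).re) := by
  have hD : (t : ℂ) + mp ∈ DD := by
    have := SP_sub mp_mem
    show |((t:ℂ) + mp).im| < _
    have h2 : |mp.im| < 2 * Real.pi / 3 := this
    simpa using h2
  have h1 := (Complex.continuous_re.tendsto _).comp (h.lu.tendsto_const hD)
  refine h1.congr' ?_
  filter_upwards [htt.eventually_gt_atTop 0] with x hx
  simp only [Function.comp]
  rw [Complex.div_ofReal_re, kx_re]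
  congr 1
  unfold bx
  rw [abs_of_pos hx, ofReal_add, add_assoc]

theorem Sys.osc {ρ : ℝ} {k : ZMod 3 → ℂ → ℂ} (hk : Sys ρ k) (ho : Osc k) (j : ZMod 3) :
    Tendsto (bx (k j)) atTop atTop ∧
    Tendsto (fun x => bx (k j) (x + 1) / bx (k j) x) atTop (𝓝 lam) ∧
    ∀ u : Ultrafilter ℝ, (u : Filter ℝ) ≤ atTop → LU (u : Filter ℝ) (fun x s => kx (k j) x s / bx (k j) x) WW DD := by
  have hmp : Tendsto (fun x : ℝ => (k j (x + mp)).re) atTop atTop := by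
    apply tendsto_uf
    intro u hu
    obtain ⟨H, M, h⟩ := (ho u hu j).hx
    exact h.tt
  have htop : Tendsto (bx (k j)) atTop atTop := tendsto_atTop_mono (fun x => le_abs_self _) hmp
  have hsh : ∀ t : ℝ, Tendsto (fun x : ℝ => (k j ((x + t : ℝ) + mp)).re) atTop atTop := fun t =>
    hmp.comp (tendsto_atTop_add_const_right atTop t tendsto_id)
  have hrat : Tendsto (fun x => bx (k j) (x + 1) / bx (k j) x) atTop (𝓝 lam) := by
    apply ratio_lim (re_mp_cont (hk.kf j)) htop lam_ge
    apply tendsto_uf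
    intro u hu
    obtain ⟨H, M, h⟩ := (ho u hu j).hx
    obtain ⟨a, b, hab, hf⟩ := hk.HX_form hu (ho u hu) h
    have h1 := h.ratio 1 ((hsh 1).mono_left hu)
    have h2 := h.ratio (-1) ((hsh (-1)).mono_left hu)
    have h3 := h1.add h2
    have hD : ∀ t : ℝ, (t : ℂ) + mp ∈ DD := by
      intro t
      have := SP_sub mp_mem
      show |((t:ℂ) + mp).im| < _
      have h2 : |mp.im| < 2 * Real.pi / 3 := this
      simpa using h2
    rw [hf _ (hD 1), hf _ (hD (-1)), h_val, h_val, Complex.ofReal_re, Complex.ofReal_re] at h3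
    have e : a * Real.exp (3 / 2 * 1) + b * Real.exp (-(3 / 2 * 1)) + (a * Real.exp (3 / 2 * -1) + b * Real.exp (-(3 / 2 * -1))) =
        lam + 1 / lam := by
      have : Real.exp (-(3/2)) = 1 / lam := by unfold lam; rw [Real.exp_neg, one_div]
      simp only [mul_one, mul_neg, neg_neg]
      rw [this]
      have : Real.exp (3/2) = lam := rfl
      rw [this]
      have : b = 1 - a := by linarith
      rw [this]; ring
    rw [e] at h3
    refine h3.congr fun x => ?_
    rw [add_div, sub_eq_add_neg]
  refine ⟨htop, hrat, fun u hu => ?_⟩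
  obtain ⟨H, M, h⟩ := (ho u hu j).hx
  obtain ⟨a, b, hab, hf⟩ := hk.HX_form hu (ho u hu) h
  have h1 := h.ratio 1 ((hsh 1).mono_left hu)
  have hD : ((1:ℝ) : ℂ) + mp ∈ DD := by
    have := SP_sub mp_mem
    show |(((1:ℝ):ℂ) + mp).im| < _
    have h2 : |mp.im| < 2 * Real.pi / 3 := this
    simpa using h2
  have h2 := tendsto_nhds_unique h1 (hrat.mono_left hu)
  rw [hf _ hD, h_val, Complex.ofReal_re, mul_one] at h2
  have h3 : Real.exp (-(3/2)) < Real.exp (3/2) := Real.exp_lt_exp.2 (by norm_num)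
  have hb : b = 0 := by
    have e : lam = Real.exp (3/2) := rfl
    rw [e] at h2
    have : a = 1 - b := by linarith
    rw [this] at h2
    have : b * (Real.exp (-(3/2)) - Real.exp (3/2)) = 0 := by linarith
    exact (mul_eq_zero.1 this).resolve_right (by linarith)
  have ha : a = 1 := by linarith
  intro s hs
  obtain ⟨r, hr, hsub, hd, ht⟩ := h.lu s hs
  refine ⟨r, hr, hsub, hd, ht.congr_right ?_⟩
  intro w hw
  rw [hf w (hsub hw), ha, hb]
  unfold WW; simp

end

section

lemma freq_uf {P : ℝ → Prop} (h : ∃ᶠ x in atTop, P x) :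
    ∃ u : Ultrafilter ℝ, (u : Filter ℝ) ≤ atTop ∧ ∀ᶠ x in (u : Filter ℝ), P x := by
  haveI := Filter.frequently_iff_neBot.1 h
  exact ⟨Ultrafilter.of _, le_trans (Ultrafilter.of_le _) inf_le_left,
      (Ultrafilter.of_le _) (mem_inf_of_right (mem_principal_self _))⟩

lemma uf_single {φ : ℝ → ℝ} {X : ℝ} (hc : ContinuousOn φ (Ici X)) {S : Set ℝ} (hS : S.Finite)
    (h : ∀ u : Ultrafilter ℝ, (u : Filter ℝ) ≤ atTop → ∃ c ∈ S, Tendsto φ u (𝓝 c))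
    {u1 u2 : Ultrafilter ℝ} (h1 : (u1 : Filter ℝ) ≤ atTop) (h2 : (u2 : Filter ℝ) ≤ atTop) {c1 c2 : ℝ}
    (t1 : Tendsto φ u1 (𝓝 c1)) (t2 : Tendsto φ u2 (𝓝 c2)) : c1 ≤ c2 := by
  by_contra hlt
  push Not at hlt
  obtain ⟨v, hv, hvS⟩ : ∃ v ∈ Ioo c2 c1, v ∉ S := by
    by_contra hcon
    push Not at hcon
    exact (Ioo_infinite hlt) (hS.subset hcon)
  have f1 : ∃ᶠ x in atTop, v < φ x := (Filter.Eventually.frequently (t1.eventually (lt_mem_nhds hv.2))).filter_mono h1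
  have f2 : ∃ᶠ x in atTop, φ x < v := (Filter.Eventually.frequently (t2.eventually (gt_mem_nhds hv.1))).filter_mono h2
  have f3 : ∃ᶠ x in atTop, φ x = v := by
    rw [frequently_atTop] at f1 f2 ⊢
    intro a
    obtain ⟨x1, hx1, hh1⟩ := f1 (max a X)
    obtain ⟨x2, hx2, hh2⟩ := f2 (max a X)
    have hsub : uIcc x1 x2 ⊆ Ici (max a X) := by
      intro x hx
      rcases le_total x1 x2 with h | h
      · rw [uIcc_of_le h] at hx; exact le_trans hx1 hx.1
      · rw [uIcc_of_ge h] at hx; exact le_trans hx2 hx.1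
    have := intermediate_value_uIcc (hc.mono (hsub.trans (Ici_subset_Ici.2 (le_max_right _ _))))
    obtain ⟨x, hx, hxv⟩ := this (show v ∈ uIcc (φ x1) (φ x2) by
      rw [uIcc_of_ge (by linarith)]; exact ⟨hh2.le, hh1.le⟩)
    exact ⟨x, le_trans (le_max_left _ _) (hsub hx), hxv⟩
  obtain ⟨u, hu, hu2⟩ := freq_uf f3
  obtain ⟨c, hcS, hct⟩ := h u hu
  have : c = v := tendsto_nhds_unique hct (tendsto_const_nhds.congr' (hu2.mono fun x hx => hx.symm))
  exact hvS (this ▸ hcS)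

lemma unif_of_uf {P : ℝ → ℝ → Prop} (h : ∀ u : Ultrafilter ℝ, (u : Filter ℝ) ≤ atTop → ∀ y : ℝ → ℝ,
      ∀ y0, |y0| ≤ Real.pi / 3 → Tendsto y u (𝓝 y0) → ∀ᶠ x in (u : Filter ℝ), P x (y x)) :
    ∀ᶠ x in atTop, ∀ y, |y| ≤ Real.pi / 3 → P x y := by
  by_contra hcon
  have hcon : ∃ᶠ x in atTop, ∃ y, |y| ≤ Real.pi / 3 ∧ ¬ P x y := by
    rw [Filter.not_eventually] at hcon
    refine hcon.mono fun x hx => ?_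
    push Not at hx; exact hx
  obtain ⟨u, hu, hu2⟩ := freq_uf hcon
  obtain ⟨y, hy⟩ : ∃ y : ℝ → ℝ, ∀ x, (∃ y, |y| ≤ Real.pi / 3 ∧ ¬ P x y) → |y x| ≤ Real.pi / 3 ∧ ¬ P x (y x) := by
    have : ∀ x, ∃ y, (∃ y, |y| ≤ Real.pi / 3 ∧ ¬ P x y) → |y| ≤ Real.pi / 3 ∧ ¬ P x y := by
      intro x
      by_cases hx : ∃ y, |y| ≤ Real.pi / 3 ∧ ¬ P x y
      · obtain ⟨y, hy⟩ := hx; exact ⟨y, fun _ => hy⟩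
      · exact ⟨0, fun h => absurd h hx⟩
    choose y hy using this
    exact ⟨y, hy⟩
  have hcomp := (isCompact_Icc (a := -(Real.pi/3)) (b := Real.pi/3)).ultrafilter_le_nhds (u.map y) (by
    rw [le_principal_iff]
    exact hu2.mono fun x hx => abs_le.1 (hy x hx).1)
  obtain ⟨y0, hy0, hle⟩ := hcomp
  have := h u hu y y0 (abs_le.2 hy0) hle
  obtain ⟨x, hx1, hx2⟩ := (this.and hu2).exists
  exact (hy x hx2).2 hx1

/-- state function -/
def stf (k : ZMod 3 → ℂ → ℂ) (x : ℝ) : ℝ :=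
  ‖Complex.exp (k 0 (x + mp))‖ / (1 + ‖Complex.exp (k 0 (x + mp))‖) +
  2 * (‖Complex.exp (k 0 (x + mm))‖ / (1 + ‖Complex.exp (k 0 (x + mm))‖))

lemma HV.lim {u : Filter ℝ} {v : ℝ → ℂ} {c : Fin 4} (h : HV u v c) (hc : c ≠ 3) :
    Tendsto (fun x => ‖v x‖ / (1 + ‖v x‖)) u (𝓝 (![0, 1/2, 1, 0] c)) := by
  rcases h with ⟨rfl, h⟩ | ⟨rfl, h⟩ | ⟨rfl, h⟩ | ⟨rfl, h⟩
  · have := h.norm.div (h.norm.const_add 1) (by simp)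
    simp only [norm_zero, zero_div, add_zero] at this
    exact this
  · have := h.norm.div (h.norm.const_add 1) (by simp)
    have e : ‖(1:ℂ)‖ / (1 + ‖(1:ℂ)‖) = 1/2 := by norm_num
    rw [e] at this
    exact this
  · have h1 : Tendsto (fun x => 1 - (1 + ‖v x‖)⁻¹) u (𝓝 (1 - 0)) :=
      (tendsto_inv_atTop_zero.comp (tendsto_atTop_add_const_left _ _ h)).const_sub 1
    simp only [sub_zero] at h1
    refine h1.congr fun x => ?_
    have : 0 < 1 + ‖v x‖ := by positivity
    field_simp; ring
  · exact absurd rfl hc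

/-- the one state -/
def OneSt (u : Filter ℝ) (k : ZMod 3 → ℂ → ℂ) (j : ZMod 3) : Prop :=
  HK u (k j) 1 ∧ HK u (k (j+1)) 2 ∧ HK u (k (j+2)) 0

lemma stf_lim {u : Filter ℝ} [u.NeBot] {k : ZMod 3 → ℂ → ℂ} {c : Fin 6} (h : HK u (k 0) c)
    (ha : aval c ≠ 3) (hb : bval c ≠ 3) :
    Tendsto (stf k) u (𝓝 ((![0, 1/2, 1, 0] : Fin 4 → ℝ) (aval c) + 2 * (![0, 1/2, 1, 0] : Fin 4 → ℝ) (bval c))) :=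
  (h.a.1.lim ha).add ((h.a.2.lim hb).const_mul 2)

lemma stf_cont {ρ : ℝ} {k : ZMod 3 → ℂ → ℂ} (hk : Sys ρ k) : ContinuousOn (stf k) (Ici (ρ + 1)) := by
  have key : ∀ s ∈ DD, s.re = 0 → ContinuousOn (fun x : ℝ => Complex.exp (k 0 (x + s))) (Ici (ρ + 1)) := by
    intro s hs h0
    apply Complex.continuous_exp.comp_continuousOn
    apply (hk.kf 0).diff.continuousOn.comp (by fun_prop)
    intro x hx
    have : ρ + 1 ≤ x := hx
    exact mem_TT hs (by rw [h0]; linarith)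
  have kp := (key mp (SP_sub mp_mem) (by simp)).norm
  have km := (key mm (SM_sub mm_mem) (by simp)).norm
  unfold stf
  refine ContinuousOn.add (kp.div (kp.const_add 1) ?_) ((km.div (km.const_add 1) ?_).const_mul 2)
  · intro x _; positivity
  · intro x _; positivity

theorem Sys.noreg {ρ : ℝ} {k : ZMod 3 → ℂ → ℂ} (hk : Sys ρ k)
    (hr : ∀ u : Ultrafilter ℝ, (u : Filter ℝ) ≤ atTop → ¬ ∀ j, HK (u : Filter ℝ) (k j) 3) :
    Osc k ∨ ∃ j, ∀ u : Ultrafilter ℝ, (u : Filter ℝ) ≤ atTop → OneSt u k j := by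
  have cases : ∀ u : Ultrafilter ℝ, (u : Filter ℝ) ≤ atTop →
      ((∀ j, HK (u : Filter ℝ) (k j) 4) ∧ Tendsto (stf k) u (𝓝 1)) ∨
      (OneSt u k 0 ∧ Tendsto (stf k) u (𝓝 (3/2))) ∨
      (OneSt u k 1 ∧ Tendsto (stf k) u (𝓝 0)) ∨ (OneSt u k 2 ∧ Tendsto (stf k) u (𝓝 3)) := by
    intro u hu
    rcases hk.tri u hu with h | h | ⟨j, h⟩
    · exact absurd h (hr u hu)
    · left; refine ⟨h, ?_⟩
      have := stf_lim (h 0) (by decide) (by decide)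
      simpa [aval, bval] using this
    · right
      fin_cases j
      · left; refine ⟨h, ?_⟩
        have := stf_lim h.1 (by decide) (by decide)
        have e : ((![0, 1/2, 1, 0] : Fin 4 → ℝ) (aval 1) + 2 * (![0, 1/2, 1, 0] : Fin 4 → ℝ) (bval 1)) = 3/2 := by
          simp [aval, bval]; norm_num
        rwa [e] at this
      · right; left; refine ⟨h, ?_⟩
        have := stf_lim (k := k) h.2.2 (by decide) (by decide)
        simpa [aval, bval] using this
      · right; right; refine ⟨h, ?_⟩
        have := stf_lim (k := k) h.2.1 (by decide) (by decide)
        have e : ((![0, 1/2, 1, 0] : Fin 4 → ℝ) (aval 2) + 2 * (![0, 1/2, 1, 0] : Fin 4 → ℝ) (bval 2)) = 3 := by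
          simp [aval, bval]; norm_num
        rwa [e] at this
  have hS : ∀ u : Ultrafilter ℝ, (u : Filter ℝ) ≤ atTop → ∃ c ∈ ({1, 3/2, 0, 3} : Set ℝ), Tendsto (stf k) u (𝓝 c) := by
    intro u hu
    rcases cases u hu with h | h | h | h
    · exact ⟨1, by simp, h.2⟩
    · exact ⟨3/2, by simp, h.2⟩
    · exact ⟨0, by simp, h.2⟩
    · exact ⟨3, by simp, h.2⟩
  have key : ∀ {u1 u2 : Ultrafilter ℝ} {c1 c2 : ℝ}, (u1 : Filter ℝ) ≤ atTop → (u2 : Filter ℝ) ≤ atTop →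
      Tendsto (stf k) u1 (𝓝 c1) → Tendsto (stf k) u2 (𝓝 c2) → c1 = c2 := by
    intro u1 u2 c1 c2 h1 h2 t1 t2
    exact le_antisymm (uf_single (stf_cont hk) (by simp) hS h1 h2 t1 t2)
      (uf_single (stf_cont hk) (by simp) hS h2 h1 t2 t1)
  obtain ⟨u0, hu0⟩ : ∃ u : Ultrafilter ℝ, (u : Filter ℝ) ≤ atTop := ⟨Ultrafilter.of atTop, Ultrafilter.of_le _⟩
  rcases cases u0 hu0 with h | h | h | h
  · left
    intro u hu
    rcases cases u hu with h' | h' | h' | h'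
    · exact h'.1
    all_goals exfalso; have := key hu0 hu h.2 h'.2; norm_num at this
  · right; refine ⟨0, ?_⟩
    intro u hu
    rcases cases u hu with h' | h' | h' | h'
    · exfalso; have := key hu0 hu h.2 h'.2; norm_num at this
    · exact h'.1
    all_goals exfalso; have := key hu0 hu h.2 h'.2; norm_num at this
  · right; refine ⟨1, ?_⟩
    intro u hu
    rcases cases u hu with h' | h' | h' | h'
    · exfalso; have := key hu0 hu h.2 h'.2; norm_num at this
    · exfalso; have := key hu0 hu h.2 h'.2; norm_num at this
    · exact h'.1
    all_goals exfalso; have := key hu0 hu h.2 h'.2; norm_num at this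
  · right; refine ⟨2, ?_⟩
    intro u hu
    rcases cases u hu with h' | h' | h' | h'
    · exfalso; have := key hu0 hu h.2 h'.2; norm_num at this
    · exfalso; have := key hu0 hu h.2 h'.2; norm_num at this
    · exfalso; have := key hu0 hu h.2 h'.2; norm_num at this
    · exact h'.1

end

section

lemma schw_eq {k : ℂ → ℂ} {s : ℂ} (hk : AnalyticAt ℂ k s) (h0 : deriv k s ≠ 0) :
    Schwarzian k s = deriv (deriv (deriv k)) s / deriv k s - 3 / 2 * (deriv (deriv k) s / deriv k s) ^ 2 := by
  unfold Schwarzian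
  have h1 := hk.deriv
  have h2 := h1.deriv
  rw [deriv_fun_div h2.differentiableAt h1.differentiableAt h0]
  field_simp
  ring

lemma deriv_kx (k : ℂ → ℂ) (x : ℝ) (M : ℂ) : deriv (fun s => kx k x s / M) = fun s => deriv k (x + s) / M := by
  funext s
  unfold kx
  rw [deriv_div_const, deriv_sub_const, deriv_comp_const_add]

lemma deriv_kx2 (k : ℂ → ℂ) (x : ℝ) (M : ℂ) : deriv (fun s => k (x + s) / M) = fun s => deriv k (x + s) / M := by
  funext s
  rw [deriv_div_const, deriv_comp_const_add]

lemma deriv_exp_lin (a c s : ℂ) : deriv (fun s => a * Complex.exp (c * s)) s = a * c * Complex.exp (c * s) := by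
  have : HasDerivAt (fun s => a * Complex.exp (c * s)) (a * (Complex.exp (c * s) * (c * 1))) s :=
    ((((hasDerivAt_id s).const_mul c).cexp).const_mul a)
  rw [this.deriv]; ring

lemma WW_deriv : deriv WW = fun s => (-I * (3/2 : ℝ)) * Complex.exp ((3/2 : ℝ) * s) := by
  funext s; unfold WW; rw [deriv_exp_lin]

lemma iy_mem {y : ℝ} (hy : |y| ≤ Real.pi / 3) : (y : ℂ) * I ∈ DD := by
  show |((y : ℂ) * I).im| < _
  have : ((y : ℂ) * I).im = y := by simp
  rw [this]; linarith [Real.pi_pos]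

/-- the combination appearing in the Schwarzian -/
def Tq (k : ℂ → ℂ) (s : ℂ) : ℂ := Schwarzian k s - deriv k s ^ 2 / 2 + 1 / 2

lemma KF.anal {ρ : ℝ} {k : ℂ → ℂ} (hk : KF ρ k) {s : ℂ} (hs : s ∈ TT ρ) : AnalyticAt ℂ k s :=
  hk.diff.analyticAt ((isOpen_TT ρ).mem_nhds hs)

theorem Sys.osc_uf {ρ : ℝ} {k : ZMod 3 → ℂ → ℂ} (hk : Sys ρ k) (ho : Osc k) (j : ZMod 3)
    (u : Ultrafilter ℝ) (hu : (u : Filter ℝ) ≤ atTop) (y : ℝ → ℝ) (y0 : ℝ) (h0 : |y0| ≤ Real.pi / 3)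
    (hy : Tendsto y u (𝓝 y0)) :
    (∀ᶠ x : ℝ in u, deriv (k j) (x + y x * I) ≠ 0) ∧
    Tendsto (fun x : ℝ => Tq (k j) (x + y x * I) / (bx (k j) x : ℂ) ^ 2 - (9/8) * Complex.exp (3 * (y x * I))) u (𝓝 0) := by
  obtain ⟨htop, hr, hl⟩ := hk.osc ho j
  have L0 := hl u hu
  have L1 := L0.deriv
  have L2 := L1.deriv
  have L3 := L2.deriv
  simp only [deriv_kx, deriv_kx2] at L1 L2 L3
  have hyc : Tendsto (fun x : ℝ => (y x : ℂ) * I) u (𝓝 ((y0 : ℂ) * I)) :=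
    ((Complex.continuous_ofReal.tendsto _).comp hy).mul_const I
  have t1 := L1.tendsto (iy_mem h0) hyc
  have t2 := L2.tendsto (iy_mem h0) hyc
  have t3 := L3.tendsto (iy_mem h0) hyc
  have hm : Tendsto (fun x : ℝ => ((bx (k j) x : ℂ))⁻¹) u (𝓝 0) := by
    have := (Complex.continuous_ofReal.tendsto 0).comp (tendsto_inv_atTop_zero.comp (htop.mono_left hu))
    simpa [Function.comp_def] using this
  have hW : deriv WW (y0 * I) ≠ 0 := by
    rw [WW_deriv]
    simp
  have hmpos : ∀ᶠ x : ℝ in u, 0 < bx (k j) x := (htop.mono_left hu).eventually_gt_atTop 0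
  have hne : ∀ᶠ x : ℝ in u, deriv (k j) (x + y x * I) ≠ 0 := by
    filter_upwards [t1.eventually_ne hW] with x hx h
    rw [h] at hx; simp at hx
  refine ⟨hne, ?_⟩
  have q2 := t2.div t1 hW
  have q3 := t3.div t1 hW
  have big := (((q3.sub ((q2.pow 2).const_mul (3/2))).add_const (1/2)).mul (hm.pow 2)).sub ((t1.pow 2).div_const 2)
  have hexp : Tendsto (fun x : ℝ => (9/8) * Complex.exp (3 * (y x * I))) u (𝓝 ((9/8) * Complex.exp (3 * (y0 * I)))) := by
    have : Continuous fun z : ℂ => (9/8) * Complex.exp (3 * z) := by fun_prop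
    exact (this.tendsto _).comp hyc
  have big2 := big.sub hexp
  have e : (deriv (deriv (deriv WW)) (↑y0 * I) / deriv WW (↑y0 * I) -
              3 / 2 * (deriv (deriv WW) (↑y0 * I) / deriv WW (↑y0 * I)) ^ 2 + 1 / 2) * 0 ^ 2 -
        deriv WW (↑y0 * I) ^ 2 / 2 - 9 / 8 * Complex.exp (3 * (↑y0 * I)) = 0 := by
    rw [WW_deriv]
    have : Complex.exp (3 * (↑y0 * I)) = Complex.exp ((3/2 : ℝ) * (y0 * I)) ^ 2 := by
      rw [← Complex.exp_nat_mul]; congr 1; push_cast; ring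
    rw [this]
    push_cast
    linear_combination (-(9/8) * Complex.exp (3/2 * (↑y0 * I))^2) * Complex.I_sq
  rw [e] at big2
  refine big2.congr' ?_
  have hT : ∀ᶠ x : ℝ in u, (x : ℂ) + y x * I ∈ TT ρ := by
    have h1 : ∀ᶠ x : ℝ in u, |y x| < 2 * Real.pi / 3 :=
      (hy.abs).eventually (gt_mem_nhds (by linarith [Real.pi_pos]))
    filter_upwards [h1, hu (eventually_gt_atTop ρ)] with x h1 h2
    refine mem_TT ?_ (by simpa using h2)
    show |((y x : ℂ) * I).im| < _
    simpa using h1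
  filter_upwards [hmpos, hne, hT] with x h1 h2 h3
  simp only [Pi.div_apply]
  have h1' : (bx (k j) x : ℂ) ≠ 0 := by exact_mod_cast h1.ne'
  unfold Tq
  rw [schw_eq ((hk.kf j).anal h3) h2]
  field_simp
  ring

theorem Sys.osc_unif {ρ : ℝ} {k : ZMod 3 → ℂ → ℂ} (hk : Sys ρ k) (ho : Osc k) (j : ZMod 3) {ε : ℝ} (hε : 0 < ε) :
    ∀ᶠ x : ℝ in atTop, ∀ y : ℝ, |y| ≤ Real.pi / 3 → deriv (k j) (x + y * I) ≠ 0 ∧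
      ‖Tq (k j) (x + y * I) / (bx (k j) x : ℂ) ^ 2 - (9/8) * Complex.exp (3 * (y * I))‖ < ε := by
  apply unif_of_uf
  intro u hu y y0 h0 hy
  obtain ⟨h1, h2⟩ := hk.osc_uf ho j u hu y y0 h0 hy
  filter_upwards [h1, (Metric.tendsto_nhds.1 h2) ε hε] with x h1 h2
  exact ⟨h1, by simpa using h2⟩

end

section

lemma bx_growth {ρ : ℝ} {k : ℂ → ℂ} (hk : KF ρ k) : ∃ C > 0, ∃ N : ℕ, ∀ᶠ x : ℝ in atTop, bx k x ≤ C * Real.exp x ^ N := by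
  obtain ⟨x0, hx0⟩ : ∃ x0, x0 = max (ρ + 2) 0 := ⟨_, rfl⟩
  have hp := BB_pos k x0
  have hC := CH_pos
  refine ⟨CH * BB k x0, by positivity, NH, ?_⟩
  filter_upwards [eventually_ge_atTop x0] with x hx
  have h0 : 0 ≤ x0 := by rw [hx0]; exact le_max_right _ _
  have hr : ρ + 2 ≤ x0 := by rw [hx0]; exact le_max_left _ _
  have h1 := hk.horizB_exp (x := x0) (t := x - x0) hr (by linarith)
  rw [add_sub_cancel, abs_of_nonneg (by linarith)] at h1
  have h2 : bx k x ≤ BB k x := by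
    unfold bx BB
    have := Complex.abs_re_le_norm (k (x + mp))
    have := norm_nonneg (k (x + mm))
    linarith
  have h3 : Real.exp (NH * (x - x0)) ≤ Real.exp x ^ NH := by
    rw [← Real.exp_nat_mul]
    apply Real.exp_le_exp.2
    have : (0:ℝ) ≤ NH := Nat.cast_nonneg _
    nlinarith
  calc _ ≤ _ := h2
    _ ≤ _ := h1
    _ ≤ CH * Real.exp x ^ NH * BB k x0 := by gcongr
    _ = _ := by ring

theorem Sys.growth {ρ : ℝ} {k : ZMod 3 → ℂ → ℂ} (hk : Sys ρ k) (ho : Osc k) :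
    ∃ C > 0, ∃ N : ℕ, ∀ᶠ x : ℝ in atTop, ∀ j, ∀ y : ℝ, |y| ≤ Real.pi / 3 → deriv (k j) (x + y * I) ≠ 0 ∧
      ‖Tq (k j) (x + y * I)‖ ≤ C * Real.exp x ^ N := by
  have key : ∀ j, ∃ C > 0, ∃ N : ℕ, ∀ᶠ x : ℝ in atTop, ∀ y : ℝ, |y| ≤ Real.pi / 3 → deriv (k j) (x + y * I) ≠ 0 ∧
      ‖Tq (k j) (x + y * I)‖ ≤ C * Real.exp x ^ N := by
    intro j
    obtain ⟨C, hC, N, h⟩ := bx_growth (hk.kf j)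
    refine ⟨3 * C ^ 2, by positivity, N * 2, ?_⟩
    filter_upwards [h, hk.osc_unif ho j one_pos, (hk.osc ho j).1.eventually_gt_atTop 0] with x h1 h2 h3 y hy
    refine ⟨(h2 y hy).1, ?_⟩
    have h4 := (h2 y hy).2
    have h5 : ‖(9/8 : ℂ) * Complex.exp (3 * (y * I))‖ = 9/8 := by
      rw [norm_mul]
      have : (3 : ℂ) * (y * I) = ((3 * y : ℝ) : ℂ) * I := by push_cast; ring
      rw [this, Complex.norm_exp_ofReal_mul_I]; norm_num
    have h6 := norm_sub_norm_le (Tq (k j) (x + y * I) / (bx (k j) x : ℂ) ^ 2) ((9/8) * Complex.exp (3 * (y * I)))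
    rw [h5, norm_div, norm_pow, Complex.norm_real, Real.norm_eq_abs, abs_of_pos h3] at h6
    have h7 : ‖Tq (k j) (x + y * I)‖ / bx (k j) x ^ 2 ≤ 3 := by linarith
    rw [div_le_iff₀ (by positivity)] at h7
    calc _ ≤ 3 * bx (k j) x ^ 2 := h7
      _ ≤ 3 * (C * Real.exp x ^ N) ^ 2 := by gcongr
      _ = _ := by ring
  choose C hC N h using key
  refine ⟨C 0 + C 1 + C 2, by have := hC 0; have := hC 1; have := hC 2; positivity, N 0 + N 1 + N 2, ?_⟩
  filter_upwards [h 0, h 1, h 2, eventually_ge_atTop 0] with x h0 h1 h2 hx j y hy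
  have he : 1 ≤ Real.exp x := Real.one_le_exp hx
  have c0 := hC 0
  have c1 := hC 1
  have c2 := hC 2
  have main : ∀ j, C j ≤ C 0 + C 1 + C 2 → N j ≤ N 0 + N 1 + N 2 → C j * Real.exp x ^ N j ≤ (C 0 + C 1 + C 2) * Real.exp x ^ (N 0 + N 1 + N 2) := by
    intro j h1 h2
    gcongr
  fin_cases j
  · exact ⟨(h0 y hy).1, (h0 y hy).2.trans (main 0 (by linarith) (by omega))⟩
  · exact ⟨(h1 y hy).1, (h1 y hy).2.trans (main 1 (by linarith) (by omega))⟩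
  · exact ⟨(h2 y hy).1, (h2 y hy).2.trans (main 2 (by linarith) (by omega))⟩

theorem Sys.ratio {ρ : ℝ} {k : ZMod 3 → ℂ → ℂ} (hk : Sys ρ k) (ho : Osc k) :
    Tendsto (fun x : ℝ => Tq (k 0) ((x + 1 : ℝ) : ℂ) / Tq (k 0) x) atTop (𝓝 (Complex.exp 3)) := by
  have h1 : Tendsto (fun x : ℝ => Tq (k 0) x / (bx (k 0) x : ℂ) ^ 2) atTop (𝓝 (9/8)) := by
    rw [Metric.tendsto_nhds]
    intro ε hε
    filter_upwards [hk.osc_unif ho 0 hε] with x hx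
    have := (hx 0 (by simp; positivity)).2
    rw [dist_eq_norm]
    simpa using this
  have h2 := h1.comp (tendsto_atTop_add_const_right atTop (1:ℝ) tendsto_id)
  have h3 := (hk.osc ho 0).2.1
  have h4 : Tendsto (fun x : ℝ => ((bx (k 0) (x+1) / bx (k 0) x : ℝ) : ℂ)) atTop (𝓝 (lam : ℂ)) :=
    (Complex.continuous_ofReal.tendsto _).comp h3
  have h5 := (h2.div h1 (by norm_num)).mul (h4.pow 2)
  have e : (9/8 : ℂ) / (9/8) * (lam : ℂ) ^ 2 = Complex.exp 3 := by
    unfold lam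
    rw [div_self (by norm_num), one_mul, Complex.ofReal_exp, ← Complex.exp_nat_mul]
    congr 1; push_cast; ring
  rw [e] at h5
  refine h5.congr' ?_
  have hp := (hk.osc ho 0).1.eventually_gt_atTop 0
  filter_upwards [hp, (tendsto_atTop_add_const_right atTop (1:ℝ) tendsto_id).eventually hp] with x p1 p2
  simp only [Pi.div_apply, Function.comp, id] at *
  have p1' : (bx (k 0) x : ℂ) ≠ 0 := by exact_mod_cast p1.ne'
  have p2' : (bx (k 0) (x+1) : ℂ) ≠ 0 := by exact_mod_cast p2.ne'
  push_cast
  by_cases hz : Tq (k 0) x = 0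
  · simp [hz]
  field_simp

end

section

/-- direction of the `j`-th ray -/
def om (j : ZMod 3) : ℂ := Complex.exp ((j.val : ℂ) * ww)

lemma exp_three_ww : Complex.exp (3 * ww) = 1 := by
  have : (3 : ℂ) * ww = 2 * Real.pi * I := by unfold ww; push_cast; ring
  rw [this, Complex.exp_two_pi_mul_I]

lemma om_succ (j : ZMod 3) : om (j + 1) = om j * Complex.exp ww := by
  unfold om
  rw [← Complex.exp_add]
  fin_cases j
  · change Complex.exp (((1:ZMod 3).val : ℂ) * ww) = Complex.exp (((0 : ZMod 3).val : ℂ) * ww + ww)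
    have h1 : (0 : ZMod 3).val = 0 := rfl
    have h2 : (1 : ZMod 3).val = 1 := rfl
    rw [h1, h2]; congr 1; push_cast; ring
  · change Complex.exp (((2:ZMod 3).val : ℂ) * ww) = Complex.exp (((1 : ZMod 3).val : ℂ) * ww + ww)
    have h1 : (2 : ZMod 3).val = 2 := rfl
    have h2 : (1 : ZMod 3).val = 1 := rfl
    rw [h1, h2]; congr 1; push_cast; ring
  · change Complex.exp (((0:ZMod 3).val : ℂ) * ww) = Complex.exp (((2 : ZMod 3).val : ℂ) * ww + ww)
    have h1 : (2 : ZMod 3).val = 2 := rfl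
    have h2 : (0 : ZMod 3).val = 0 := rfl
    rw [h1, h2]
    have : ((2:ℕ) : ℂ) * ww + ww = 3 * ww := by push_cast; ring
    rw [this, exp_three_ww]; simp

lemma om_norm (j : ZMod 3) : ‖om j‖ = 1 := by
  unfold om ww
  have : ((j.val : ℂ) * (((2 * Real.pi / 3 : ℝ) : ℂ) * I)) = ((j.val * (2 * Real.pi / 3) : ℝ) : ℂ) * I := by
    rw [Complex.ofReal_mul, mul_assoc, Complex.ofReal_natCast]
  rw [this, Complex.norm_exp_ofReal_mul_I]

lemma om_ne (j : ZMod 3) : om j ≠ 0 := Complex.exp_ne_zero _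

/-- configuration of three functions, related by an order three Moebius map -/
structure Conf (R : ℝ) (E : ZMod 3 → ℂ → ℂ) : Prop where
  nf : ∀ j, MeromorphicNFOn (E j) univ
  rel : ∀ j z, ∀ᶠ w in 𝓝[≠] z, E (j + 1) w * (1 - E j w) = 1
  one : ∀ j z, R < ‖z‖ → AnalyticAt ℂ (E j) z → E j z = 1 → ∃ t : ℝ, 0 < t ∧ z = t * om j
  pos : 1 ≤ R

lemma nf_of_tendsto {g : ℂ → ℂ} {z c : ℂ} (h : MeromorphicNFAt g z) (ht : Tendsto g (𝓝[≠] z) (𝓝 c)) :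
    AnalyticAt ℂ g z ∧ g z = c := by
  have h1 := (tendsto_nhds_iff_meromorphicOrderAt_nonneg h.meromorphicAt).1 ⟨c, ht⟩
  have h2 := h.meromorphicOrderAt_nonneg_iff_analyticAt.1 h1
  exact ⟨h2, tendsto_nhds_unique (h2.continuousAt.tendsto.mono_left nhdsWithin_le_nhds) ht⟩

lemma nf_pole {g : ℂ → ℂ} {z : ℂ} (h : MeromorphicNFAt g z) (hn : ¬ AnalyticAt ℂ g z) :
    Tendsto g (𝓝[≠] z) (Bornology.cobounded ℂ) := by
  rw [tendsto_cobounded_iff_meromorphicOrderAt_neg h.meromorphicAt]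
  rw [← h.meromorphicOrderAt_nonneg_iff_analyticAt] at hn
  exact not_le.1 hn

lemma eq_of_punct {g h : ℂ → ℂ} {z : ℂ} (hg : ContinuousAt g z) (hh : ContinuousAt h z)
    (he : ∀ᶠ w in 𝓝[≠] z, g w = h w) : g z = h z :=
  tendsto_nhds_unique ((hg.tendsto.mono_left nhdsWithin_le_nhds).congr' he) (hh.tendsto.mono_left nhdsWithin_le_nhds)

namespace Conf
variable {R : ℝ} {E : ZMod 3 → ℂ → ℂ}

lemma rel_an (h : Conf R E) {j : ZMod 3} {z : ℂ} (h1 : AnalyticAt ℂ (E j) z) (h2 : AnalyticAt ℂ (E (j+1)) z) :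
    E (j + 1) z * (1 - E j z) = 1 :=
  eq_of_punct (g := fun w => E (j + 1) w * (1 - E j w)) (h := fun _ => 1)
    (h2.continuousAt.mul (continuousAt_const.sub h1.continuousAt)) continuousAt_const (h.rel j z)

lemma next_of_tendsto (h : Conf R E) {j : ZMod 3} {z c : ℂ} (hc : c ≠ 1) (ht : Tendsto (E j) (𝓝[≠] z) (𝓝 c)) :
    AnalyticAt ℂ (E (j+1)) z ∧ E (j+1) z = (1 - c)⁻¹ := by
  apply nf_of_tendsto (h.nf (j+1) (mem_univ z))
  have h1 : Tendsto (fun w => (1 - E j w)⁻¹) (𝓝[≠] z) (𝓝 (1 - c)⁻¹) :=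
    (ht.const_sub 1).inv₀ (sub_ne_zero.2 hc.symm)
  refine h1.congr' ?_
  filter_upwards [h.rel j z] with w hw
  exact (eq_inv_of_mul_eq_one_left hw).symm

lemma zero_one (h : Conf R E) {j : ZMod 3} {z : ℂ} (h1 : AnalyticAt ℂ (E j) z) (h0 : E j z = 0) :
    AnalyticAt ℂ (E (j+1)) z ∧ E (j+1) z = 1 := by
  have := h.next_of_tendsto (j := j) (z := z) (c := 0) (by norm_num) (by
    rw [← h0]; exact h1.continuousAt.tendsto.mono_left nhdsWithin_le_nhds)
  simpa using this

lemma pole_zero (h : Conf R E) {j : ZMod 3} {z : ℂ} (h1 : ¬ AnalyticAt ℂ (E j) z) :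
    AnalyticAt ℂ (E (j+1)) z ∧ E (j+1) z = 0 := by
  apply nf_of_tendsto (h.nf (j+1) (mem_univ z))
  have hp := nf_pole (h.nf j (mem_univ z)) h1
  have h2 : Tendsto (fun w => (1 - E j w)) (𝓝[≠] z) (Bornology.cobounded ℂ) := by
    rw [← tendsto_norm_atTop_iff_cobounded] at hp ⊢
    have := tendsto_atTop_add_const_right (𝓝[≠] z) (-1 : ℝ) hp
    refine tendsto_atTop_mono (fun w => ?_) this
    have := norm_sub_norm_le (E j w) 1
    rw [norm_sub_rev] at this
    simp at this ⊢; linarith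
  have h3 := tendsto_inv₀_cobounded.comp h2
  refine h3.congr' ?_
  filter_upwards [h.rel j z] with w hw
  exact (eq_inv_of_mul_eq_one_left hw).symm

lemma pole_one (h : Conf R E) {j : ZMod 3} {z : ℂ} (h1 : ¬ AnalyticAt ℂ (E j) z) :
    AnalyticAt ℂ (E (j+1+1)) z ∧ E (j+1+1) z = 1 :=
  h.zero_one (h.pole_zero h1).1 (h.pole_zero h1).2

lemma one_pole (h : Conf R E) {j : ZMod 3} {z : ℂ} (h1 : AnalyticAt ℂ (E j) z) (h0 : E j z = 1) :
    ¬ AnalyticAt ℂ (E (j+1)) z := by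
  intro h2
  have := h.rel_an h1 h2
  rw [h0] at this; simp at this

end Conf

lemma ray_im {t : ℝ} (ht : 0 < t) {s c : ℂ} (h : Complex.exp s = t * Complex.exp c) :
    ∃ n : ℤ, s.im = c.im + n * (2 * Real.pi) := by
  have : (t : ℂ) = Complex.exp (Real.log t : ℝ) := by rw [← Complex.ofReal_exp, Real.exp_log ht]
  rw [this, ← Complex.exp_add, Complex.exp_eq_exp_iff_exists_int] at h
  obtain ⟨n, hn⟩ := h
  refine ⟨n, ?_⟩
  rw [hn]; simp

lemma ray_off {t a : ℝ} (ht : 0 < t) {s : ℂ} (hs : |s.im| < 2 * Real.pi / 3) (ha : 2 * Real.pi / 3 ≤ a) (ha2 : a ≤ 4 * Real.pi / 3)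
    (h : Complex.exp s = t * Complex.exp (a * I)) : False := by
  obtain ⟨n, hn⟩ := ray_im ht h
  simp at hn
  rw [abs_lt] at hs
  have hp := Real.pi_pos
  have h1 : (n : ℝ) < 0 := by nlinarith
  have h2 : (-1 : ℝ) < n := by nlinarith
  have h3 : n < 0 := by exact_mod_cast h1
  have h4 : (-1 : ℤ) < n := by exact_mod_cast h2
  omega

lemma TT_exp {R : ℝ} (hR : 1 ≤ R) {s : ℂ} (hs : s ∈ TT (Real.log R)) (j : ZMod 3) : R < ‖om j * Complex.exp s‖ := by
  rw [norm_mul, om_norm, one_mul, Complex.norm_exp]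
  exact (Real.log_lt_iff_lt_exp (by linarith)).1 hs.1

namespace Conf
variable {R : ℝ} {E : ZMod 3 → ℂ → ℂ}

lemma anal (h : Conf R E) (j : ZMod 3) {s : ℂ} (hs : s ∈ TT (Real.log R)) : AnalyticAt ℂ (E j) (om j * Complex.exp s) := by
  by_contra hn
  obtain ⟨t, ht, he⟩ := h.one _ _ (TT_exp h.pos hs j) (h.pole_one hn).1 (h.pole_one hn).2
  rw [om_succ, om_succ, mul_assoc, mul_comm (t : ℂ), mul_assoc] at he
  have he := mul_left_cancel₀ (om_ne j) he
  refine ray_off ht hs.2 (a := 4 * Real.pi / 3) (by linarith [Real.pi_pos]) le_rfl ?_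
  rw [he, ← Complex.exp_add, mul_comm]
  congr 2; unfold ww; push_cast; ring

lemma nz (h : Conf R E) (j : ZMod 3) {s : ℂ} (hs : s ∈ TT (Real.log R)) : E j (om j * Complex.exp s) ≠ 0 := by
  intro hn
  have ha := h.anal j hs
  obtain ⟨t, ht, he⟩ := h.one _ _ (TT_exp h.pos hs j) (h.zero_one ha hn).1 (h.zero_one ha hn).2
  rw [om_succ, mul_comm (t : ℂ), mul_assoc] at he
  have he := mul_left_cancel₀ (om_ne j) he
  refine ray_off ht hs.2 (a := 2 * Real.pi / 3) (by linarith [Real.pi_pos]) (by linarith [Real.pi_pos]) ?_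
  rw [he, mul_comm]; rfl

lemma o1 (h : Conf R E) (j : ZMod 3) {s : ℂ} (hs : s ∈ TT (Real.log R)) (h1 : E j (om j * Complex.exp s) = 1) : s.im = 0 := by
  obtain ⟨t, ht, he⟩ := h.one _ _ (TT_exp h.pos hs j) (h.anal j hs) h1
  rw [mul_comm (t : ℂ)] at he
  have he := mul_left_cancel₀ (om_ne j) he
  obtain ⟨n, hn⟩ := ray_im (c := 0) ht (by simpa using he)
  simp at hn
  have h2 := hs.2
  rw [hn, abs_lt] at h2
  have hp := Real.pi_pos
  have h3 : (n : ℝ) < 1 := by nlinarith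
  have h4 : (-1 : ℝ) < n := by nlinarith
  have h3 : n < 1 := by exact_mod_cast h3
  have h4 : (-1 : ℤ) < n := by exact_mod_cast h4
  have : n = 0 := by omega
  rw [hn, this]; simp

theorem sys (h : Conf R E) : ∃ k : ZMod 3 → ℂ → ℂ, Sys (Real.log R) k ∧
    ∀ j, ∀ s ∈ TT (Real.log R), Complex.exp (k j s) = E j (om j * Complex.exp s) := by
  have key : ∀ j, ∃ k : ℂ → ℂ, DifferentiableOn ℂ k (TT (Real.log R)) ∧ ∀ s ∈ TT (Real.log R), Complex.exp (k s) = E j (om j * Complex.exp s) := by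
    intro j
    refine exists_log_convex (isOpen_TT _) (convex_TT _) ⟨(Real.log R + 1 : ℝ), ?_⟩ ?_ (fun s hs => h.nz j hs)
    · constructor
      · simp
      · simp; positivity
    · intro s hs
      have := (h.anal j hs).differentiableAt.comp s (f := fun s => om j * Complex.exp s) (by fun_prop)
      exact this.differentiableWithinAt
  choose k hk hke using key
  refine ⟨k, ⟨fun j => ⟨hk j, fun s hs h1 => h.o1 j hs ((hke j s hs) ▸ h1)⟩, ?_⟩, hke⟩
  intro j s hs h0
  have hs' : s - ((2 * Real.pi / 3 : ℝ) : ℂ) * I ∈ TT (Real.log R) := by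
    constructor
    · simpa using hs.1
    · have := hs.2
      rw [abs_lt] at this ⊢
      simp
      constructor <;> linarith [this.2]
  have e : om (j+1) * Complex.exp (s - ((2 * Real.pi / 3 : ℝ) : ℂ) * I) = om j * Complex.exp s := by
    rw [om_succ, mul_assoc, ← Complex.exp_add]; congr 2; unfold ww; ring
  have ha := h.anal (j+1) hs'
  rw [hke _ _ hs', hke _ _ hs, e]
  rw [e] at ha
  exact h.rel_an (h.anal j hs) ha

end Conf

lemma om_zero : om 0 = 1 := by simp [om]

lemma cover {z : ℂ} (hz : z ≠ 0) : ∃ j, ∃ y : ℝ, |y| ≤ Real.pi / 3 ∧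
    z = om j * Complex.exp ((Real.log ‖z‖ : ℝ) + y * I) := by
  have h0 : z = Complex.exp ((Real.log ‖z‖ : ℝ) + z.arg * I) := by
    rw [Complex.exp_add, ← Complex.ofReal_exp, Real.exp_log (norm_pos_iff.2 hz)]
    exact (Complex.norm_mul_exp_arg_mul_I z).symm
  have h1 := Complex.neg_pi_lt_arg z
  have h2 := Complex.arg_le_pi z
  have o1 : om 1 = Complex.exp ww := by have := om_succ 0; rw [zero_add, om_zero, one_mul] at this; exact this
  have o2 : om 2 = Complex.exp (2 * ww) := by
    have := om_succ 1; rw [o1, ← Complex.exp_add] at this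
    rw [two_mul]; exact this
  rcases le_or_gt |z.arg| (Real.pi / 3) with h | h
  · exact ⟨0, z.arg, h, by rw [om_zero, one_mul]; exact h0⟩
  rcases lt_abs.1 h with h | h
  · refine ⟨1, z.arg - 2 * Real.pi / 3, by rw [abs_le]; constructor <;> linarith, ?_⟩
    rw [o1, ← Complex.exp_add]
    conv_lhs => rw [h0]
    congr 1; unfold ww; push_cast; ring
  · refine ⟨2, z.arg + 2 * Real.pi / 3, by rw [abs_le]; constructor <;> linarith, ?_⟩
    rw [o2, ← Complex.exp_add]
    conv_lhs => rw [h0, ← mul_one (Complex.exp _), ← exp_three_ww, ← Complex.exp_add]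
    congr 1; unfold ww; push_cast; ring

end

section

lemma comp_d1 {f g : ℂ → ℂ} {z : ℂ} (hf : AnalyticAt ℂ f (g z)) (hg : AnalyticAt ℂ g z) :
    deriv (fun w => f (g w)) =ᶠ[𝓝 z] fun w => deriv f (g w) * deriv g w := by
  filter_upwards [hg.eventually_analyticAt, hg.continuousAt.eventually hf.eventually_analyticAt] with w h1 h2
  exact deriv_comp w h2.differentiableAt h1.differentiableAt

lemma comp_d2 {f g : ℂ → ℂ} {z : ℂ} (hf : AnalyticAt ℂ f (g z)) (hg : AnalyticAt ℂ g z) :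
    deriv (deriv (fun w => f (g w))) =ᶠ[𝓝 z] fun w => deriv (deriv f) (g w) * deriv g w ^ 2 + deriv f (g w) * deriv (deriv g) w := by
  refine (comp_d1 hf hg).deriv.trans ?_
  filter_upwards [hg.eventually_analyticAt, hg.continuousAt.eventually hf.eventually_analyticAt] with w h1 h2
  have e1 : HasDerivAt (fun w => deriv f (g w)) (deriv (deriv f) (g w) * deriv g w) w :=
    h2.deriv.differentiableAt.hasDerivAt.comp w h1.differentiableAt.hasDerivAt
  have e2 := e1.fun_mul h1.deriv.differentiableAt.hasDerivAt
  rw [e2.deriv]; ring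

lemma comp_d3 {f g : ℂ → ℂ} {z : ℂ} (hf : AnalyticAt ℂ f (g z)) (hg : AnalyticAt ℂ g z) :
    deriv (deriv (deriv (fun w => f (g w)))) z = deriv (deriv (deriv f)) (g z) * deriv g z ^ 3
      + 3 * (deriv (deriv f) (g z) * deriv g z * deriv (deriv g) z) + deriv f (g z) * deriv (deriv (deriv g)) z := by
  rw [(comp_d2 hf hg).deriv_eq]
  have e1 : HasDerivAt (fun w => deriv f (g w)) (deriv (deriv f) (g z) * deriv g z) z :=
    hf.deriv.differentiableAt.hasDerivAt.comp z hg.differentiableAt.hasDerivAt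
  have e2 : HasDerivAt (fun w => deriv (deriv f) (g w)) (deriv (deriv (deriv f)) (g z) * deriv g z) z :=
    hf.deriv.deriv.differentiableAt.hasDerivAt.comp z hg.differentiableAt.hasDerivAt
  have g1 := hg.deriv.differentiableAt.hasDerivAt
  have g2 := hg.deriv.deriv.differentiableAt.hasDerivAt
  have := (e2.fun_mul (g1.fun_pow 2)).fun_add (e1.fun_mul g2)
  rw [this.deriv]; push_cast; ring

lemma schw_comp {f g : ℂ → ℂ} {z : ℂ} (hf : AnalyticAt ℂ f (g z)) (hg : AnalyticAt ℂ g z)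
    (h1 : deriv f (g z) ≠ 0) (h2 : deriv g z ≠ 0) :
    Schwarzian (fun w => f (g w)) z = Schwarzian f (g z) * deriv g z ^ 2 + Schwarzian g z := by
  have hd : deriv (fun w => f (g w)) z = deriv f (g z) * deriv g z := (comp_d1 hf hg).self_of_nhds
  have hfg : AnalyticAt ℂ (fun w => f (g w)) z := hf.comp hg
  rw [schw_eq hf h1, schw_eq hg h2, schw_eq hfg (by rw [hd]; exact mul_ne_zero h1 h2)]
  rw [comp_d3 hf hg, (comp_d2 hf hg).self_of_nhds, hd]
  field_simp
  ring

lemma schw_congr {f g : ℂ → ℂ} {z : ℂ} (h : f =ᶠ[𝓝 z] g) : Schwarzian f z = Schwarzian g z := by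
  unfold Schwarzian
  have h1 := h.deriv
  have h2 := h1.deriv
  have h3 : (fun w => deriv (deriv f) w / deriv f w) =ᶠ[𝓝 z] (fun w => deriv (deriv g) w / deriv g w) := by
    filter_upwards [h1, h2] with w a b; rw [a, b]
  rw [h3.deriv_eq, h1.self_of_nhds, h2.self_of_nhds]

lemma deriv_cexp' (c : ℂ) : deriv (fun s => c * Complex.exp s) = fun s => c * Complex.exp s := by
  funext s; simp

lemma schw_exp (c : ℂ) (hc : c ≠ 0) (s : ℂ) : Schwarzian (fun s => c * Complex.exp s) s = -(1/2) := by
  have ha : AnalyticAt ℂ (fun s => c * Complex.exp s) s := by fun_prop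
  have hn : c * Complex.exp s ≠ 0 := mul_ne_zero hc (Complex.exp_ne_zero _)
  rw [schw_eq ha (by rw [deriv_cexp']; exact hn)]
  simp only [deriv_cexp']
  rw [div_self hn]; norm_num

lemma log_schw {E k : ℂ → ℂ} {c s : ℂ} (hc : c ≠ 0) (hE : AnalyticAt ℂ E (c * Complex.exp s)) (hk : AnalyticAt ℂ k s)
    (he : ∀ᶠ w in 𝓝 s, Complex.exp (k w) = E (c * Complex.exp w)) (h0 : deriv k s ≠ 0) :
    deriv E (c * Complex.exp s) ≠ 0 ∧ (c * Complex.exp s) ^ 2 * Schwarzian E (c * Complex.exp s) = Tq k s := by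
  have hexp : AnalyticAt ℂ (fun s => 1 * Complex.exp s) (k s) := by fun_prop
  have hphi : AnalyticAt ℂ (fun s => c * Complex.exp s) s := by fun_prop
  have hz : c * Complex.exp s ≠ 0 := mul_ne_zero hc (Complex.exp_ne_zero _)
  have he' : (fun w => (fun s => 1 * Complex.exp s) (k w)) =ᶠ[𝓝 s] (fun w => E ((fun s => c * Complex.exp s) w)) := by
    filter_upwards [he] with w hw; simpa using hw
  have d1 := (comp_d1 hexp hk).self_of_nhds
  have d2 := (comp_d1 (f := E) (g := fun s => c * Complex.exp s) hE hphi).self_of_nhds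
  rw [he'.deriv_eq, d2] at d1
  simp only [deriv_cexp'] at d1
  have hE0 : deriv E (c * Complex.exp s) ≠ 0 := by
    intro h
    rw [h, zero_mul] at d1
    have : 1 * Complex.exp (k s) * deriv k s ≠ 0 := mul_ne_zero (by simp) h0
    exact this d1.symm
  refine ⟨hE0, ?_⟩
  have s1 := schw_comp hexp hk (by rw [deriv_cexp']; simp) h0
  have s2 := schw_comp (f := E) (g := fun s => c * Complex.exp s) hE hphi hE0 (by rw [deriv_cexp']; exact hz)
  rw [schw_congr he', s2, schw_exp 1 one_ne_zero, schw_exp c hc, deriv_cexp'] at s1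
  unfold Tq
  linear_combination s1

lemma TT_mem_of {ρ x y : ℝ} (hx : ρ < x) (hy : |y| ≤ Real.pi / 3) : (x : ℂ) + y * I ∈ TT ρ :=
  mem_TT (iy_mem hy) (by simpa using hx)

theorem Conf.core {R : ℝ} {E k : ZMod 3 → ℂ → ℂ} (h : Conf R E) (hk : Sys (Real.log R) k)
    (hke : ∀ j, ∀ s ∈ TT (Real.log R), Complex.exp (k j s) = E j (om j * Complex.exp s)) (ho : Osc k) :
    (∃ R' > 0, ∃ C : ℝ, ∃ N : ℕ, ∀ z : ℂ, R' < ‖z‖ → ∃ j, AnalyticAt ℂ (E j) z ∧ deriv (E j) z ≠ 0 ∧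
      ‖Schwarzian (E j) z‖ ≤ C * ‖z‖ ^ N) ∧
    (∀ᶠ t : ℝ in atTop, AnalyticAt ℂ (E 0) t ∧ deriv (E 0) t ≠ 0) ∧
    Tendsto (fun t : ℝ => Schwarzian (E 0) ((Real.exp 1 * t : ℝ) : ℂ) / Schwarzian (E 0) t) atTop (𝓝 (Complex.exp 1)) := by
  have hlog : ∀ j, ∀ s ∈ TT (Real.log R), deriv (k j) s ≠ 0 → deriv (E j) (om j * Complex.exp s) ≠ 0 ∧
      (om j * Complex.exp s) ^ 2 * Schwarzian (E j) (om j * Complex.exp s) = Tq (k j) s := by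
    intro j s hs h0
    refine log_schw (om_ne j) (h.anal j hs) ((hk.kf j).anal hs) ?_ h0
    filter_upwards [(isOpen_TT _).mem_nhds hs] with w hw
    exact hke j w hw
  obtain ⟨C, hC, N, hgr⟩ := hk.growth ho
  obtain ⟨X, hX⟩ := eventually_atTop.1 hgr
  have hreal : ∀ x : ℝ, max (Real.log R + 1) X ≤ x → deriv (k 0) x ≠ 0 := by
    intro x hx
    have := (hX x (le_trans (le_max_right _ _) hx) 0 0 (by simp; positivity)).1
    simpa using this
  have hTr : ∀ x : ℝ, max (Real.log R + 1) X ≤ x → (x : ℂ) ∈ TT (Real.log R) := by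
    intro x hx
    have := TT_mem_of (ρ := Real.log R) (x := x) (y := 0) (by have := (le_max_left _ _).trans hx; linarith) (by simp; positivity)
    simpa using this
  refine ⟨⟨max (Real.exp (max (Real.log R + 1) X)) 1, by positivity, C, N, ?_⟩, ?_, ?_⟩
  · intro z hz
    have hz1 : 1 < ‖z‖ := lt_of_le_of_lt (le_max_right _ _) hz
    have hz0 : z ≠ 0 := by intro h; rw [h] at hz1; simp at hz1; linarith
    obtain ⟨j, y, hy, he⟩ := cover hz0
    have hx : max (Real.log R + 1) X < Real.log ‖z‖ := by
      rw [Real.lt_log_iff_exp_lt (by linarith)]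
      exact lt_of_le_of_lt (le_max_left _ _) hz
    have hT := TT_mem_of (ρ := Real.log R) (x := Real.log ‖z‖) (by have := lt_of_le_of_lt (le_max_left _ _) hx; linarith) hy
    obtain ⟨d, g⟩ := hX (Real.log ‖z‖) (le_trans (le_max_right _ _) hx.le) j y hy
    obtain ⟨l1, l2⟩ := hlog j _ hT d
    have la := h.anal j hT
    rw [← he] at l1 l2 la
    refine ⟨j, la, l1, ?_⟩
    rw [← l2, Real.exp_log (by linarith), norm_mul, norm_pow] at g
    have : 1 ≤ ‖z‖ ^ 2 := one_le_pow₀ hz1.le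
    nlinarith [norm_nonneg (Schwarzian (E j) z)]
  · filter_upwards [Real.tendsto_log_atTop.eventually (eventually_ge_atTop (max (Real.log R + 1) X)), eventually_gt_atTop 0] with t ht h0
    have e : om 0 * Complex.exp (Real.log t : ℝ) = t := by
      rw [om_zero, one_mul, ← Complex.ofReal_exp, Real.exp_log h0]
    have a := h.anal 0 (hTr _ ht)
    have b := (hlog 0 _ (hTr _ ht) (hreal _ ht)).1
    rw [e] at a b
    exact ⟨a, b⟩
  · have h1 := ((hk.ratio ho).comp Real.tendsto_log_atTop).mul_const (Complex.exp (-2))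
    rw [← Complex.exp_add] at h1
    have e : (3 : ℂ) + -2 = 1 := by norm_num
    rw [e] at h1
    refine h1.congr' ?_
    filter_upwards [Real.tendsto_log_atTop.eventually (eventually_ge_atTop (max (Real.log R + 1) X)), eventually_gt_atTop 0] with t ht h0
    have e : om 0 * Complex.exp (Real.log t : ℝ) = t := by
      rw [om_zero, one_mul, ← Complex.ofReal_exp, Real.exp_log h0]
    have e2 : om 0 * Complex.exp ((Real.log t + 1 : ℝ) : ℂ) = (Real.exp 1 * t : ℝ) := by
      rw [om_zero, one_mul, ← Complex.ofReal_exp, Real.exp_add, Real.exp_log h0, mul_comm]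
    have ht' : max (Real.log R + 1) X ≤ Real.log t + 1 := by linarith
    have b := (hlog 0 _ (hTr _ ht) (hreal _ ht)).2
    have b' := (hlog 0 _ (hTr _ ht') (hreal _ ht')).2
    rw [e] at b
    rw [e2] at b'
    simp only [Function.comp]
    rw [← b, ← b']
    have t0 : (t : ℂ) ≠ 0 := by exact_mod_cast h0.ne'
    push_cast
    have e3 : Complex.exp 1 ^ 2 * Complex.exp (-2) = 1 := by
      rw [← Complex.exp_nat_mul, ← Complex.exp_add]; norm_num
    by_cases hS : Schwarzian (E 0) t = 0
    · simp [hS]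
    field_simp
    linear_combination Schwarzian (E 0) (Complex.exp 1 * t) * e3

end

section

/-- rationality of a meromorphic function in normal form -/
def RatF (g : ℂ → ℂ) : Prop :=
  ∃ p q : Polynomial ℂ, q ≠ 0 ∧ ∀ z, AnalyticAt ℂ g z → q.eval z ≠ 0 → g z = p.eval z / q.eval z

lemma fin_of_bdd {S : Set ℂ} {R : ℝ} (h : ∀ z, ∀ᶠ w in 𝓝[≠] z, w ∉ S) (hR : ∀ z ∈ S, ‖z‖ ≤ R) : S.Finite := by
  by_contra hinf
  obtain ⟨z, -, hz⟩ := Set.Infinite.exists_accPt_of_subset_isCompact (K := Metric.closedBall (0:ℂ) R) hinf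
    (isCompact_closedBall _ _) (fun z hz => by simpa using hR z hz)
  rw [accPt_iff_frequently_nhdsNE] at hz
  exact hz (h z)

lemma poly_bound (q : Polynomial ℂ) : ∃ C : ℝ, 0 ≤ C ∧ ∀ z : ℂ, 1 ≤ ‖z‖ → ‖q.eval z‖ ≤ C * ‖z‖ ^ q.natDegree := by
  refine ⟨∑ i ∈ Finset.range (q.natDegree + 1), ‖q.coeff i‖, Finset.sum_nonneg fun _ _ => norm_nonneg _, fun z hz => ?_⟩
  rw [Polynomial.eval_eq_sum_range, Finset.sum_mul]
  refine (norm_sum_le _ _).trans (Finset.sum_le_sum fun i hi => ?_)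
  rw [norm_mul, norm_pow]
  exact mul_le_mul_of_nonneg_left (pow_le_pow_right₀ hz (by rw [Finset.mem_range] at hi; omega)) (norm_nonneg _)

lemma nf_an_eventually {g : ℂ → ℂ} (h : MeromorphicOn g univ) (z : ℂ) : ∀ᶠ w in 𝓝[≠] z, AnalyticAt ℂ g w :=
  (h z (mem_univ z)).eventually_analyticAt

theorem rat_of_bound {g : ℂ → ℂ} {R C : ℝ} {N : ℕ} (hg : MeromorphicNFOn g univ)
    (ha : ∀ z, R < ‖z‖ → AnalyticAt ℂ g z)
    (hb : ∃ᶠ r : ℝ in atTop, ∀ z : ℂ, ‖z‖ = r → ‖g z‖ ≤ C * r ^ N) : RatF g := by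
  have hm : MeromorphicOn g univ := hg.meromorphicOn
  have hfin : {z | ¬ AnalyticAt ℂ g z}.Finite := by
    refine fin_of_bdd (R := R) (fun z => ?_) (fun z hz => ?_)
    · filter_upwards [nf_an_eventually hm z] with w hw
      simpa using hw
    · by_contra hn; exact hz (ha z (not_le.1 hn))
  choose n hn using fun z => (hm z (mem_univ z))
  let S := hfin.toFinset
  let q : Polynomial ℂ := ∏ a ∈ S, (Polynomial.X - Polynomial.C a) ^ n a
  have hq : q ≠ 0 := Finset.prod_ne_zero_iff.2 fun a _ => pow_ne_zero _ (Polynomial.X_sub_C_ne_zero a)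
  have hqa : ∀ z, AnalyticAt ℂ (fun w => q.eval w) z := fun z => by
    have := (Polynomial.differentiable q)
    exact this.analyticAt z
  have hqm : MeromorphicOn (fun w => q.eval w * g w) univ := fun z _ =>
    (hqa z).meromorphicAt.mul (hm z (mem_univ z))
  let h := toMeromorphicNFOn (fun w => q.eval w * g w) univ
  have hnf : MeromorphicNFOn h univ := meromorphicNFOn_toMeromorphicNFOn _ _
  have hhe : ∀ z, ∀ᶠ w in 𝓝[≠] z, h w = q.eval w * g w := fun z =>
    hqm.toMeromorphicNFOn_eq_self_on_nhdsNE (mem_univ z)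
  have hlim : ∀ z, ∃ φ : ℂ → ℂ, AnalyticAt ℂ φ z ∧ ∀ᶠ w in 𝓝[≠] z, φ w = q.eval w * g w := by
    intro z
    by_cases hz : AnalyticAt ℂ g z
    · exact ⟨_, (hqa z).mul hz, Eventually.of_forall fun _ => rfl⟩
    · have hzS : z ∈ S := by simpa [S] using hz
      refine ⟨fun w => (∏ a ∈ S.erase z, (Polynomial.X - Polynomial.C a) ^ n a).eval w * ((w - z) ^ n z • g w), ?_, ?_⟩
      · refine AnalyticAt.mul ?_ (hn z)
        exact (Polynomial.differentiable _).analyticAt z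
      · refine Eventually.of_forall fun w => ?_
        have : q = (Polynomial.X - Polynomial.C z) ^ n z * ∏ a ∈ S.erase z, (Polynomial.X - Polynomial.C a) ^ n a :=
          (Finset.mul_prod_erase S _ hzS).symm
        rw [this]; simp only [Polynomial.eval_mul, Polynomial.eval_pow, Polynomial.eval_sub, Polynomial.eval_X, Polynomial.eval_C, smul_eq_mul]
        ring
  have hhan : ∀ z, AnalyticAt ℂ h z := by
    intro z
    obtain ⟨φ, hφ, he⟩ := hlim z
    refine (nf_of_tendsto (c := φ z) (hnf (mem_univ z)) ?_).1
    refine (hφ.continuousAt.tendsto.mono_left nhdsWithin_le_nhds).congr' ?_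
    filter_upwards [he, hhe z] with w h1 h2
    rw [h1, h2]
  have hhg : ∀ z, AnalyticAt ℂ g z → h z = q.eval z * g z := fun z hz =>
    eq_of_punct (h := fun w => q.eval w * g w) (hhan z).continuousAt ((hqa z).mul hz).continuousAt (hhe z)
  obtain ⟨Cq, hCq, hqb⟩ := poly_bound q
  obtain ⟨p, -, hp⟩ := entire_poly (g := h) (C := Cq * C) (N := q.natDegree + N) (fun z => (hhan z).differentiableAt) (by
    refine (hb.and_eventually ((eventually_gt_atTop R).and (eventually_ge_atTop 1))).mono ?_
    rintro r ⟨hr, h1, h2⟩ z hz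
    rw [hhg z (ha z (by rw [hz]; exact h1)), norm_mul]
    have e1 := hqb z (by rw [hz]; exact h2)
    rw [hz] at e1
    calc _ ≤ (Cq * r ^ q.natDegree) * (C * r ^ N) := mul_le_mul e1 (hr z hz) (norm_nonneg _) (by positivity)
      _ = _ := by ring)
  refine ⟨p, q, hq, fun z hz hqz => ?_⟩
  rw [← hp, hhg z hz]; field_simp

section
variable {R : ℝ} {E k : ZMod 3 → ℂ → ℂ}

lemma zmod3_three (j : ZMod 3) : j + 2 + 1 = j := by
  have : (2 : ZMod 3) + 1 = 0 := rfl
  rw [add_assoc, this, add_zero]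

lemma zmod3_cases : ∀ i j : ZMod 3, i = j ∨ i = j + 1 ∨ i = j + 2 := by decide

theorem Conf.one_st (h : Conf R E)
    (hke : ∀ j, ∀ s ∈ TT (Real.log R), Complex.exp (k j s) = E j (om j * Complex.exp s))
    {j : ZMod 3} (ho : ∀ u : Ultrafilter ℝ, (u : Filter ℝ) ≤ atTop → OneSt u k j) : RatF (E j) := by
  have key : ∀ᶠ x : ℝ in atTop, ∀ y : ℝ, |y| ≤ Real.pi / 3 →
      ‖Complex.exp (k j (x + y * I)) - 1‖ ≤ 1/2 ∧ 4 ≤ ‖Complex.exp (k (j+1) (x + y * I))‖ ∧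
      ‖Complex.exp (k (j+2) (x + y * I))‖ ≤ 1/2 := by
    apply unif_of_uf
    intro u hu y y0 hy0 hy
    obtain ⟨h1, h2, h3⟩ := ho u hu
    have hd := iy_mem hy0
    have hσ : Tendsto (fun x => (y x : ℂ) * I) u (𝓝 (y0 * I)) :=
      ((Complex.continuous_ofReal.tendsto _).comp hy).mul_const I
    have h1 : To1 u (k j) DD := by simpa [HK] using h1
    have h2 : ToTop u (k (j+1)) DD := by simpa [HK] using h2
    have h3 : ToBot u (k (j+2)) DD := by simpa [HK] using h3
    have t1 := h1 _ hd _ hσ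
    have t2 := Real.tendsto_exp_atTop.comp (h2 _ hd _ hσ)
    have t3 := Real.tendsto_exp_atBot.comp (h3 _ hd _ hσ)
    have e1 := t1.eventually (Metric.closedBall_mem_nhds _ (show (0:ℝ) < 1/2 by norm_num))
    have e2 := t2.eventually (eventually_ge_atTop 4)
    have e3 := t3.eventually (Iic_mem_nhds (show (0:ℝ) < 1/2 by norm_num))
    filter_upwards [e1, e2, e3] with x a b c
    refine ⟨by simpa [dist_eq_norm] using a, ?_, ?_⟩
    · rw [Complex.norm_exp]; exact b
    · rw [Complex.norm_exp]; exact c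
  obtain ⟨X, hX⟩ := eventually_atTop.1 key
  have hmain : ∀ z : ℂ, Real.exp (max X (Real.log R + 1)) < ‖z‖ → AnalyticAt ℂ (E j) z ∧ ‖E j z‖ ≤ 2 := by
    intro z hz
    have hz0 : z ≠ 0 := by
      intro h0; rw [h0, norm_zero] at hz; exact absurd hz (not_lt.2 (Real.exp_pos _).le)
    have hl : max X (Real.log R + 1) < Real.log ‖z‖ := (Real.lt_log_iff_exp_lt (norm_pos_iff.2 hz0)).2 hz
    obtain ⟨i, y, hy, he⟩ := cover hz0
    set x := Real.log ‖z‖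
    have hT : (x : ℂ) + y * I ∈ TT (Real.log R) := TT_mem_of (by linarith [le_max_right X (Real.log R + 1)]) hy
    obtain ⟨b1, b2, b3⟩ := hX x ((le_max_left _ _).trans hl.le) y hy
    have hi := h.anal i hT
    have hei := hke i _ hT
    rw [← he] at hi hei
    have hcase := zmod3_cases i j
    rcases hcase with rfl | rfl | rfl
    · rw [hei] at b1
      refine ⟨hi, ?_⟩
      have := norm_add_le (E i z - 1) 1
      simp at this
      linarith
    · rw [hei] at b2
      have hA : AnalyticAt ℂ (E j) z := by
        by_contra hn
        have := (h.pole_zero hn).2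
        rw [this] at b2; simp at b2; linarith
      refine ⟨hA, ?_⟩
      have := h.rel_an hA hi
      have e : ‖1 - E j z‖ ≤ 1/4 := by
        have h5 : ‖E (j+1) z‖ * ‖1 - E j z‖ = 1 := by rw [← norm_mul, this, norm_one]
        nlinarith [norm_nonneg (1 - E j z)]
      have := norm_sub_le 1 (1 - E j z)
      simp at this; linarith
    · rw [hei] at b3
      have hc : E (j+2) z ≠ 1 := by
        intro h1; rw [h1] at b3; simp at b3; linarith
      have := h.next_of_tendsto (j := j + 2) hc (hi.continuousAt.tendsto.mono_left nhdsWithin_le_nhds)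
      rw [zmod3_three] at this
      refine ⟨this.1, ?_⟩
      rw [this.2, norm_inv]
      have h6 : 1/2 ≤ ‖1 - E (j+2) z‖ := by
        have := norm_sub_norm_le 1 (E (j+2) z)
        rw [norm_one] at this; linarith
      calc _ ≤ (1/2 : ℝ)⁻¹ := inv_anti₀ (by norm_num) h6
        _ = 2 := by norm_num
  refine rat_of_bound (R := Real.exp (max X (Real.log R + 1))) (C := 2) (N := 0) (h.nf j) (fun z hz => (hmain z hz).1) ?_
  apply Eventually.frequently
  filter_upwards [eventually_gt_atTop (Real.exp (max X (Real.log R + 1)))] with r hr z hz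
  rw [pow_zero, mul_one]
  exact (hmain z (by rw [hz]; exact hr)).2
end

end

section

/-- integer valued order -/
def ordI (G : ℂ → ℂ) (z : ℂ) : ℤ := (meromorphicOrderAt G z).untop₀

lemma ordI_zero {G : ℂ → ℂ} {z : ℂ} (hG : MeromorphicNFAt G z) (ht : meromorphicOrderAt G z ≠ ⊤)
    (h : ordI G z = 0) : AnalyticAt ℂ G z ∧ G z ≠ 0 := by
  have h0 : meromorphicOrderAt G z = 0 := by
    rw [ordI, WithTop.untop₀_eq_zero] at h
    exact h.resolve_right ht
  exact ⟨hG.meromorphicOrderAt_nonneg_iff_analyticAt.1 h0.ge, hG.meromorphicOrderAt_eq_zero_iff.1 h0⟩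

lemma ordI_form {G : ℂ → ℂ} {z : ℂ} (hG : MeromorphicAt G z) (ht : meromorphicOrderAt G z ≠ ⊤) :
    ∃ g : ℂ → ℂ, AnalyticAt ℂ g z ∧ g z ≠ 0 ∧ ∀ᶠ w in 𝓝[≠] z, G w = (w - z) ^ (ordI G z) * g w := by
  have := (meromorphicOrderAt_eq_int_iff hG (n := ordI G z)).1 (WithTop.coe_untop₀_of_ne_top ht).symm
  simpa using this

/-- local form of the logarithmic derivative -/
lemma logd_form {G : ℂ → ℂ} {z : ℂ} (hG : MeromorphicAt G z) (ht : meromorphicOrderAt G z ≠ ⊤) :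
    ∃ φ : ℂ → ℂ, AnalyticAt ℂ φ z ∧ ∀ᶠ w in 𝓝[≠] z, deriv G w / G w - ordI G z / (w - z) = φ w := by
  obtain ⟨g, hg, hg0, he⟩ := ordI_form hG ht
  refine ⟨fun w => deriv g w / g w, hg.deriv.div hg hg0, ?_⟩
  have h1 : ∀ᶠ w in 𝓝[≠] z, ∀ᶠ v in 𝓝 w, G v = (v - z) ^ (ordI G z) * g v := by
    have := eventually_eventually_nhdsWithin.2 he
    filter_upwards [this, self_mem_nhdsWithin] with w hw hwz
    rwa [nhdsWithin_eq_nhds.2 (isOpen_compl_singleton.mem_nhds hwz)] at hw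
  have h2 : ∀ᶠ w in 𝓝[≠] z, AnalyticAt ℂ g w ∧ g w ≠ 0 :=
    nhdsWithin_le_nhds (hg.eventually_analyticAt.and (hg.continuousAt.eventually_ne hg0))
  filter_upwards [h1, h2, self_mem_nhdsWithin] with w h1 h2 hwz
  have hwz' : w - z ≠ 0 := sub_ne_zero.2 hwz
  have hd : HasDerivAt (fun v => (v - z) ^ (ordI G z) * g v)
      (((ordI G z : ℂ) * (w - z) ^ (ordI G z - 1) * 1) * g w + (w - z) ^ (ordI G z) * deriv g w) w :=
by
    have d1 : HasDerivAt (fun v : ℂ => v - z) 1 w := (hasDerivAt_id w).sub_const z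
    have d2 : HasDerivAt (fun v : ℂ => (v - z) ^ (ordI G z)) ((ordI G z : ℂ) * (w - z) ^ (ordI G z - 1) * 1) w :=
      HasDerivAt.comp (h₂ := fun y : ℂ => y ^ (ordI G z)) w (hasDerivAt_zpow (ordI G z) (w - z) (Or.inl hwz')) d1
    exact d2.mul h2.1.differentiableAt.hasDerivAt
  have h1' : G =ᶠ[𝓝 w] fun v => (v - z) ^ (ordI G z) * g v := h1
  rw [h1'.deriv_eq, hd.deriv, h1.self_of_nhds, zpow_sub_one₀ hwz']
  have h3 : (w - z) ^ (ordI G z) ≠ 0 := zpow_ne_zero _ hwz'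
  have h4 := h2.2
  field_simp
  ring

lemma ld {G : ℂ → ℂ} (hG : MeromorphicNFOn G univ) (ht : ∀ z, meromorphicOrderAt G z ≠ ⊤) {r C : ℝ} (hr : 0 < r)
    (T : Finset ℂ) (hT : ∀ u ∈ T, ‖u‖ < r) (hT2 : ∀ z, ‖z‖ ≤ r → z ∉ T → ordI G z = 0)
    (hb : ∀ z, ‖z‖ = r → ‖z * (deriv G z / G z)‖ ≤ C) :
    |∑ u ∈ T, (ordI G u : ℝ)| ≤ C ∧
    ∀ w, ‖w‖ ≤ r / 2 → w ∉ T → ‖deriv G w / G w - ∑ u ∈ T, (ordI G u : ℂ) / (w - u)‖ ≤ 2 * C / r := by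
  set L : ℂ → ℂ := fun w => deriv G w / G w - ∑ u ∈ T, (ordI G u : ℂ) / (w - u) with hL
  have hm : MeromorphicOn G univ := hG.meromorphicOn
  have hsum : ∀ (T' : Finset ℂ) (z : ℂ), z ∉ T' → AnalyticAt ℂ (fun w => ∑ u ∈ T', (ordI G u : ℂ) / (w - u)) z := by
    intro T' z hz
    refine Finset.analyticAt_fun_sum _ fun u hu => ?_
    refine analyticAt_const.div (analyticAt_id.sub analyticAt_const) (sub_ne_zero.2 ?_)
    rintro rfl; exact hz hu
  have hLa : ∀ z, ‖z‖ ≤ r → z ∉ T → AnalyticAt ℂ L z := by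
    intro z hz hzT
    obtain ⟨h1, h2⟩ := ordI_zero (hG (mem_univ z)) (ht z) (hT2 z hz hzT)
    exact (h1.deriv.div h1 h2).sub (hsum T z hzT)
  have hLf : ∀ z, ‖z‖ ≤ r → ∃ φ : ℂ → ℂ, AnalyticAt ℂ φ z ∧ ∀ᶠ w in 𝓝[≠] z, L w = φ w := by
    intro z hz
    by_cases hzT : z ∈ T
    · obtain ⟨φ, hφ, he⟩ := logd_form (hm z (mem_univ z)) (ht z)
      refine ⟨fun w => φ w - ∑ u ∈ T.erase z, (ordI G u : ℂ) / (w - u), hφ.sub (hsum _ z (by simp)), ?_⟩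
      filter_upwards [he] with w hw
      simp only [hL]
      rw [← hw, ← Finset.add_sum_erase T _ hzT]; ring
    · exact ⟨L, hLa z hz hzT, Eventually.of_forall fun _ => rfl⟩
  let H : ℂ → ℂ := fun z => if z ∈ T then limUnder (𝓝[≠] z) L else L z
  have hHL : ∀ z, z ∉ T → H z = L z := fun z hz => by simp [H, hz]
  have hTn : ∀ z, ∀ᶠ w in 𝓝[≠] z, w ∉ T := by
    intro z
    have : ∀ᶠ w in 𝓝 z, w ∉ (T.erase z : Finset ℂ) := by
      have hc : IsClosed ((T.erase z : Finset ℂ) : Set ℂ) := (Finset.finite_toSet _).isClosed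
      have := hc.isOpen_compl.mem_nhds (show z ∈ ((T.erase z : Finset ℂ) : Set ℂ)ᶜ by simp)
      filter_upwards [this] with w hw
      exact hw
    filter_upwards [nhdsWithin_le_nhds this, self_mem_nhdsWithin] with w hw hwz
    intro h; exact hw (Finset.mem_erase.2 ⟨hwz, h⟩)
  have hHa : ∀ z, ‖z‖ ≤ r → AnalyticAt ℂ H z := by
    intro z hz
    obtain ⟨φ, hφ, he⟩ := hLf z hz
    have hlim : Tendsto L (𝓝[≠] z) (𝓝 (φ z)) :=
      (hφ.continuousAt.tendsto.mono_left nhdsWithin_le_nhds).congr' (by filter_upwards [he] with w hw; exact hw.symm)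
    have hz0 : H z = φ z := by
      by_cases hzT : z ∈ T
      · simp only [H, hzT, if_true]; exact hlim.limUnder_eq
      · rw [hHL z hzT]
        exact tendsto_nhds_unique ((hLa z hz hzT).continuousAt.tendsto.mono_left nhdsWithin_le_nhds) hlim
    refine hφ.congr ?_
    have h3 : ∀ᶠ w in 𝓝[≠] z, φ w = H w := by
      filter_upwards [he, hTn z] with w h1 h2
      rw [hHL w h2, h1]
    rw [eventually_nhdsWithin_iff] at h3
    filter_upwards [h3] with w hw
    by_cases hwz : w = z
    · rw [hwz, hz0]
    · exact hw hwz
  have hdiff : DiffContOnCl ℂ H (Metric.ball 0 r) := by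
    apply DifferentiableOn.diffContOnCl
    intro z hz
    rw [closure_ball _ hr.ne'] at hz
    exact (hHa z (by simpa using hz)).differentiableAt.differentiableWithinAt
  have hsT : ∀ z, ‖z‖ = r → z ∉ T := fun z hz h => (hT z h).ne hz
  have hinv : ∀ w : ℂ, ‖w‖ < r → ContinuousOn (fun z => (z - w)⁻¹) (Metric.sphere 0 r) := by
    intro w hw z hz
    refine ContinuousAt.continuousWithinAt (ContinuousAt.inv₀ (by fun_prop) (sub_ne_zero.2 ?_))
    rintro rfl
    rw [mem_sphere_zero_iff_norm] at hz; exact hw.ne hz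
  have hGd : ContinuousOn (fun z => deriv G z / G z) (Metric.sphere 0 r) := by
    intro z hz
    rw [mem_sphere_zero_iff_norm] at hz
    obtain ⟨h1, h2⟩ := ordI_zero (hG (mem_univ z)) (ht z) (hT2 z hz.le (hsT z hz))
    exact (h1.deriv.div h1 h2).continuousAt.continuousWithinAt
  have hGb : ∀ z, ‖z‖ = r → ‖deriv G z / G z‖ ≤ C / r := by
    intro z hz
    have := hb z hz
    rw [norm_mul, hz] at this
    rw [le_div_iff₀ hr]; linarith
  have hC : 0 ≤ C := (norm_nonneg _).trans (hb (r : ℂ) (by simp [abs_of_pos hr]))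
  have h2pi : (2 * (Real.pi : ℂ) * I) ≠ 0 := by simp [Real.pi_ne_zero]
  constructor
  · have e0 := hdiff.circleIntegral_eq_zero hr.le
    have e1 : (∮ z in C(0, r), H z) = ∮ z in C(0, r), (deriv G z / G z - ∑ u ∈ T, (ordI G u : ℂ) * (z - u)⁻¹) := by
      refine circleIntegral.integral_congr hr.le fun z hz => ?_
      rw [mem_sphere_zero_iff_norm] at hz
      rw [hHL z (hsT z hz)]
      simp [hL, div_eq_mul_inv]
    have ci : ∀ u ∈ T, CircleIntegrable (fun z => (ordI G u : ℂ) * (z - u)⁻¹) 0 r := fun u hu =>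
      (continuousOn_const.mul (hinv u (hT u hu))).circleIntegrable hr.le
    have ci2 : CircleIntegrable (fun z => ∑ u ∈ T, (ordI G u : ℂ) * (z - u)⁻¹) 0 r :=
      (continuousOn_finsetSum _ fun u hu => (continuousOn_const.mul (hinv u (hT u hu)))).circleIntegrable hr.le
    rw [e1, circleIntegral.integral_sub (hGd.circleIntegrable hr.le) ci2, circleIntegral.integral_fun_sum ci] at e0
    have e2 : ∀ u ∈ T, (∮ z in C(0, r), (ordI G u : ℂ) * (z - u)⁻¹) = ordI G u * (2 * Real.pi * I) := by
      intro u hu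
      rw [circleIntegral.integral_const_mul, circleIntegral.integral_sub_inv_of_mem_ball (by simpa using hT u hu)]
    rw [Finset.sum_congr rfl e2, ← Finset.sum_mul, sub_eq_zero] at e0
    have e3 := circleIntegral.norm_two_pi_i_inv_smul_integral_le_of_norm_le_const (f := fun z => deriv G z / G z) (c := 0) hr.le
      (fun z hz => hGb z (by simpa using hz))
    rw [e0, smul_eq_mul, mul_comm, mul_assoc, mul_inv_cancel₀ h2pi, mul_one, mul_div_cancel₀ _ hr.ne'] at e3
    have e4 : (∑ u ∈ T, (ordI G u : ℂ)) = ((∑ u ∈ T, (ordI G u : ℝ) : ℝ) : ℂ) := by push_cast; rfl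
    rw [e4, Complex.norm_real] at e3
    exact e3
  · intro w hw hwT
    have hwr : ‖w‖ < r := by linarith
    have hwb : w ∈ Metric.ball (0 : ℂ) r := by simpa using hwr
    have e0 := hdiff.circleIntegral_sub_inv_smul hwb
    have e1 : (∮ z in C(0, r), (z - w)⁻¹ • H z) = ∮ z in C(0, r), ((z - w)⁻¹ * (deriv G z / G z) - ∑ u ∈ T, (ordI G u / (u - w) : ℂ) * ((z - u)⁻¹ - (z - w)⁻¹)) := by
      refine circleIntegral.integral_congr hr.le fun z hz => ?_
      rw [mem_sphere_zero_iff_norm] at hz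
      simp only [smul_eq_mul]
      rw [hHL z (hsT z hz)]
      simp only [hL, mul_sub, Finset.mul_sum]
      congr 1
      refine Finset.sum_congr rfl fun u hu => ?_
      have h1 : z - w ≠ 0 := sub_ne_zero.2 (by rintro rfl; exact hwr.ne hz)
      have h2 : z - u ≠ 0 := sub_ne_zero.2 (by rintro rfl; exact (hT z hu).ne hz)
      have h3 : u - w ≠ 0 := sub_ne_zero.2 (by rintro rfl; exact hwT hu)
      field_simp
      ring
    have cc : ∀ u ∈ T, ContinuousOn (fun z => (ordI G u / (u - w) : ℂ) * ((z - u)⁻¹ - (z - w)⁻¹)) (Metric.sphere 0 r) := fun u hu =>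
      (continuousOn_const.mul ((hinv u (hT u hu)).sub (hinv w hwr)))
    have ci : ∀ u ∈ T, CircleIntegrable (fun z => (ordI G u / (u - w) : ℂ) * ((z - u)⁻¹ - (z - w)⁻¹)) 0 r := fun u hu =>
      (cc u hu).circleIntegrable hr.le
    have ci2 : CircleIntegrable (fun z => ∑ u ∈ T, (ordI G u / (u - w) : ℂ) * ((z - u)⁻¹ - (z - w)⁻¹)) 0 r :=
      (continuousOn_finsetSum _ cc).circleIntegrable hr.le
    have ci3 : CircleIntegrable (fun z => (z - w)⁻¹ * (deriv G z / G z)) 0 r :=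
      ((hinv w hwr).mul hGd).circleIntegrable hr.le
    rw [e1, circleIntegral.integral_sub ci3 ci2, circleIntegral.integral_fun_sum ci] at e0
    have e2 : ∀ u ∈ T, (∮ z in C(0, r), (ordI G u / (u - w) : ℂ) * ((z - u)⁻¹ - (z - w)⁻¹)) = 0 := by
      intro u hu
      rw [circleIntegral.integral_const_mul, circleIntegral.integral_sub ((hinv u (hT u hu)).circleIntegrable hr.le) ((hinv w hwr).circleIntegrable hr.le),
        circleIntegral.integral_sub_inv_of_mem_ball (by simpa using hT u hu), circleIntegral.integral_sub_inv_of_mem_ball hwb, sub_self, mul_zero]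
    rw [Finset.sum_congr rfl e2, Finset.sum_const_zero, sub_zero, smul_eq_mul, hHL w hwT] at e0
    have e3 := circleIntegral.norm_two_pi_i_inv_smul_integral_le_of_norm_le_const (f := fun z => (z - w)⁻¹ * (deriv G z / G z)) (c := 0) (C := (r/2)⁻¹ * (C / r)) hr.le
      (fun z hz => by
        have hz : ‖z‖ = r := by simpa using hz
        rw [norm_mul, norm_inv]
        refine mul_le_mul (inv_anti₀ (by linarith) ?_) (hGb z hz) (norm_nonneg _) (by positivity)
        have := norm_sub_norm_le z w
        rw [hz] at this; linarith)
    have e4 : (∮ z in C(0, r), (z - w)⁻¹ * (deriv G z / G z)) = 2 * Real.pi * I * L w := e0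
    rw [e4, smul_eq_mul, ← mul_assoc, inv_mul_cancel₀ h2pi, one_mul] at e3
    refine e3.trans (le_of_eq ?_)
    field_simp

end

section

def Phi (k : ℂ → ℂ) (s : ℂ) : ℝ := ‖deriv k s‖ + ‖Complex.exp (k s)‖ + ‖(Complex.exp (k s))⁻¹‖ + ‖(Complex.exp (k s) - 1)⁻¹‖

lemma t0y_mem (t0 : ℝ) {y : ℝ} (hy : |y| ≤ Real.pi / 3) : (t0 : ℂ) + y * I ∈ DD := by
  show |((t0 : ℂ) + y * I).im| < _
  simp; linarith [Real.pi_pos]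

lemma Phi_kx (k : ℂ → ℂ) (x : ℝ) (s : ℂ) : Phi (kx k x) s = Phi k (x + s) := by
  unfold Phi
  rw [exp_kx]
  have : deriv (kx k x) s = deriv k (x + s) := by
    unfold kx
    rw [deriv_sub_const, deriv_comp_const_add]
  rw [this]

lemma reg_bound {k K : ℂ → ℂ} {u : Ultrafilter ℝ} {t0 : ℝ} (hK : LU (u : Filter ℝ) (kx k) K DD)
    (hne : ∀ y : ℝ, |y| ≤ Real.pi / 3 → Complex.exp (K (t0 + y * I)) ≠ 1) :
    ∃ C : ℝ, ∀ᶠ x : ℝ in (u : Filter ℝ), ∀ y : ℝ, |y| ≤ Real.pi / 3 → Phi k (x + (t0 + y * I)) ≤ C ∧ Complex.exp (k (x + (t0 + y * I))) ≠ 1 := by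
  have hlim : ∀ (y : ℝ → ℝ) (y0 : ℝ), |y0| ≤ Real.pi / 3 → Tendsto y u (𝓝 y0) →
      Tendsto (fun x : ℝ => Phi k (x + (t0 + y x * I))) u (𝓝 (Phi K (t0 + y0 * I))) ∧
      Tendsto (fun x : ℝ => Complex.exp (k (x + (t0 + y x * I)))) u (𝓝 (Complex.exp (K (t0 + y0 * I)))) := by
    intro y y0 hy0 hy
    have hd := t0y_mem t0 hy0
    have hσ : Tendsto (fun x => (t0 : ℂ) + (y x : ℂ) * I) u (𝓝 (t0 + y0 * I)) :=
      (((Complex.continuous_ofReal.tendsto _).comp hy).mul_const I).const_add _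
    have h1 := hK.tendsto hd hσ
    have h2 := hK.deriv.tendsto hd hσ
    have h3 := (Complex.continuous_exp.tendsto _).comp h1
    have h4 : Tendsto (fun x => Phi (kx k x) (t0 + y x * I)) u (𝓝 (Phi K (t0 + y0 * I))) :=
      ((h2.norm.add h3.norm).add (h3.inv₀ (Complex.exp_ne_zero _)).norm).add
        ((h3.sub_const 1).inv₀ (sub_ne_zero.2 (hne y0 hy0))).norm
    refine ⟨by simpa only [Phi_kx] using h4, ?_⟩
    refine h3.congr fun x => ?_
    exact exp_kx _ _ _
  have hKd : DifferentiableOn ℂ K DD := hK.diff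
  have hKa : AnalyticOnNhd ℂ K DD := hKd.analyticOnNhd isOpen_DD
  have hcont : ContinuousOn (fun y : ℝ => Phi K (t0 + y * I)) (Icc (-(Real.pi/3)) (Real.pi/3)) := by
    intro y hy
    apply ContinuousAt.continuousWithinAt
    have hd := t0y_mem t0 (abs_le.2 hy)
    have hc : ContinuousAt (fun y : ℝ => (t0 : ℂ) + y * I) y := by fun_prop
    have c1 : ContinuousAt (fun y : ℝ => K (t0 + y * I)) y := ContinuousAt.comp (f := fun y : ℝ => (t0 : ℂ) + y * I) (hKa _ hd).continuousAt hc
    have c2 : ContinuousAt (fun y : ℝ => deriv K (t0 + y * I)) y := ContinuousAt.comp (f := fun y : ℝ => (t0 : ℂ) + y * I) (hKa _ hd).deriv.continuousAt hc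
    have c3 : ContinuousAt (fun y : ℝ => Complex.exp (K (t0 + y * I))) y := c1.cexp
    exact ((c2.norm.add c3.norm).add (c3.inv₀ (Complex.exp_ne_zero _)).norm).add
      ((c3.sub continuousAt_const).inv₀ (sub_ne_zero.2 (hne y (abs_le.2 hy)))).norm
  obtain ⟨C, hC⟩ := (isCompact_Icc.image_of_continuousOn hcont).bddAbove
  refine ⟨C + 1, ?_⟩
  by_contra hcon
  have hcon : ∀ᶠ x : ℝ in (u : Filter ℝ), ∃ y : ℝ, |y| ≤ Real.pi / 3 ∧ (Phi k (x + (t0 + y * I)) ≤ C + 1 → Complex.exp (k (x + (t0 + y * I))) = 1) := by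
    rw [← Ultrafilter.eventually_not] at hcon
    filter_upwards [hcon] with x hx
    push Not at hx; exact hx
  have hch : ∀ x : ℝ, ∃ y : ℝ, (∃ y : ℝ, |y| ≤ Real.pi / 3 ∧ (Phi k (x + (t0 + y * I)) ≤ C + 1 → Complex.exp (k (x + (t0 + y * I))) = 1)) →
      |y| ≤ Real.pi / 3 ∧ (Phi k (x + (t0 + y * I)) ≤ C + 1 → Complex.exp (k (x + (t0 + y * I))) = 1) := by
    intro x
    by_cases hx : ∃ y : ℝ, |y| ≤ Real.pi / 3 ∧ (Phi k (x + (t0 + y * I)) ≤ C + 1 → Complex.exp (k (x + (t0 + y * I))) = 1)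
    · exact ⟨hx.choose, fun _ => hx.choose_spec⟩
    · exact ⟨0, fun h => absurd h hx⟩
  choose y hy' using hch
  have hy := hcon.mono fun x hx => hy' x hx
  obtain ⟨y0, hy0, hle⟩ := (isCompact_Icc (a := -(Real.pi/3)) (b := Real.pi/3)).ultrafilter_le_nhds (u.map y) (by
    rw [le_principal_iff]
    exact hy.mono fun x hx => abs_le.1 hx.1)
  obtain ⟨h1, h1'⟩ := hlim y y0 (abs_le.2 hy0) hle
  have h2 : Phi K (t0 + y0 * I) ≤ C := hC ⟨y0, hy0, rfl⟩
  obtain ⟨x, ⟨hx1, hx3⟩, hx2⟩ := (((h1.eventually (gt_mem_nhds (show Phi K (t0 + y0 * I) < C + 1 by linarith))).and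
    (h1'.eventually_ne (hne y0 (abs_le.2 hy0)))).and hy).exists
  exact hx3 (hx2.2 hx1.le)

lemma exists_t0 {K : ZMod 3 → ℂ → ℂ} (hd : ∀ j, DifferentiableOn ℂ (K j) DD) (hne : ∀ j, ∀ s ∈ SP ∪ SM, Complex.exp (K j s) ≠ 1) :
    ∃ t0 : ℝ, ∀ j, ∀ y : ℝ, |y| ≤ Real.pi / 3 → Complex.exp (K j (t0 + y * I)) ≠ 1 := by
  have h0 : (0 : ℂ) ∈ DD := by show |(0:ℂ).im| < _; simp; positivity
  have h1 : ∀ j, ∀ᶠ z in 𝓝[≠] (0:ℂ), Complex.exp (K j z) ≠ 1 := by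
    intro j
    by_contra hcon
    rw [not_eventually] at hcon
    have ha : AnalyticOnNhd ℂ (fun z => Complex.exp (K j z)) DD := ((hd j).cexp).analyticOnNhd isOpen_DD
    have := ha.eqOn_of_preconnected_of_frequently_eq (g := fun _ => 1) (fun z _ => analyticAt_const) convex_DD.isPreconnected h0
      (hcon.mono fun z hz => not_not.1 hz)
    exact hne j mp (Or.inl mp_mem) (this (SP_sub mp_mem))
  have h2 : Tendsto (fun t : ℝ => (t : ℂ)) (𝓝[≠] 0) (𝓝[≠] (0:ℂ)) := by
    refine tendsto_nhdsWithin_iff.2 ⟨?_, ?_⟩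
    · have := (Complex.continuous_ofReal.tendsto 0).mono_left (nhdsWithin_le_nhds (s := {0}ᶜ)); simpa using this
    · filter_upwards [self_mem_nhdsWithin] with t ht
      simpa using ht
  obtain ⟨t0, ht⟩ := (h2.eventually (eventually_all.2 h1)).exists
  refine ⟨t0, fun j y hy => ?_⟩
  have hpi := Real.pi_pos
  rw [abs_le] at hy
  rcases lt_trichotomy y 0 with h | h | h
  · exact hne j _ (Or.inr (by
      show -(2 * Real.pi / 3) < ((t0 : ℂ) + y * I).im ∧ ((t0 : ℂ) + y * I).im < 0
      simp; constructor <;> linarith))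
  · rw [h]; simpa using ht j
  · exact hne j _ (Or.inl (by
      show 0 < ((t0 : ℂ) + y * I).im ∧ ((t0 : ℂ) + y * I).im < 2 * Real.pi / 3
      simp; constructor <;> linarith))

section
variable {R : ℝ} {E k : ZMod 3 → ℂ → ℂ}

lemma Conf.next_logd (h : Conf R E) {j : ZMod 3} {z : ℂ} (ha : AnalyticAt ℂ (E j) z) (h1 : E j z ≠ 1) :
    AnalyticAt ℂ (E (j+1)) z ∧ E (j+1) z = (1 - E j z)⁻¹ ∧ deriv (E (j+1)) z = deriv (E j) z / (1 - E j z) ^ 2 := by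
  obtain ⟨h2, h3⟩ := h.next_of_tendsto h1 (ha.continuousAt.tendsto.mono_left nhdsWithin_le_nhds)
  refine ⟨h2, h3, ?_⟩
  have he : ∀ᶠ w in 𝓝 z, E (j+1) w = (1 - E j w)⁻¹ := by
    filter_upwards [ha.continuousAt.eventually_ne h1, ha.eventually_analyticAt] with w hw1 hw2
    exact (h.next_of_tendsto hw1 (hw2.continuousAt.tendsto.mono_left nhdsWithin_le_nhds)).2
  have he' : E (j+1) =ᶠ[𝓝 z] fun w => (1 - E j w)⁻¹ := he
  have hd : HasDerivAt (fun w => (1 - E j w)⁻¹) (-(-deriv (E j) z) / (1 - E j z) ^ 2) z :=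
    (ha.differentiableAt.hasDerivAt.const_sub 1).inv (sub_ne_zero.2 h1.symm)
  rw [he'.deriv_eq, hd.deriv, neg_neg]

lemma Conf.sector_bd (h : Conf R E) {i : ZMod 3} {z : ℂ} {C : ℝ} (ha : AnalyticAt ℂ (E i) z) (h0 : E i z ≠ 0) (h1 : E i z ≠ 1)
    (hC : ‖z * (deriv (E i) z / E i z)‖ + ‖E i z‖ + ‖(E i z)⁻¹‖ + ‖(E i z - 1)⁻¹‖ ≤ C) (j : ZMod 3) :
    AnalyticAt ℂ (E j) z ∧ E j z ≠ 0 ∧ ‖E j z‖ ≤ (1 + C) ^ 3 ∧ ‖z * (deriv (E j) z / E j z)‖ ≤ (1 + C) ^ 3 := by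
  have n1 := norm_nonneg (z * (deriv (E i) z / E i z))
  have n2 := norm_nonneg (E i z)
  have n3 := norm_nonneg (E i z)⁻¹
  have n4 := norm_nonneg (E i z - 1)⁻¹
  have hC0 : 0 ≤ C := by linarith
  have hp1 : C ≤ (1 + C) ^ 3 := by nlinarith [mul_nonneg hC0 hC0, mul_nonneg (mul_nonneg hC0 hC0) hC0]
  have hp2 : C * C ≤ (1 + C) ^ 3 := by nlinarith [mul_nonneg hC0 hC0, mul_nonneg (mul_nonneg hC0 hC0) hC0]
  have hp3 : C * C * C ≤ (1 + C) ^ 3 := by nlinarith [mul_nonneg hC0 hC0, mul_nonneg (mul_nonneg hC0 hC0) hC0]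
  have hp4 : 1 + C ≤ (1 + C) ^ 3 := by nlinarith [mul_nonneg hC0 hC0, mul_nonneg (mul_nonneg hC0 hC0) hC0]
  have s1 : E i z - 1 ≠ 0 := sub_ne_zero.2 h1
  have s2 : 1 - E i z ≠ 0 := sub_ne_zero.2 h1.symm
  obtain ⟨a1, v1, d1⟩ := h.next_logd ha h1
  have h11 : E (i+1) z ≠ 1 := by
    rw [v1]; intro hh
    have := inv_eq_one.1 hh
    exact h0 (by linear_combination -this)
  obtain ⟨a2, v2, d2⟩ := h.next_logd a1 h11
  have e2 : i + 1 + 1 = i + 2 := by rw [add_assoc]; rfl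
  rw [e2] at a2 v2 d2
  have v2' : E (i+2) z = 1 - (E i z)⁻¹ := by
    rw [v2, v1]
    have : 1 - (1 - E i z)⁻¹ = - E i z / (1 - E i z) := by field_simp; ring
    rw [this]; field_simp
    ring
  rcases zmod3_cases j i with rfl | rfl | rfl
  · exact ⟨ha, h0, by linarith, by linarith⟩
  · refine ⟨a1, by rw [v1]; exact inv_ne_zero s2, ?_, ?_⟩
    · rw [v1, norm_inv, norm_sub_rev, ← norm_inv]; linarith
    · have : z * (deriv (E (i+1)) z / E (i+1) z) = -((z * (deriv (E i) z / E i z)) * E i z * (E i z - 1)⁻¹) := by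
        rw [d1, v1]
        have : (1 - E i z) = -(E i z - 1) := by ring
        rw [this]; field_simp
      rw [this, norm_neg, norm_mul, norm_mul]
      refine le_trans ?_ hp3
      exact mul_le_mul (mul_le_mul (by linarith) (by linarith) n2 hC0) (by linarith) n4 (by positivity)
  · refine ⟨a2, ?_, ?_, ?_⟩
    · rw [v2', sub_ne_zero]; intro hh; exact h1 (inv_eq_one.1 hh.symm)
    · rw [v2']; refine (norm_sub_le _ _).trans ?_
      rw [norm_one]; linarith
    · have : z * (deriv (E (i+2)) z / E (i+2) z) = (z * (deriv (E i) z / E i z)) * (E i z - 1)⁻¹ := by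
        rw [d2, v2', v1, d1]
        have : 1 - (1 - E i z)⁻¹ = - E i z / (1 - E i z) := by field_simp; ring
        rw [this]
        have : 1 - (E i z)⁻¹ = (E i z - 1) / E i z := by field_simp
        rw [this]
        have : (1 - E i z) = -(E i z - 1) := by ring
        rw [this]; field_simp
      rw [this, norm_mul]
      refine le_trans ?_ hp2
      exact mul_le_mul (by linarith) (by linarith) n4 hC0

lemma Conf.k_deriv (h : Conf R E) (hk : Sys (Real.log R) k)
    (hke : ∀ j, ∀ s ∈ TT (Real.log R), Complex.exp (k j s) = E j (om j * Complex.exp s)) {j : ZMod 3} {s : ℂ}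
    (hs : s ∈ TT (Real.log R)) :
    (om j * Complex.exp s) * (deriv (E j) (om j * Complex.exp s) / E j (om j * Complex.exp s)) = deriv (k j) s := by
  have ha := h.anal j hs
  have hka := (hk.kf j).anal hs
  have h1 : HasDerivAt (fun w => Complex.exp (k j w)) (Complex.exp (k j s) * deriv (k j) s) s := hka.differentiableAt.hasDerivAt.cexp
  have h2 : HasDerivAt (fun w => om j * Complex.exp w) (om j * Complex.exp s) s := (Complex.hasDerivAt_exp s).const_mul _
  have h3 : HasDerivAt (fun w => E j (om j * Complex.exp w)) (deriv (E j) (om j * Complex.exp s) * (om j * Complex.exp s)) s :=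
    HasDerivAt.comp (h₂ := E j) s ha.differentiableAt.hasDerivAt h2
  have he : (fun w => Complex.exp (k j w)) =ᶠ[𝓝 s] fun w => E j (om j * Complex.exp w) := by
    filter_upwards [(isOpen_TT _).mem_nhds hs] with w hw
    exact hke j w hw
  have h4 := h1.unique (h3.congr_of_eventuallyEq he)
  rw [hke j s hs] at h4
  have := h.nz j hs
  field_simp
  linear_combination -h4

theorem Conf.circ (h : Conf R E) (hk : Sys (Real.log R) k)
    (hke : ∀ j, ∀ s ∈ TT (Real.log R), Complex.exp (k j s) = E j (om j * Complex.exp s))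
    {u : Ultrafilter ℝ} (hu : (u : Filter ℝ) ≤ atTop) (hreg : ∀ j, HK u (k j) 3) :
    ∃ C : ℝ, ∃ᶠ r : ℝ in atTop, (∀ z : ℂ, ‖z‖ = r → ∀ j, AnalyticAt ℂ (E j) z ∧ E j z ≠ 0 ∧ ‖E j z‖ ≤ C ∧
      ‖z * (deriv (E j) z / E j z)‖ ≤ C) ∧ ‖k 0 (Real.log r : ℝ) - k 0 (Real.log (r / 2) : ℝ)‖ ≤ C := by
  have hreg' : ∀ j, ∃ K, LU (u : Filter ℝ) (kx (k j)) K DD ∧ ∀ s ∈ SP ∪ SM, Complex.exp (K s) ≠ 1 := by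
    intro j; simpa [HK] using hreg j
  choose K hK hne using hreg'
  obtain ⟨t0, ht0⟩ := exists_t0 (fun j => (hK j).diff) hne
  choose C hC using fun j => reg_bound (hK j) (ht0 j)
  obtain ⟨M, hM⟩ := (Set.finite_range C).bddAbove
  have hM : ∀ j, C j ≤ M := fun j => hM ⟨j, rfl⟩
  have hd0 : (t0 : ℂ) ∈ DD := by simpa using t0y_mem t0 (y := 0) (by simp; positivity)
  have hd1 : ((t0 - Real.log 2 : ℝ) : ℂ) ∈ DD := by simpa using t0y_mem (t0 - Real.log 2) (y := 0) (by simp; positivity)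
  have hdiff := (((hK 0).tendsto_const hd0).sub ((hK 0).tendsto_const hd1)).norm
  set c := ‖K 0 t0 - K 0 ((t0 - Real.log 2 : ℝ) : ℂ)‖ with hc
  have hx0 : ∀ᶠ x in (u : Filter ℝ), (Real.log R - t0 < x) := hu (eventually_gt_atTop _)
  have key : ∃ᶠ x : ℝ in atTop, Real.log R - t0 < x ∧ (∀ j, ∀ y : ℝ, |y| ≤ Real.pi / 3 → Phi (k j) (x + (t0 + y * I)) ≤ M ∧ Complex.exp (k j (x + (t0 + y * I))) ≠ 1) ∧
      ‖kx (k 0) x t0 - kx (k 0) x ((t0 - Real.log 2 : ℝ) : ℂ)‖ < c + 1 := by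
    have : ∀ᶠ x : ℝ in (u : Filter ℝ), Real.log R - t0 < x ∧ (∀ j, ∀ y : ℝ, |y| ≤ Real.pi / 3 → Phi (k j) (x + (t0 + y * I)) ≤ M ∧ Complex.exp (k j (x + (t0 + y * I))) ≠ 1) ∧
      ‖kx (k 0) x t0 - kx (k 0) x ((t0 - Real.log 2 : ℝ) : ℂ)‖ < c + 1 := by
      filter_upwards [hx0, eventually_all.2 hC, hdiff.eventually (gt_mem_nhds (show c < c + 1 by linarith))] with x h1 h2 h3
      exact ⟨h1, fun j y hy => ⟨(h2 j y hy).1.trans (hM j), (h2 j y hy).2⟩, h3⟩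
    exact this.frequently.filter_mono hu
  refine ⟨max ((1 + M) ^ 3) (c + 1), ?_⟩
  have htend : Tendsto (fun x : ℝ => Real.exp (x + t0)) atTop atTop := Real.tendsto_exp_atTop.comp (tendsto_atTop_add_const_right _ _ tendsto_id)
  refine htend.frequently (key.mono ?_)
  rintro x ⟨hx, hP, hd⟩
  constructor
  · intro z hz j
    have hz0 : z ≠ 0 := by
      intro h0; rw [h0, norm_zero] at hz; exact (Real.exp_pos _).ne hz
    obtain ⟨i, y, hy, he⟩ := cover hz0
    rw [hz, Real.log_exp] at he
    have hT : ((x + t0 : ℝ) : ℂ) + y * I ∈ TT (Real.log R) := TT_mem_of (by linarith) hy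
    obtain ⟨hb, h1⟩ := hP i y hy
    have e1 : (x : ℂ) + (t0 + y * I) = ((x + t0 : ℝ) : ℂ) + y * I := by push_cast; ring
    rw [e1] at hb h1
    have ha := h.anal i hT
    have hn := h.nz i hT
    have hkd := h.k_deriv hk hke hT (j := i)
    unfold Phi at hb
    rw [hke i _ hT, ← he] at h1
    rw [hke i _ hT, ← hkd] at hb
    rw [← he] at ha hn hb
    obtain ⟨b1, b2, b3, b4⟩ := h.sector_bd ha hn h1 hb j
    exact ⟨b1, b2, b3.trans (le_max_left _ _), b4.trans (le_max_left _ _)⟩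
  · refine le_trans ?_ (le_max_right _ _)
    refine le_trans (le_of_eq ?_) hd.le
    rw [Real.log_div (Real.exp_pos _).ne' two_ne_zero, Real.log_exp]
    unfold kx
    congr 1
    have e1 : ((x + t0 : ℝ) : ℂ) = x + t0 := by push_cast; rfl
    have e2 : ((x + t0 - Real.log 2 : ℝ) : ℂ) = x + (t0 - Real.log 2 : ℝ) := by push_cast; ring
    rw [e1, e2]; ring
end

end

section

section
variable {R : ℝ} {E k : ZMod 3 → ℂ → ℂ}

lemma Conf.ord_ne (h : Conf R E) (j : ZMod 3) (z : ℂ) : meromorphicOrderAt (E j) z ≠ ⊤ := by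
  have hs : ((Real.log R + 1 : ℝ) : ℂ) ∈ TT (Real.log R) := by
    simpa using TT_mem_of (ρ := Real.log R) (x := Real.log R + 1) (y := 0) (by linarith) (by simp; positivity)
  have h0 : meromorphicOrderAt (E j) (om j * Complex.exp ((Real.log R + 1 : ℝ) : ℂ)) = 0 :=
    (h.nf j (mem_univ _)).meromorphicOrderAt_eq_zero_iff.2 (h.nz j hs)
  exact MeromorphicOn.meromorphicOrderAt_ne_top_of_isPreconnected (h.nf j).meromorphicOn isPreconnected_univ (mem_univ _) (mem_univ _) (by rw [h0]; simp)

lemma Conf.ordI_coe (h : Conf R E) (j : ZMod 3) (z : ℂ) : meromorphicOrderAt (E j) z = ((ordI (E j) z : ℤ) : WithTop ℤ) :=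
  (WithTop.coe_untop₀_of_ne_top (h.ord_ne j z)).symm

lemma Conf.ordI_of_ne (h : Conf R E) {j : ZMod 3} {z : ℂ} (hz : E j z ≠ 0) : ordI (E j) z = 0 := by
  have h0 := (h.nf j (mem_univ z)).meromorphicOrderAt_eq_zero_iff.2 hz
  unfold ordI; rw [h0]; rfl

lemma Conf.ordI_disc (h : Conf R E) (j : ZMod 3) (z : ℂ) : ∀ᶠ w in 𝓝[≠] z, ordI (E j) w = 0 := by
  have := (meromorphicOrderAt_ne_top_iff_eventually_ne_zero ((h.nf j).meromorphicOn z (mem_univ z))).1 (h.ord_ne j z)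
  filter_upwards [this] with w hw
  exact h.ordI_of_ne hw

lemma Conf.ordI_fin (h : Conf R E) (j : ZMod 3) (r : ℝ) : {u : ℂ | ordI (E j) u ≠ 0 ∧ ‖u‖ ≤ r}.Finite := by
  refine fin_of_bdd (R := r) (fun z => ?_) (fun z hz => hz.2)
  filter_upwards [h.ordI_disc j z] with w hw hw2
  exact hw2.1 hw

lemma Conf.ordI_neg (h : Conf R E) {j : ZMod 3} {z : ℂ} : ordI (E j) z < 0 ↔ ¬ AnalyticAt ℂ (E j) z := by
  rw [← (h.nf j (mem_univ z)).meromorphicOrderAt_nonneg_iff_analyticAt, h.ordI_coe]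
  simp

lemma Conf.ordI_pos (h : Conf R E) {j : ZMod 3} {z : ℂ} (hz : 0 < ordI (E j) z) : AnalyticAt ℂ (E j) z ∧ E j z = 0 := by
  refine ⟨?_, ?_⟩
  · by_contra hn
    have := h.ordI_neg.2 hn
    omega
  · by_contra hn
    have := h.ordI_of_ne hn
    omega

lemma Conf.ord_rel (h : Conf R E) (j : ZMod 3) (z : ℂ) :
    meromorphicOrderAt (fun w => 1 - E j w) z = ((- ordI (E (j+1)) z : ℤ) : WithTop ℤ) := by
  have hm : MeromorphicAt (fun w => 1 - E j w) z := (MeromorphicAt.const 1 z).sub ((h.nf j).meromorphicOn z (mem_univ z))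
  have h1 : meromorphicOrderAt (fun w => 1 - E j w) z = meromorphicOrderAt (E (j+1))⁻¹ z := by
    apply meromorphicOrderAt_congr
    filter_upwards [h.rel j z] with w hw
    show 1 - E j w = (E (j+1) w)⁻¹
    exact eq_inv_of_mul_eq_one_right hw
  rw [h1, meromorphicOrderAt_inv, h.ordI_coe]
  rfl

lemma Conf.ordI_pos_part (h : Conf R E) (j : ZMod 3) (z : ℂ) : max (ordI (E (j+1)) z) 0 = max (- ordI (E j) z) 0 := by
  have h1 := h.ord_rel j z
  by_cases hn : ordI (E j) z < 0
  · have h2 : meromorphicOrderAt (fun w => 1 - E j w) z = meromorphicOrderAt (E j) z := by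
      have e : (fun w => 1 - E j w) = (fun _ => (1:ℂ)) + (- E j) := by ext w; simp [sub_eq_add_neg]
      have hmm : meromorphicOrderAt (-E j) z = meromorphicOrderAt (E j) z := meromorphicOrderAt_neg.symm
      rw [e, meromorphicOrderAt_add_eq_right_of_lt, hmm]
      · exact MeromorphicAt.const 1 z
      · rw [hmm, h.ordI_coe]
        have : (0 : WithTop ℤ) ≤ meromorphicOrderAt (fun _ => (1:ℂ)) z := (analyticAt_const).meromorphicOrderAt_nonneg
        refine lt_of_lt_of_le ?_ this
        exact_mod_cast hn
    rw [h2, h.ordI_coe] at h1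
    have : ordI (E j) z = - ordI (E (j+1)) z := by exact_mod_cast h1
    rw [this]; simp
  · have hnn : max (- ordI (E j) z) 0 = 0 := by apply max_eq_right; omega
    rw [hnn]
    apply max_eq_right
    by_contra hp
    push Not at hp
    obtain ⟨a1, a2⟩ := h.ordI_pos hp
    have a0 : AnalyticAt ℂ (E j) z := by
      by_contra hh; exact hn (h.ordI_neg.2 hh)
    have := h.rel_an a0 a1
    rw [a2] at this; simp at this

lemma Conf.ordI_ge (h : Conf R E) {j : ZMod 3} {z : ℂ} (ha : AnalyticAt ℂ (E j) z) (hd : deriv (E j) z ≠ 0) :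
    -1 ≤ ordI (E (j+1)) z := by
  have h1 := h.ord_rel j z
  by_contra hc
  push Not at hc
  have ha' : AnalyticAt ℂ (fun w => 1 - E j w) z := analyticAt_const.sub ha
  obtain ⟨g, hg, hg0, he⟩ := (meromorphicOrderAt_eq_int_iff ha'.meromorphicAt).1 h1
  have h3 : ∀ᶠ w in 𝓝[≠] z, 1 - E j w = (w - z) ^ 2 * ((w - z) ^ ((- ordI (E (j+1)) z - 2).toNat) * g w) := by
    filter_upwards [he, self_mem_nhdsWithin] with w hw hwz
    rw [hw, smul_eq_mul, ← mul_assoc]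
    congr 1
    have : - ordI (E (j+1)) z = ((2 + (- ordI (E (j+1)) z - 2).toNat : ℕ) : ℤ) := by
      push_cast; omega
    rw [← pow_add, ← zpow_natCast, ← this]
  have hga : AnalyticAt ℂ (fun w => (w - z) ^ ((- ordI (E (j+1)) z - 2).toNat) * g w) z := by fun_prop
  have h4 : (fun w => 1 - E j w) =ᶠ[𝓝 z] fun w => (w - z) ^ 2 * ((w - z) ^ ((- ordI (E (j+1)) z - 2).toNat) * g w) :=
    (AnalyticAt.frequently_eq_iff_eventually_eq ha' (by fun_prop)).1 h3.frequently
  have h5 := h4.deriv_eq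
  have h6 : HasDerivAt (fun w => 1 - E j w) (- deriv (E j) z) z := ha.differentiableAt.hasDerivAt.const_sub 1
  have h7 : HasDerivAt (fun w => (w - z) ^ 2 * ((w - z) ^ ((- ordI (E (j+1)) z - 2).toNat) * g w)) _ z :=
    (((hasDerivAt_id z).sub_const z).pow 2).mul hga.differentiableAt.hasDerivAt
  rw [h6.deriv, h7.deriv] at h5
  simp at h5
  exact hd h5

lemma om_two : om 2 = om 1 * Complex.exp ww := om_succ 1
lemma om_one : om 1 = Complex.exp ww := by
  have := om_succ 0
  rw [om_zero, one_mul] at this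
  simpa using this

lemma om_one_val : om 1 = ⟨-1/2, Real.sqrt 3 / 2⟩ := by
  rw [om_one]; unfold ww
  rw [Complex.exp_mul_I, ← Complex.ofReal_cos, ← Complex.ofReal_sin]
  have h : 2 * Real.pi / 3 = Real.pi - Real.pi / 3 := by ring
  rw [h, Real.cos_pi_sub, Real.sin_pi_sub, Real.cos_pi_div_three, Real.sin_pi_div_three]
  apply Complex.ext <;> simp
  norm_num

lemma om_two_val : om 2 = ⟨-1/2, -(Real.sqrt 3 / 2)⟩ := by
  rw [om_two, ← om_one, om_one_val]
  have := Real.mul_self_sqrt (show (0:ℝ) ≤ 3 by norm_num)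
  apply Complex.ext <;> simp <;> nlinarith

def phi (a x : ℝ) : ℝ := a * (Real.sqrt 3 / 2) / (x ^ 2 + x * a + a ^ 2)

lemma inv_im_eq (w : ℂ) : (w⁻¹).im = - w.im / (w.re ^ 2 + w.im ^ 2) := by
  rw [Complex.inv_im, Complex.normSq_apply]; ring_nf

lemma im_phi1 {a x : ℝ} : (((x : ℂ) - a * om 1)⁻¹).im = phi a x := by
  rw [inv_im_eq, om_one_val]; unfold phi
  have := Real.mul_self_sqrt (show (0:ℝ) ≤ 3 by norm_num)
  simp
  congr 1
  nlinarith

lemma im_phi2 {a x : ℝ} : (((x : ℂ) - a * om 2)⁻¹).im = - phi a x := by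
  rw [inv_im_eq, om_two_val]; unfold phi
  have := Real.mul_self_sqrt (show (0:ℝ) ≤ 3 by norm_num)
  have e1 : ((x : ℂ) - a * (⟨-1/2, -(Real.sqrt 3 / 2)⟩ : ℂ)).re = x + a / 2 := by simp; ring
  have e2 : ((x : ℂ) - a * (⟨-1/2, -(Real.sqrt 3 / 2)⟩ : ℂ)).im = a * (Real.sqrt 3 / 2) := by simp
  rw [e1, e2, neg_div]
  congr 2
  nlinarith

lemma Conf.term_far (h : Conf R E) {u : ℂ} (hu : R < ‖u‖) (x : ℝ) :
    ((ordI (E 0) u : ℂ) / (x - u)).im = |(ordI (E 0) u : ℝ)| * phi ‖u‖ x := by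
  have e : ((ordI (E 0) u : ℂ) / (x - u)).im = (ordI (E 0) u : ℝ) * ((x - u)⁻¹).im := by
    rw [div_eq_mul_inv, ← Complex.ofReal_intCast, Complex.im_ofReal_mul]
  rw [e]
  rcases lt_trichotomy (ordI (E 0) u) 0 with hh | hh | hh
  · have hn := h.ordI_neg.1 hh
    obtain ⟨t, ht, he⟩ := h.one _ _ hu (h.pole_one hn).1 (h.pole_one hn).2
    have e2 : (0 : ZMod 3) + 1 + 1 = 2 := rfl
    rw [e2] at he
    have : ‖u‖ = t := by rw [he, norm_mul, om_norm, mul_one, Complex.norm_real, Real.norm_of_nonneg ht.le]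
    rw [this, he, im_phi2, ← he, abs_of_neg (by exact_mod_cast hh)]; ring
  · rw [hh]; simp
  · obtain ⟨a1, a2⟩ := h.ordI_pos hh
    obtain ⟨t, ht, he⟩ := h.one _ _ hu (h.zero_one a1 a2).1 (h.zero_one a1 a2).2
    rw [zero_add] at he
    have : ‖u‖ = t := by rw [he, norm_mul, om_norm, mul_one, Complex.norm_real, Real.norm_of_nonneg ht.le]
    rw [this, he, im_phi1, ← he, abs_of_pos (by exact_mod_cast hh)]

lemma term_near {D : ℤ} {u : ℂ} (hu : ‖u‖ ≤ R) (hR : 0 < R) {x : ℝ} (hx : 2 * R ≤ x) :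
    |((D : ℂ) / (x - u)).im| ≤ |(D : ℝ)| * (4 * R / x ^ 2) := by
  have e : ((D : ℂ) / (x - u)).im = (D : ℝ) * ((x - u)⁻¹).im := by
    rw [div_eq_mul_inv, ← Complex.ofReal_intCast, Complex.im_ofReal_mul]
  rw [e, abs_mul]
  apply mul_le_mul_of_nonneg_left _ (abs_nonneg _)
  rw [inv_im_eq]
  simp
  have h1 := (Complex.abs_re_le_norm u).trans hu
  have h2 := (Complex.abs_im_le_norm u).trans hu
  have h3 : x / 2 ≤ x - u.re := by linarith [le_abs_self u.re]
  have h4 : x ^ 2 / 4 ≤ (x - u.re) ^ 2 + u.im ^ 2 := by nlinarith [sq_nonneg u.im]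
  have hx2 : 0 < x ^ 2 := by have : 0 < x := by linarith
                             positivity
  rw [abs_div, abs_of_pos (show 0 < (x - u.re) ^ 2 + u.im ^ 2 by linarith)]
  calc |u.im| / ((x - u.re) ^ 2 + u.im ^ 2) ≤ R / (x ^ 2 / 4) := by gcongr
    _ = _ := by field_simp

lemma phi_nonneg {a x : ℝ} (ha : 0 < a) (hx : 0 < x) : 0 ≤ phi a x := by unfold phi; positivity

lemma phi_lower {a x : ℝ} (hR : 0 < R) (ha : R < a) (hx : a ≤ x) : R / (6 * x ^ 2) ≤ phi a x := by
  unfold phi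
  have hs : 1 ≤ Real.sqrt 3 := by rw [Real.one_le_sqrt]; norm_num
  have ha0 : 0 < a := by linarith
  have hx0 : 0 < x := by linarith
  calc R / (6 * x ^ 2) = (R * (1/2)) / (3 * x ^ 2) := by field_simp; norm_num
    _ ≤ _ := by
      gcongr
      nlinarith

lemma phi_deriv {a x : ℝ} (ha : 0 < a) (hx : 0 < x) :
    HasDerivAt (fun t => Real.arctan ((t + a / 2) / (a * (Real.sqrt 3 / 2)))) (phi a x) x := by
  have hs : 0 < Real.sqrt 3 := by positivity
  have h1 : HasDerivAt (fun t => (t + a / 2) / (a * (Real.sqrt 3 / 2))) (1 / (a * (Real.sqrt 3 / 2))) x :=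
    ((hasDerivAt_id x).add_const _).div_const _
  refine h1.arctan.congr_deriv ?_
  unfold phi
  have := Real.sq_sqrt (show (0:ℝ) ≤ 3 by norm_num)
  field_simp
  rw [this]
  ring
end

end

section

lemma count_le {S : Finset ℂ} {A : ℂ → ℝ} {α β : ℝ} (hαβ : α ≤ β) (hinj : Set.InjOn A S)
    (hS : ∀ x ∈ S, (∃ n : ℤ, A x = n * (2 * Real.pi)) ∧ α ≤ A x ∧ A x ≤ β) :
    (S.card : ℝ) ≤ (β - α) / (2 * Real.pi) + 1 := by
  have hp : 0 < 2 * Real.pi := by positivity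
  have h1 : S.card ≤ (Finset.Icc ⌈α / (2 * Real.pi)⌉ ⌊β / (2 * Real.pi)⌋).card := by
    apply Finset.card_le_card_of_injOn (fun x => ⌊A x / (2 * Real.pi)⌋)
    · intro x hx
      obtain ⟨⟨n, hn⟩, h2, h3⟩ := hS x hx
      have e : ⌊A x / (2 * Real.pi)⌋ = n := by rw [hn, mul_div_cancel_right₀ _ hp.ne', Int.floor_intCast]
      simp only [Finset.coe_Icc, Set.mem_Icc]
      rw [e, Int.ceil_le, Int.le_floor, div_le_iff₀ hp, le_div_iff₀ hp, ← hn]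
      exact ⟨h2, h3⟩
    · intro x hx y hy hxy
      obtain ⟨⟨n, hn⟩, -⟩ := hS x hx
      obtain ⟨⟨m, hm⟩, -⟩ := hS y hy
      have e : ⌊A x / (2 * Real.pi)⌋ = n := by rw [hn, mul_div_cancel_right₀ _ hp.ne', Int.floor_intCast]
      have e' : ⌊A y / (2 * Real.pi)⌋ = m := by rw [hm, mul_div_cancel_right₀ _ hp.ne', Int.floor_intCast]
      simp only [e, e'] at hxy
      apply hinj hx hy
      rw [hn, hm, hxy]
  rw [Int.card_Icc] at h1
  have h2 : (S.card : ℤ) ≤ max (⌊β / (2 * Real.pi)⌋ + 1 - ⌈α / (2 * Real.pi)⌉) 0 := by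
    rw [← Int.ofNat_toNat]; exact_mod_cast h1
  have h3 : (S.card : ℝ) ≤ max ((⌊β / (2 * Real.pi)⌋ : ℝ) + 1 - ⌈α / (2 * Real.pi)⌉) 0 := by exact_mod_cast h2
  have h4 := Int.floor_le (β / (2 * Real.pi))
  have h5 := Int.le_ceil (α / (2 * Real.pi))
  have h6 : α / (2 * Real.pi) ≤ β / (2 * Real.pi) := by gcongr
  rw [sub_div]
  refine h3.trans (max_le ?_ ?_) <;> linarith

section
variable {R : ℝ} {E k : ZMod 3 → ℂ → ℂ}

def Good (E : ZMod 3 → ℂ → ℂ) (C r : ℝ) : Prop := ∀ z : ℂ, ‖z‖ = r → ∀ j, AnalyticAt ℂ (E j) z ∧ E j z ≠ 0 ∧ ‖E j z‖ ≤ C ∧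
      ‖z * (deriv (E j) z / E j z)‖ ≤ C

def AA (k : ZMod 3 → ℂ → ℂ) (x : ℝ) : ℝ := (k 0 (Real.log x : ℝ)).im
def BBB (E : ZMod 3 → ℂ → ℂ) (x : ℝ) : ℝ := (deriv (E 0) x / E 0 x).im

lemma log_mem (hR : 1 ≤ R) {x : ℝ} (hx : R < x) : ((Real.log x : ℝ) : ℂ) ∈ TT (Real.log R) := by
  simpa using TT_mem_of (ρ := Real.log R) (x := Real.log x) (y := 0) (Real.log_lt_log (by linarith) hx) (by simp; positivity)

lemma om_log (hR : 1 ≤ R) {x : ℝ} (hx : R < x) : om 0 * Complex.exp ((Real.log x : ℝ) : ℂ) = x := by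
  rw [om_zero, one_mul, ← Complex.ofReal_exp, Real.exp_log (by linarith)]

lemma Conf.A_deriv (h : Conf R E) (hk : Sys (Real.log R) k)
    (hke : ∀ j, ∀ s ∈ TT (Real.log R), Complex.exp (k j s) = E j (om j * Complex.exp s)) {x : ℝ} (hx : R < x) :
    HasDerivAt (AA k) (BBB E x) x := by
  have hm := log_mem h.pos hx
  have hR := h.pos
  have hx0 : 0 < x := by linarith
  have h1 : HasDerivAt (k 0) (deriv (k 0) (Real.log x : ℝ)) (Real.log x : ℝ) := ((hk.kf 0).anal hm).differentiableAt.hasDerivAt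
  have h2 : HasDerivAt (fun y : ℝ => k 0 (y : ℂ)) (deriv (k 0) (Real.log x : ℝ)) (Real.log x) := h1.comp_ofReal
  have h3 := HasDerivAt.scomp (g₁ := fun y : ℝ => k 0 (y : ℂ)) (h := Real.log) x h2 (Real.hasDerivAt_log hx0.ne')
  have h4 := (Complex.imCLM.hasFDerivAt).comp_hasDerivAt x h3
  refine h4.congr_deriv ?_
  have h5 := h.k_deriv hk hke (j := 0) hm
  rw [om_log hR hx] at h5
  rw [← h5]
  have : (x : ℂ) ≠ 0 := by exact_mod_cast hx0.ne'
  simp only [Complex.imCLM_apply, Complex.real_smul]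
  unfold BBB
  congr 1
  push_cast
  field_simp

def T0 (h : Conf R E) (r : ℝ) : Finset ℂ := (h.ordI_fin 0 r).toFinset
def T1 (h : Conf R E) (r : ℝ) : Finset ℂ := (h.ordI_fin 1 r).toFinset
def Wsum (h : Conf R E) : ℝ := ∑ u ∈ T0 h R, |(ordI (E 0) u : ℝ)|
def FF (h : Conf R E) (r : ℝ) : Finset ℂ := T0 h r \ T0 h R

lemma mem_T0 (h : Conf R E) {r : ℝ} {u : ℂ} : u ∈ T0 h r ↔ ordI (E 0) u ≠ 0 ∧ ‖u‖ ≤ r := by simp [T0]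
lemma mem_T1 (h : Conf R E) {r : ℝ} {u : ℂ} : u ∈ T1 h r ↔ ordI (E 1) u ≠ 0 ∧ ‖u‖ ≤ r := by simp [T1]
lemma mem_FF (h : Conf R E) {r : ℝ} {u : ℂ} : u ∈ FF h r ↔ ordI (E 0) u ≠ 0 ∧ ‖u‖ ≤ r ∧ R < ‖u‖ := by
  simp only [FF, Finset.mem_sdiff, mem_T0]
  constructor
  · rintro ⟨⟨h1, h2⟩, h3⟩
    refine ⟨h1, h2, ?_⟩
    by_contra h4
    exact h3 ⟨h1, not_lt.1 h4⟩
  · rintro ⟨h1, h2, h3⟩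
    exact ⟨⟨h1, h2⟩, fun h4 => absurd h4.2 (not_le.2 h3)⟩

lemma Wsum_nonneg (h : Conf R E) : 0 ≤ Wsum h := Finset.sum_nonneg fun _ _ => abs_nonneg _

lemma Good.nonneg {C r : ℝ} (hg : Good E C r) (hr : 0 < r) : 0 ≤ C :=
  (norm_nonneg _).trans (hg r (by simp [hr.le]) 0).2.2.1

lemma Good.lt {C r : ℝ} (h : Conf R E) (hg : Good E C r) {j : ZMod 3} {u : ℂ} (h1 : ordI (E j) u ≠ 0) (h2 : ‖u‖ ≤ r) : ‖u‖ < r := by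
  refine lt_of_le_of_ne h2 fun he => h1 (h.ordI_of_ne (hg u he j).2.1)

lemma Conf.ordI_real (h : Conf R E) {x : ℝ} (hx : R < x) : ordI (E 0) x = 0 := by
  have := h.nz 0 (log_mem h.pos hx)
  rw [om_log h.pos hx] at this
  exact h.ordI_of_ne this

lemma Conf.B_bound (h : Conf R E) {C r x : ℝ} (hg : Good E C r) (hx : 2 * R ≤ x) (hxr : x ≤ r / 2) :
    |BBB E x - ∑ u ∈ FF h r, |(ordI (E 0) u : ℝ)| * phi ‖u‖ x| ≤ 2 * C / r + Wsum h * (4 * R / x ^ 2) := by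
  have hR := h.pos
  have hr : 0 < r := by linarith
  have h1 := (ld (h.nf 0) (h.ord_ne 0) hr (T0 h r) (fun u hu => Good.lt h hg ((mem_T0 h).1 hu).1 ((mem_T0 h).1 hu).2)
    (fun z hz hz2 => by
      by_contra hc
      exact hz2 ((mem_T0 h).2 ⟨hc, hz⟩)) (fun z hz => (hg z hz 0).2.2.2)).2 x (by
        rw [Complex.norm_real, Real.norm_of_nonneg (by linarith)]; exact hxr) (fun hm => ((mem_T0 h).1 hm).1 (h.ordI_real (by linarith)))
  have h2 := (Complex.abs_im_le_norm _).trans h1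
  rw [Complex.sub_im, Complex.im_sum] at h2
  have hsub : T0 h R ⊆ T0 h r := by
    intro u hu
    rw [mem_T0] at hu ⊢
    exact ⟨hu.1, by linarith [hu.2]⟩
  rw [← Finset.sum_sdiff hsub] at h2
  change |BBB E x - (∑ u ∈ FF h r, _ + _)| ≤ _ at h2
  rw [Finset.sum_congr rfl (fun u hu => h.term_far ((mem_FF h).1 hu).2.2 x)] at h2
  have h3 : |∑ u ∈ T0 h R, ((ordI (E 0) u : ℂ) / (x - u)).im| ≤ Wsum h * (4 * R / x ^ 2) := by
    unfold Wsum
    rw [Finset.sum_mul]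
    refine (Finset.abs_sum_le_sum_abs _ _).trans (Finset.sum_le_sum fun u hu => ?_)
    exact term_near ((mem_T0 h).1 hu).2 (by linarith) hx
  rw [abs_le] at *
  constructor <;> linarith

lemma Conf.B_pos (h : Conf R E) {C : ℝ} (hg : ∃ᶠ r in atTop, Good E C r) (hinf : {u | ordI (E 0) u ≠ 0}.Infinite) :
    ∃ T, 2 * R ≤ T ∧ ∀ x, T ≤ x → 0 < BBB E x := by
  have hR := h.pos
  have hW := Wsum_nonneg h
  have hinf2 : {u | ordI (E 0) u ≠ 0 ∧ R < ‖u‖}.Infinite := by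
    refine (hinf.sdiff (h.ordI_fin 0 R)).mono fun u hu => ?_
    refine ⟨hu.1, ?_⟩
    by_contra hc
    exact hu.2 ⟨hu.1, not_lt.1 hc⟩
  obtain ⟨n, hn⟩ := exists_nat_gt (24 * Wsum h)
  obtain ⟨F, hF, hFc⟩ := hinf2.exists_subset_card_eq n
  refine ⟨max (2 * R) (∑ u ∈ F, ‖u‖), le_max_left _ _, fun x hx => ?_⟩
  have hx1 : 2 * R ≤ x := (le_max_left _ _).trans hx
  have hx2 : ∀ u ∈ F, ‖u‖ ≤ x := fun u hu =>
    (Finset.single_le_sum (f := fun u : ℂ => ‖u‖) (fun u _ => norm_nonneg u) hu).trans ((le_max_right _ _).trans hx)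
  have hx0 : 0 < x := by linarith
  have hL : n * (R / (6 * x ^ 2)) ≤ ∑ u ∈ F, phi ‖u‖ x := by
    rw [← hFc, ← nsmul_eq_mul]
    exact Finset.card_nsmul_le_sum _ _ _ fun u hu => phi_lower (by linarith) (hF hu).2 (hx2 u hu)
  have hε : 0 < n * (R / (6 * x ^ 2)) - Wsum h * (4 * R / x ^ 2) := by
    have : n * (R / (6 * x ^ 2)) - Wsum h * (4 * R / x ^ 2) = (n - 24 * Wsum h) * (R / (6 * x ^ 2)) := by field_simp; ring
    rw [this]
    exact mul_pos (by linarith) (by positivity)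
  have ht : Tendsto (fun r : ℝ => 2 * C / r) atTop (𝓝 0) := tendsto_const_nhds.div_atTop tendsto_id
  obtain ⟨r, hr, hr1, hr2⟩ := (hg.and_eventually ((ht.eventually (gt_mem_nhds hε)).and (eventually_ge_atTop (2 * x)))).exists
  have hb := (abs_le.1 (h.B_bound hr hx1 (by linarith))).1
  have hs : ∑ u ∈ F, phi ‖u‖ x ≤ ∑ u ∈ FF h r, |(ordI (E 0) u : ℝ)| * phi ‖u‖ x := by
    have hsub : F ⊆ FF h r := by
      intro u hu
      rw [mem_FF]
      exact ⟨(hF hu).1, by linarith [hx2 u hu], (hF hu).2⟩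
    have hp : ∀ u ∈ FF h r, 0 ≤ phi ‖u‖ x := fun u hu => phi_nonneg (by linarith [((mem_FF h).1 hu).2.2]) hx0
    refine (Finset.sum_le_sum fun u hu => ?_).trans (Finset.sum_le_sum_of_subset_of_nonneg hsub fun u hu _ =>
      mul_nonneg (abs_nonneg _) (hp u hu))
    have h1 : (1 : ℝ) ≤ |(ordI (E 0) u : ℝ)| := by
      exact_mod_cast Int.one_le_abs (hF hu).1
    nlinarith [hp u (hsub hu)]
  linarith

lemma Conf.A_upper (h : Conf R E) (hk : Sys (Real.log R) k)
    (hke : ∀ j, ∀ s ∈ TT (Real.log R), Complex.exp (k j s) = E j (om j * Complex.exp s)) {C r T : ℝ} (hg : Good E C r)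
    (hT : 2 * R ≤ T) (hTr : T ≤ r / 2) :
    AA k (r / 2) - AA k T ≤ (Real.pi / 2) * ∑ u ∈ FF h r, |(ordI (E 0) u : ℝ)| + 4 * R * Wsum h / T + C := by
  have hR := h.pos
  have hW := Wsum_nonneg h
  have hr : 0 < r := by linarith
  have hC := hg.nonneg hr
  have hT0 : 0 < T := by linarith
  set c : ℝ → ℝ → ℝ := fun a t => Real.arctan ((t + a / 2) / (a * (Real.sqrt 3 / 2))) with hc
  set G : ℝ → ℝ := fun t => ∑ u ∈ FF h r, |(ordI (E 0) u : ℝ)| * c ‖u‖ t - 4 * R * Wsum h * t⁻¹ + 2 * C / r * t - AA k t with hG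
  have hd : ∀ t ∈ Icc T (r / 2), HasDerivAt G (∑ u ∈ FF h r, |(ordI (E 0) u : ℝ)| * phi ‖u‖ t - 4 * R * Wsum h * (-(t ^ 2)⁻¹) + 2 * C / r * 1 - BBB E t) t := by
    intro t ht
    have ht0 : 0 < t := by linarith [ht.1]
    have h1 : HasDerivAt (fun t => ∑ u ∈ FF h r, |(ordI (E 0) u : ℝ)| * c ‖u‖ t) (∑ u ∈ FF h r, |(ordI (E 0) u : ℝ)| * phi ‖u‖ t) t :=
      HasDerivAt.fun_sum fun u hu => (phi_deriv (by linarith [((mem_FF h).1 hu).2.2]) ht0).const_mul _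
    exact ((h1.sub ((hasDerivAt_inv ht0.ne').const_mul _)).add ((hasDerivAt_id t).const_mul _)).sub (h.A_deriv hk hke (by linarith [ht.1]))
  have hmono : MonotoneOn G (Icc T (r / 2)) := by
    refine monotoneOn_of_deriv_nonneg (convex_Icc _ _) (fun t ht => (hd t ht).continuousAt.continuousWithinAt)
      (fun t ht => (hd t (interior_subset ht)).differentiableAt.differentiableWithinAt) (fun t ht => ?_)
    have ht := interior_subset ht
    rw [(hd t ht).deriv]
    have hb := (abs_le.1 (h.B_bound hg (show 2 * R ≤ t by linarith [ht.1]) ht.2)).2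
    have e : Wsum h * (4 * R / t ^ 2) = 4 * R * Wsum h * (t ^ 2)⁻¹ := by ring
    rw [e] at hb
    linarith
  have h1 := hmono (left_mem_Icc.2 hTr) (right_mem_Icc.2 hTr) hTr
  simp only [hG] at h1
  have h2 : ∑ u ∈ FF h r, |(ordI (E 0) u : ℝ)| * c ‖u‖ (r/2) - ∑ u ∈ FF h r, |(ordI (E 0) u : ℝ)| * c ‖u‖ T ≤ (Real.pi / 2) * ∑ u ∈ FF h r, |(ordI (E 0) u : ℝ)| := by
    rw [← Finset.sum_sub_distrib, Finset.mul_sum]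
    refine Finset.sum_le_sum fun u hu => ?_
    have h3 : c ‖u‖ (r/2) ≤ Real.pi / 2 := (Real.arctan_lt_pi_div_two _).le
    have h4 : 0 ≤ c ‖u‖ T := by
      simp only [hc]
      rw [Real.arctan_nonneg]
      positivity
    nlinarith [abs_nonneg (ordI (E 0) u : ℝ)]
  have h3 : 2 * C / r * (r / 2) = C := by field_simp
  have h4 : 0 ≤ 4 * R * Wsum h * (r/2)⁻¹ := by positivity
  have h5 : 0 ≤ 2 * C / r * T := by positivity
  rw [div_eq_mul_inv (4 * R * Wsum h) T]
  linarith
end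

end

section

section
variable {R : ℝ} {E k : ZMod 3 → ℂ → ℂ}

lemma Conf.count_poles (h : Conf R E) (hk : Sys (Real.log R) k)
    (hke : ∀ j, ∀ s ∈ TT (Real.log R), Complex.exp (k j s) = E j (om j * Complex.exp s)) {C r T : ℝ} (hg : Good E C r)
    (hkr : ‖k 0 (Real.log r : ℝ) - k 0 (Real.log (r / 2) : ℝ)‖ ≤ C)
    (hT : 2 * R ≤ T) (hTr : T ≤ r / 2) (hB : ∀ x, T ≤ x → 0 < BBB E x) :
    ∑ u ∈ T0 h r ∪ T1 h r, max (-(ordI (E 0) u : ℝ)) 0 ≤ 2 * (C + (∑ u ∈ T1 h T, |(ordI (E 1) u : ℝ)|) + 1 + C / 4 +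
      (4 * R * Wsum h / T + 2 * C) / (2 * Real.pi)) := by
  classical
  have hR := h.pos
  have hr : 0 < r := by linarith
  have hmono : StrictMonoOn (AA k) (Ici T) := by
    have hd : ∀ x ∈ Ici T, HasDerivAt (AA k) (BBB E x) x := fun x hx => h.A_deriv hk hke (by linarith [mem_Ici.1 hx])
    refine strictMonoOn_of_deriv_pos (convex_Ici T) (fun x hx => (hd x hx).continuousAt.continuousWithinAt) fun x hx => ?_
    have hx := interior_subset hx
    rw [(hd x hx).deriv]
    exact hB x hx
  set S := T0 h r ∪ T1 h r with hS
  have hSlt : ∀ u ∈ S, ‖u‖ < r := by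
    intro u hu
    rw [hS, Finset.mem_union, mem_T0, mem_T1] at hu
    rcases hu with hu | hu
    · exact Good.lt h hg hu.1 hu.2
    · exact Good.lt h hg hu.1 hu.2
  have l0 := (ld (h.nf 0) (h.ord_ne 0) hr S hSlt (fun z hz hz2 => by
    by_contra hc
    exact hz2 (Finset.mem_union_left _ ((mem_T0 h).2 ⟨hc, hz⟩))) (fun z hz => (hg z hz 0).2.2.2)).1
  have l1 := (ld (h.nf 1) (h.ord_ne 1) hr S hSlt (fun z hz hz2 => by
    by_contra hc
    exact hz2 (Finset.mem_union_right _ ((mem_T1 h).2 ⟨hc, hz⟩))) (fun z hz => (hg z hz 1).2.2.2)).1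
  set P0 := ∑ u ∈ S, max (-(ordI (E 0) u : ℝ)) 0 with hP0
  set M1 := ∑ u ∈ T1 h T, |(ordI (E 1) u : ℝ)| with hM1
  have e1 : ∑ u ∈ S, max (ordI (E 1) u : ℝ) 0 = P0 := by
    refine Finset.sum_congr rfl fun u _ => ?_
    have := h.ordI_pos_part 0 u
    rw [zero_add] at this
    exact_mod_cast this
  have e2 : ∑ u ∈ S, (ordI (E 1) u : ℝ) = P0 - ∑ u ∈ S, max (-(ordI (E 1) u : ℝ)) 0 := by
    rw [← e1, ← Finset.sum_sub_distrib]
    refine Finset.sum_congr rfl fun u _ => ?_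
    rcases le_total (ordI (E 1) u : ℝ) 0 with hh | hh
    · rw [max_eq_right hh, max_eq_left (by linarith)]; ring
    · rw [max_eq_left hh, max_eq_right (by linarith)]; ring
  set Q := S.filter (fun u => ordI (E 1) u < 0 ∧ T < ‖u‖) with hQ
  have hQm : ∀ u ∈ Q, T < ‖u‖ ∧ ‖u‖ < r ∧ u = (‖u‖ : ℝ) ∧ E 0 u = 1 ∧ ordI (E 1) u < 0 := by
    intro u hu
    rw [hQ, Finset.mem_filter] at hu
    obtain ⟨hu1, hu2, hu3⟩ := hu
    have hn := h.ordI_neg.1 hu2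
    have hp := h.pole_one hn
    have e3 : (1 : ZMod 3) + 1 + 1 = 0 := rfl
    rw [e3] at hp
    obtain ⟨t, ht, he⟩ := h.one _ _ (by linarith) hp.1 hp.2
    rw [om_zero, mul_one] at he
    refine ⟨hu3, hSlt u hu1, ?_, hp.2, hu2⟩
    rw [he]; simp [abs_of_pos ht]
  have e3 : ∑ u ∈ S, max (-(ordI (E 1) u : ℝ)) 0 ≤ M1 + Q.card := by
    have h1 : ∀ u ∈ S, max (-(ordI (E 1) u : ℝ)) 0 ≤ (if u ∈ T1 h T then |(ordI (E 1) u : ℝ)| else 0) + (if u ∈ Q then 1 else 0) := by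
      intro u hu
      have i1 : (0 : ℝ) ≤ (if u ∈ T1 h T then |(ordI (E 1) u : ℝ)| else 0) := by split_ifs <;> positivity
      have i2 : (0 : ℝ) ≤ (if u ∈ Q then 1 else 0) := by split_ifs <;> norm_num
      by_cases hneg : ordI (E 1) u < 0
      · rw [max_eq_left (by have : (ordI (E 1) u : ℝ) < 0 := by exact_mod_cast hneg
                            linarith)]
        by_cases hn : ‖u‖ ≤ T
        · rw [if_pos ((mem_T1 h).2 ⟨hneg.ne, hn⟩)]
          linarith [neg_le_abs (ordI (E 1) u : ℝ)]
        · have hq : u ∈ Q := by rw [hQ, Finset.mem_filter]; exact ⟨hu, hneg, not_le.1 hn⟩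
          rw [if_pos hq]
          obtain ⟨q1, q2, q3, q4, q5⟩ := hQm u hq
          have hb := hB ‖u‖ q1.le
          have hd : deriv (E 0) u ≠ 0 := by
            intro hd
            unfold BBB at hb
            rw [← q3, hd] at hb
            simp at hb
          have ha : AnalyticAt ℂ (E 0) u := by
            have := h.anal 0 (log_mem h.pos (show R < ‖u‖ by linarith))
            rwa [om_log h.pos (show R < ‖u‖ by linarith), ← q3] at this
          have := h.ordI_ge ha hd
          rw [zero_add] at this
          have : (-1 : ℝ) ≤ ordI (E 1) u := by exact_mod_cast this
          linarith
      · rw [max_eq_right (by have : (0 : ℝ) ≤ (ordI (E 1) u : ℝ) := by exact_mod_cast (not_lt.1 hneg)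
                             linarith)]
        linarith
    refine (Finset.sum_le_sum h1).trans ?_
    rw [Finset.sum_add_distrib]
    refine add_le_add ?_ ?_
    · rw [← Finset.sum_filter, hM1]
      refine Finset.sum_le_sum_of_subset_of_nonneg (fun u hu => (Finset.mem_filter.1 hu).2) fun _ _ _ => abs_nonneg _
    · rw [← Finset.sum_filter, Finset.sum_const, nsmul_eq_mul, mul_one]
      exact_mod_cast Finset.card_le_card fun u hu => (Finset.mem_filter.1 hu).2
  have hAr : AA k T ≤ AA k r := hmono.monotoneOn (mem_Ici.2 le_rfl) (mem_Ici.2 (by linarith)) (by linarith)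
  have e4 : (Q.card : ℝ) ≤ (AA k r - AA k T) / (2 * Real.pi) + 1 := by
    refine count_le (A := fun u => AA k ‖u‖) hAr ?_ ?_
    · intro u hu v hv huv
      obtain ⟨q1, q2, q3, -⟩ := hQm u hu
      obtain ⟨q1', q2', q3', -⟩ := hQm v hv
      have := hmono.injOn (mem_Ici.2 q1.le) (mem_Ici.2 q1'.le) huv
      rw [q3, q3', this]
    · intro u hu
      obtain ⟨q1, q2, q3, q4, -⟩ := hQm u hu
      refine ⟨?_, hmono.monotoneOn (mem_Ici.2 le_rfl) (mem_Ici.2 q1.le) q1.le, hmono.monotoneOn (mem_Ici.2 q1.le) (mem_Ici.2 (by linarith)) q2.le⟩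
      have hx : R < ‖u‖ := by linarith
      have h1 := hke 0 _ (log_mem h.pos hx)
      rw [om_log h.pos hx, ← q3, q4, Complex.exp_eq_one_iff] at h1
      obtain ⟨n, hn⟩ := h1
      refine ⟨n, ?_⟩
      show (k 0 _).im = _
      rw [hn]; simp
  have e5 := h.A_upper hk hke hg hT hTr
  have e6 : AA k r - AA k (r / 2) ≤ C := by
    refine le_trans ?_ hkr
    refine le_trans (le_abs_self _) ?_
    have := Complex.abs_im_le_norm (k 0 (Real.log r : ℝ) - k 0 (Real.log (r / 2) : ℝ))
    rwa [Complex.sub_im] at this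
  have e7 : ∑ u ∈ FF h r, |(ordI (E 0) u : ℝ)| ≤ C + 2 * P0 := by
    have h1 : ∑ u ∈ FF h r, |(ordI (E 0) u : ℝ)| ≤ ∑ u ∈ S, |(ordI (E 0) u : ℝ)| :=
      Finset.sum_le_sum_of_subset_of_nonneg (fun u hu => Finset.mem_union_left _ (Finset.sdiff_subset hu)) fun _ _ _ => abs_nonneg _
    have h2 : ∑ u ∈ S, |(ordI (E 0) u : ℝ)| = ∑ u ∈ S, (ordI (E 0) u : ℝ) + 2 * P0 := by
      rw [hP0, Finset.mul_sum, ← Finset.sum_add_distrib]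
      refine Finset.sum_congr rfl fun u _ => ?_
      rcases le_total (ordI (E 0) u : ℝ) 0 with hh | hh
      · rw [abs_of_nonpos hh, max_eq_left (by linarith)]; ring
      · rw [abs_of_nonneg hh, max_eq_right (by linarith)]; ring
    linarith [(abs_le.1 l0).2]
  have hp := Real.pi_pos
  have e8 : (AA k r - AA k T) / (2 * Real.pi) ≤ (C + 2 * P0) / 4 + (4 * R * Wsum h / T + 2 * C) / (2 * Real.pi) := by
    have e9 : AA k r - AA k T ≤ (Real.pi / 2) * (C + 2 * P0) + (4 * R * Wsum h / T + 2 * C) := by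
      have := mul_le_mul_of_nonneg_left e7 (show 0 ≤ Real.pi / 2 by positivity)
      linarith
    calc _ ≤ ((Real.pi / 2) * (C + 2 * P0) + (4 * R * Wsum h / T + 2 * C)) / (2 * Real.pi) := by gcongr
      _ = _ := by field_simp; ring
  rw [e2] at l1
  have := (abs_le.1 l1).2
  linarith

theorem Conf.reg_rat (h : Conf R E) (hk : Sys (Real.log R) k)
    (hke : ∀ j, ∀ s ∈ TT (Real.log R), Complex.exp (k j s) = E j (om j * Complex.exp s))
    {u : Ultrafilter ℝ} (hu : (u : Filter ℝ) ≤ atTop) (hreg : ∀ j, HK u (k j) 3) : RatF (E 0) := by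
  obtain ⟨C, hC⟩ := h.circ hk hke hu hreg
  have hgood : ∃ᶠ r in atTop, Good E C r := hC.mono fun r hr => hr.1
  by_cases hfin : {u | ordI (E 0) u < 0}.Finite
  · obtain ⟨R', hR'⟩ := (hfin.image (fun u => ‖u‖)).bddAbove
    refine rat_of_bound (R := R') (C := C) (N := 0) (h.nf 0) (fun z hz => ?_) (hgood.mono fun r hr z hz => ?_)
    · by_contra hn
      have := hR' ⟨z, h.ordI_neg.2 hn, rfl⟩
      exact absurd hz (not_lt.2 this)
    · simpa using (hr z hz 0).2.2.1
  · exfalso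
    obtain ⟨T, hT, hB⟩ := h.B_pos hgood (Set.Infinite.mono (fun u hu => ne_of_lt hu) hfin)
    set M := 2 * (C + (∑ u ∈ T1 h T, |(ordI (E 1) u : ℝ)|) + 1 + C / 4 + (4 * R * Wsum h / T + 2 * C) / (2 * Real.pi)) with hM
    obtain ⟨n, hn⟩ := exists_nat_gt M
    obtain ⟨F, hF, hFc⟩ := Set.Infinite.exists_subset_card_eq hfin n
    obtain ⟨r, hr, hr1, hr2⟩ := (hC.and_eventually ((eventually_ge_atTop (2 * T)).and (eventually_ge_atTop (∑ u ∈ F, ‖u‖)))).exists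
    have h1 := h.count_poles hk hke hr.1 hr.2 hT (by linarith) hB
    rw [← hM] at h1
    have h2 : (n : ℝ) ≤ ∑ u ∈ T0 h r ∪ T1 h r, max (-(ordI (E 0) u : ℝ)) 0 := by
      have hsub : F ⊆ T0 h r ∪ T1 h r := by
        intro v hv
        refine Finset.mem_union_left _ ((mem_T0 h).2 ⟨ne_of_lt (hF hv), ?_⟩)
        exact (Finset.single_le_sum (f := fun u : ℂ => ‖u‖) (fun u _ => norm_nonneg u) hv).trans hr2
      refine le_trans ?_ (Finset.sum_le_sum_of_subset_of_nonneg hsub fun _ _ _ => le_max_right _ _)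
      rw [← hFc]
      have := Finset.card_nsmul_le_sum F (fun u => max (-(ordI (E 0) u : ℝ)) 0) 1 (fun v hv => ?_)
      · simpa using this
      · refine le_trans ?_ (le_max_left _ _)
        have : ordI (E 0) v ≤ -1 := by
          have : ordI (E 0) v < 0 := hF hv
          omega
        have : (ordI (E 0) v : ℝ) ≤ -1 := by exact_mod_cast this
        linarith
    linarith

theorem Conf.main (h : Conf R E) (hk : Sys (Real.log R) k)
    (hke : ∀ j, ∀ s ∈ TT (Real.log R), Complex.exp (k j s) = E j (om j * Complex.exp s)) (hnr : ∀ j, ¬ RatF (E j)) : Osc k := by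
  have h1 := hk.noreg (fun u hu hreg => hnr 0 (h.reg_rat hk hke hu hreg))
  rcases h1 with h1 | ⟨j, hj⟩
  · exact h1
  · exact absurd (h.one_st hke hj) (hnr j)
end

end

section

lemma MeromOn.merom {f : ℂ → ℂ} {P : Set ℂ} (hf : MeromOn f P univ) (z : ℂ) : MeromorphicAt f z := by
  obtain ⟨-, h1, h2, h3⟩ := hf
  have hd : ∀ᶠ w in 𝓝[≠] z, w ∉ P := by
    have := h3 z (mem_univ z)
    rw [accPt_iff_frequently_nhdsNE] at this
    simpa using this
  by_cases hz : z ∈ P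
  · have ht := h2 z hz
    have hg : ContinuousAt (Function.update f⁻¹ z 0) z := by
      rw [continuousAt_update_same]
      have := tendsto_inv₀_cobounded.comp (tendsto_norm_atTop_iff_cobounded.1 ht)
      exact this
    have hn : ∀ᶠ w in 𝓝[≠] z, f w ≠ 0 := by
      filter_upwards [ht.eventually_gt_atTop 0] with w hw
      exact norm_pos_iff.1 hw
    have ha : AnalyticAt ℂ (Function.update f⁻¹ z 0) z := by
      apply Complex.analyticAt_of_differentiable_on_punctured_nhds_of_continuousAt _ hg
      filter_upwards [hd, hn, self_mem_nhdsWithin] with w hw1 hw2 hw3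
      have : AnalyticAt ℂ f⁻¹ w := (h1 w ⟨mem_univ w, hw1⟩).inv hw2
      refine this.differentiableAt.congr_of_eventuallyEq ?_
      filter_upwards [isOpen_ne.mem_nhds hw3] with v hv
      exact Function.update_of_ne hv _ _
    have hm := ha.meromorphicAt.inv
    refine hm.congr ?_
    filter_upwards [self_mem_nhdsWithin] with w hw
    simp [Function.update_of_ne hw]
  · exact (h1 z ⟨mem_univ z, hz⟩).meromorphicAt

lemma MeromOn.disc {f : ℂ → ℂ} {P : Set ℂ} (hf : MeromOn f P univ) (z : ℂ) : ∀ᶠ w in 𝓝[≠] z, w ∉ P := by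
  have := hf.2.2.2 z (mem_univ z)
  rw [accPt_iff_frequently_nhdsNE] at this
  simpa using this

lemma MeromOn.anal {f : ℂ → ℂ} {P : Set ℂ} (hf : MeromOn f P univ) {z : ℂ} (hz : z ∉ P) : AnalyticAt ℂ f z :=
  hf.2.1 z ⟨mem_univ z, hz⟩

lemma MeromOn.nonconst {f : ℂ → ℂ} {P : Set ℂ} (hf : MeromOn f P univ) (ht : ¬ IsRationalFn f P) (c z : ℂ) :
    ∀ᶠ w in 𝓝[≠] z, f w ≠ c := by
  have hm : MeromorphicOn (fun w => f w - c) univ := fun z _ => (hf.merom z).sub (MeromorphicAt.const c z)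
  by_cases htop : meromorphicOrderAt (fun w => f w - c) z = ⊤
  · exfalso
    apply ht
    refine ⟨Polynomial.C c, 1, one_ne_zero, fun y hy _ => ?_⟩
    have hy2 : meromorphicOrderAt (fun w => f w - c) y = ⊤ := by
      by_contra hne
      exact hm.meromorphicOrderAt_ne_top_of_isPreconnected isPreconnected_univ (mem_univ y) (mem_univ z) hne htop
    rw [meromorphicOrderAt_eq_top_iff] at hy2
    have := eq_of_punct (g := fun w => f w - c) (h := fun _ => 0) ((hf.anal hy).continuousAt.sub continuousAt_const) continuousAt_const hy2
    simpa [sub_eq_zero] using this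
  · filter_upwards [(meromorphicOrderAt_ne_top_iff_eventually_ne_zero (hm z (mem_univ z))).1 htop] with w hw
    exact sub_ne_zero.1 hw

lemma mob_schw {α β γ δ s : ℂ} (hΔ : α * δ - β * γ ≠ 0) (hs : γ * s + δ ≠ 0) :
    AnalyticAt ℂ (fun w => (α * w + β) / (γ * w + δ)) s ∧ deriv (fun w => (α * w + β) / (γ * w + δ)) s ≠ 0 ∧
    Schwarzian (fun w => (α * w + β) / (γ * w + δ)) s = 0 := by
  have hev : ∀ᶠ w in 𝓝 s, γ * w + δ ≠ 0 := by
    have : ContinuousAt (fun w => γ * w + δ) s := by fun_prop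
    exact this.eventually_ne hs
  have d1 : ∀ w, γ * w + δ ≠ 0 → HasDerivAt (fun w => (α * w + β) / (γ * w + δ)) ((α * δ - β * γ) / (γ * w + δ) ^ 2) w := by
    intro w hw
    have h1 : HasDerivAt (fun w => α * w + β) (α * 1) w := ((hasDerivAt_id w).const_mul α).add_const β
    have h2 : HasDerivAt (fun w => γ * w + δ) (γ * 1) w := ((hasDerivAt_id w).const_mul γ).add_const δ
    refine (h1.div h2 hw).congr_deriv ?_
    congr 1; ring
  have e1 : deriv (fun w => (α * w + β) / (γ * w + δ)) =ᶠ[𝓝 s] fun w => (α * δ - β * γ) / (γ * w + δ) ^ 2 := by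
    filter_upwards [hev] with w hw
    exact (d1 w hw).deriv
  have e2 : deriv (deriv (fun w => (α * w + β) / (γ * w + δ))) =ᶠ[𝓝 s] fun w => -2 * γ * (α * δ - β * γ) / (γ * w + δ) ^ 3 := by
    refine e1.deriv.trans ?_
    filter_upwards [hev] with w hw
    have h2 : HasDerivAt (fun w => (γ * w + δ) ^ 2) (((2 : ℕ) : ℂ) * (γ * w + δ) ^ (2 - 1) * (γ * 1)) w := (((hasDerivAt_id w).const_mul γ).add_const δ).pow 2
    rw [((hasDerivAt_const w (α * δ - β * γ)).fun_div h2 (pow_ne_zero 2 hw)).deriv]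
    simp
    field_simp
  have e3 : (fun w => deriv (deriv (fun w => (α * w + β) / (γ * w + δ))) w / deriv (fun w => (α * w + β) / (γ * w + δ)) w) =ᶠ[𝓝 s]
      fun w => (-2 * γ) / (γ * w + δ) := by
    filter_upwards [e1, e2, hev] with w h1 h2 hw
    rw [h1, h2]
    generalize α * δ - β * γ = D at *
    field_simp
  refine ⟨?_, ?_, ?_⟩
  · exact (by fun_prop : AnalyticAt ℂ (fun w => α * w + β) s).div (by fun_prop) hs
  · rw [e1.self_of_nhds]; exact div_ne_zero hΔ (pow_ne_zero 2 hs)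
  · have hx : deriv (deriv (fun w => (α * w + β) / (γ * w + δ))) s / deriv (fun w => (α * w + β) / (γ * w + δ)) s = (-2 * γ) / (γ * s + δ) := e3.self_of_nhds
    unfold Schwarzian
    rw [e3.deriv_eq, hx]
    have h2 : HasDerivAt (fun w => γ * w + δ) (γ * 1) s := ((hasDerivAt_id s).const_mul γ).add_const δ
    rw [((hasDerivAt_const s (-2 * γ)).fun_div h2 hs).deriv]
    field_simp
    ring

def SimpleP (f : ℂ → ℂ) (z : ℂ) : Prop :=
  ∃ h : ℂ → ℂ, AnalyticAt ℂ h z ∧ h z ≠ 0 ∧ ∀ᶠ w in 𝓝[≠] z, f w = h w / (w - z)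

/-- `f` is a Moebius transform of `G` -/
structure MobRel (f G : ℂ → ℂ) (α β γ δ : ℂ) : Prop where
  det : α * δ - β * γ ≠ 0
  rel : ∀ z, ∀ᶠ w in 𝓝[≠] z, f w * (γ * G w + δ) = α * G w + β

section
variable {f G : ℂ → ℂ} {P : Set ℂ} {α β γ δ : ℂ}

lemma MobRel.rat (h : MobRel f G α β γ δ) (hf : MeromOn f P univ) (hG : MeromorphicOn G univ) (hr : RatF G) : IsRationalFn f P := by
  obtain ⟨p, q, hq, he⟩ := hr
  set p' := Polynomial.C α * p + Polynomial.C β * q with hp'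
  set q' := Polynomial.C γ * p + Polynomial.C δ * q with hq'
  have key : ∀ z, ∀ᶠ w in 𝓝[≠] z, q.eval w ≠ 0 ∧ f w * q'.eval w = p'.eval w := by
    intro z
    have hqn : ∀ᶠ w in 𝓝[≠] z, q.eval w ≠ 0 := by
      have hfin : {w | q.eval w = 0}.Finite := by
        refine (q.roots.toFinset.finite_toSet).subset fun w hw => ?_
        simpa [hq] using hw
      have := (hfin.sdiff (t := {z})).isClosed.isOpen_compl.mem_nhds (x := z) (by simp)
      filter_upwards [mem_nhdsWithin_of_mem_nhds this, self_mem_nhdsWithin] with w hw hw2 hw3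
      exact hw ⟨hw3, hw2⟩
    filter_upwards [h.rel z, nf_an_eventually hG z, hqn] with w h1 h2 h3
    refine ⟨h3, ?_⟩
    have := he w h2 h3
    rw [this] at h1
    simp only [hp', hq', Polynomial.eval_add, Polynomial.eval_mul, Polynomial.eval_C]
    field_simp at h1
    linear_combination h1
  refine ⟨p', q', ?_, fun z hz hz2 => ?_⟩
  · intro h0
    obtain ⟨w, hw1, hw2⟩ := (key 0).exists
    rw [h0, Polynomial.eval_zero, mul_zero] at hw2
    have h0' : q'.eval w = 0 := by rw [h0, Polynomial.eval_zero]
    simp only [hp', hq', Polynomial.eval_add, Polynomial.eval_mul, Polynomial.eval_C] at hw2 h0'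
    have : (α * δ - β * γ) * q.eval w = 0 := by linear_combination α * h0' + γ * hw2
    exact (mul_ne_zero h.det hw1) this
  · have := eq_of_punct (g := fun w => f w * q'.eval w) (h := fun w => p'.eval w) ((hf.anal hz).continuousAt.mul q'.continuous.continuousAt)
      p'.continuous.continuousAt ((key z).mono fun w hw => hw.2)
    field_simp
    exact this

lemma MobRel.crit (h : MobRel f G α β γ δ) (hf : MeromOn f P univ) {z : ℂ} (hz : z ∉ P) (hG : AnalyticAt ℂ G z) (hd : deriv G z ≠ 0) :
    deriv f z ≠ 0 := by
  have hfa := hf.anal hz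
  have h1 : (fun w => f w * (γ * G w + δ)) =ᶠ[𝓝 z] fun w => α * G w + β :=
    (AnalyticAt.frequently_eq_iff_eventually_eq (by fun_prop) (by fun_prop)).1 (h.rel z).frequently
  have h2 := h1.deriv_eq
  have h3 := h1.self_of_nhds
  have hGd := hG.differentiableAt.hasDerivAt
  have d1 := hfa.differentiableAt.hasDerivAt.fun_mul ((hGd.const_mul γ).add_const δ)
  have d2 := (hGd.const_mul α).add_const β
  rw [d1.deriv, d2.deriv] at h2
  intro h0
  rw [h0] at h2
  have h4 : f z * γ = α := by
    apply mul_right_cancel₀ hd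
    linear_combination h2
  simp only at h3
  exact h.det (by rw [← h4] at h3 ⊢; linear_combination γ * h3)

lemma MobRel.simple (h : MobRel f G α β γ δ) (hf : MeromOn f P univ) {z : ℂ} (hz : z ∈ P) (hG : AnalyticAt ℂ G z) (hd : deriv G z ≠ 0) :
    SimpleP f z := by
  have hpole := hf.2.2.1 z hz
  have hden : AnalyticAt ℂ (fun w => γ * G w + δ) z := by fun_prop
  have hnum : AnalyticAt ℂ (fun w => α * G w + β) z := by fun_prop
  have h0 : γ * G z + δ = 0 := by
    by_contra hne
    have h1 : Tendsto (fun w => (α * G w + β) / (γ * G w + δ)) (𝓝[≠] z) (𝓝 ((α * G z + β) / (γ * G z + δ))) :=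
      ((hnum.div hden hne).continuousAt.tendsto).mono_left nhdsWithin_le_nhds
    have h2 : Tendsto f (𝓝[≠] z) (𝓝 ((α * G z + β) / (γ * G z + δ))) := by
      refine h1.congr' ?_
      filter_upwards [h.rel z, mem_nhdsWithin_of_mem_nhds (hden.continuousAt.eventually_ne hne)] with w hw1 hw2
      rw [← hw1, mul_div_cancel_right₀ _ hw2]
    exact not_tendsto_nhds_of_tendsto_atTop hpole _ h2.norm
  have hn0 : α * G z + β ≠ 0 := by
    intro hn
    exact h.det (by linear_combination α * h0 - γ * hn)
  have hγ : γ ≠ 0 := by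
    intro hγ
    rw [hγ] at h0
    exact h.det (by rw [hγ]; linear_combination α * h0)
  obtain ⟨g, hg, hgz⟩ : ∃ g : ℂ → ℂ, AnalyticAt ℂ g z ∧ g z ≠ 0 ∧ ∀ᶠ w in 𝓝[≠] z, γ * G w + δ = (w - z) * g w := by
    have hds : AnalyticAt ℂ (dslope (fun w => γ * G w + δ) z) z := by
      obtain ⟨p, hp⟩ := hden
      exact hp.has_fpower_series_dslope_fslope.analyticAt
    refine ⟨dslope (fun w => γ * G w + δ) z, hds, ?_, ?_⟩
    · rw [dslope_same, ((hG.differentiableAt.hasDerivAt.const_mul γ).add_const δ).deriv]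
      exact mul_ne_zero hγ hd
    · filter_upwards [self_mem_nhdsWithin] with w hw
      have := sub_smul_dslope (fun w => γ * G w + δ) z w
      simp only [smul_eq_mul, h0, sub_zero] at this
      exact this.symm
  refine ⟨fun w => (α * G w + β) / g w, hnum.div hg hgz.1, div_ne_zero hn0 hgz.1, ?_⟩
  filter_upwards [h.rel z, hgz.2, self_mem_nhdsWithin, mem_nhdsWithin_of_mem_nhds (hg.continuousAt.eventually_ne hgz.1)] with w h1 h2 h3 h4
  have h3' : w - z ≠ 0 := sub_ne_zero.2 h3
  rw [h2] at h1
  rw [← h1]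
  field_simp

lemma MobRel.schw (h : MobRel f G α β γ δ) {z : ℂ} (hG : AnalyticAt ℂ G z) (hd : deriv G z ≠ 0) :
    ∀ᶠ w in 𝓝[≠] z, Schwarzian f w = Schwarzian G w := by
  have h1 := eventually_eventually_nhdsWithin.2 (h.rel z)
  filter_upwards [h1, self_mem_nhdsWithin, mem_nhdsWithin_of_mem_nhds hG.eventually_analyticAt,
    mem_nhdsWithin_of_mem_nhds (hG.deriv.continuousAt.eventually_ne hd)] with w hw1 hw2 hw3 hw4
  rw [(isOpen_compl_singleton).nhdsWithin_eq hw2] at hw1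
  have hne : ∀ v, f v * (γ * G v + δ) = α * G v + β → γ * G v + δ ≠ 0 := by
    intro v hv h0
    rw [h0, mul_zero] at hv
    exact h.det (by linear_combination α * h0 + γ * hv)
  have he : f =ᶠ[𝓝 w] fun v => (fun u => (α * u + β) / (γ * u + δ)) (G v) := by
    filter_upwards [hw1] with v hv
    show f v = (α * G v + β) / (γ * G v + δ)
    rw [← hv, mul_div_cancel_right₀ _ (hne v hv)]
  obtain ⟨m1, m2, m3⟩ := mob_schw h.det (hne w hw1.self_of_nhds)
  rw [schw_congr he, schw_comp m1 hw3 m2 hw4, m3]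
  ring
end

lemma schw_an {G : ℂ → ℂ} {z : ℂ} (hG : AnalyticAt ℂ G z) (hd : deriv G z ≠ 0) : AnalyticAt ℂ (Schwarzian G) z := by
  have h2 : AnalyticAt ℂ (fun w => deriv (deriv G) w / deriv G w) z := hG.deriv.deriv.div hG.deriv hd
  unfold Schwarzian
  exact h2.deriv.sub (analyticAt_const.mul (h2.pow 2))

lemma schw_mer {G : ℂ → ℂ} {z : ℂ} (hG : MeromorphicAt G z) : MeromorphicAt (Schwarzian G) z := by
  have h2 : MeromorphicAt (fun w => deriv (deriv G) w / deriv G w) z := hG.deriv.deriv.div hG.deriv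
  unfold Schwarzian
  exact h2.deriv.sub ((MeromorphicAt.const _ z).mul (h2.pow 2))

end

section

def pc : Option ℂ → ℂ
  | Option.some a => a
  | Option.none => 1

def qc : Option ℂ → ℂ
  | Option.some _ => 1
  | Option.none => 0

def dd (x y : Option ℂ) : ℂ := pc x * qc y - pc y * qc x

lemma dd_ne {x y : Option ℂ} (h : x ≠ y) : dd x y ≠ 0 := by
  rcases x with _ | x <;> rcases y with _ | y <;> simp [dd, pc, qc] at h ⊢
  exact sub_ne_zero.2 h

lemma pole_ev_ne {f : ℂ → ℂ} {P : Set ℂ} (hf : MeromOn f P univ) (ht : ¬ IsRationalFn f P) (x : Option ℂ) (z : ℂ) :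
    ∀ᶠ w in 𝓝[≠] z, f w * qc x - pc x ≠ 0 := by
  rcases x with _ | x
  · simp [pc, qc]
  · filter_upwards [hf.nonconst ht x z] with w hw
    simpa [pc, qc, sub_eq_zero] using hw

def mobM (x y u : Option ℂ) (w : ℂ) : ℂ := (w * qc y - pc y) * dd x u / ((w * qc u - pc u) * dd x y)

lemma mobM_id (x y u : Option ℂ) (w : ℂ) :
    (w * qc u - pc u) * dd x y - (w * qc y - pc y) * dd x u = - ((w * qc x - pc x) * dd y u) := by
  simp only [dd]; ring

lemma mobM_rel {x y u : Option ℂ} (hxy : x ≠ y) (hyu : y ≠ u) {w : ℂ} (hx : w * qc x - pc x ≠ 0)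
    (hu : w * qc u - pc u ≠ 0) : mobM y u x w * (1 - mobM x y u w) = 1 := by
  have h1 := dd_ne hxy
  have h2 := dd_ne hyu
  have h3 : dd y x = - dd x y := by simp only [dd]; ring
  have h4 : 1 - mobM x y u w = - ((w * qc x - pc x) * dd y u) / ((w * qc u - pc u) * dd x y) := by
    rw [← mobM_id, mobM, sub_div, div_self (mul_ne_zero hu h1)]
  rw [h4, mobM, h3]
  field_simp

lemma mobM_mob {x y u : Option ℂ} (hxy : x ≠ y) {w : ℂ}
    (hu : w * qc u - pc u ≠ 0) : w * ((qc u * dd x y) * mobM x y u w + (- (qc y * dd x u))) =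
      (pc u * dd x y) * mobM x y u w + (- (pc y * dd x u)) := by
  have h1 := dd_ne hxy
  rw [mobM]
  have : (w * qc u - pc u) * dd x y * ((w * qc y - pc y) * dd x u / ((w * qc u - pc u) * dd x y)) = (w * qc y - pc y) * dd x u :=
    mul_div_cancel₀ _ (mul_ne_zero hu h1)
  linear_combination this

lemma mobM_det {x y u : Option ℂ} (hxy : x ≠ y) (hyu : y ≠ u) (hxu : x ≠ u) :
    (pc u * dd x y) * (- (qc y * dd x u)) - (- (pc y * dd x u)) * (qc u * dd x y) ≠ 0 := by
  have : (pc u * dd x y) * (- (qc y * dd x u)) - (- (pc y * dd x u)) * (qc u * dd x y) = dd x y * dd x u * dd y u := by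
    simp only [dd]; ring
  rw [this]
  exact mul_ne_zero (mul_ne_zero (dd_ne hxy) (dd_ne hxu)) (dd_ne hyu)

/-- If the Moebius transform tends to one, the point is an `x`-point. -/
lemma mobM_one {f : ℂ → ℂ} {P : Set ℂ} (hf : MeromOn f P univ) (ht : ¬ IsRationalFn f P) {x y u : Option ℂ} (hxy : x ≠ y) (hyu : y ≠ u)
    {z : ℂ} (hl : Tendsto (fun w => mobM x y u (f w)) (𝓝[≠] z) (𝓝 1)) : z ∈ aPoints f P x := by
  have h1 := dd_ne hxy
  have h2 := dd_ne hyu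
  have hid : ∀ᶠ w in 𝓝[≠] z, (f w * qc u - pc u) * dd x y * (1 - mobM x y u (f w)) = - ((f w * qc x - pc x) * dd y u) := by
    filter_upwards [pole_ev_ne hf ht u z] with w hw
    rw [← mobM_id, mobM, mul_sub, mul_div_cancel₀ _ (mul_ne_zero hw h1), mul_one]
  have hl' : Tendsto (fun w => 1 - mobM x y u (f w)) (𝓝[≠] z) (𝓝 0) := by
    simpa using (tendsto_const_nhds (x := (1:ℂ))).sub hl
  by_cases hz : z ∈ P
  · have hp := tendsto_inv₀_cobounded.comp (tendsto_norm_atTop_iff_cobounded.1 (hf.2.2.1 z hz))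
    have hfw : ∀ v, Tendsto (fun w => (qc v - pc v * (f w)⁻¹)) (𝓝[≠] z) (𝓝 (qc v)) := by
      intro v
      simpa using (tendsto_const_nhds (x := qc v)).sub ((tendsto_const_nhds (x := pc v)).mul hp)
    have e1 := (((hfw u).mul_const (dd x y)).mul hl')
    have e2 := ((hfw x).mul_const (dd y u)).neg
    have e3 := tendsto_nhds_unique_of_eventuallyEq e1 e2 (by
      filter_upwards [hid, (hf.2.2.1 z hz).eventually_gt_atTop 0] with w hw hw0
      have hw0' : f w ≠ 0 := norm_pos_iff.1 hw0
      have a1 : ∀ v, qc v - pc v * (f w)⁻¹ = (f w * qc v - pc v) / f w := by intro v; field_simp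
      rw [a1, a1, div_mul_eq_mul_div, div_mul_eq_mul_div, hw, div_mul_eq_mul_div, neg_div])
    have : qc x = 0 := by
      have := e3
      simp [h2] at this
      exact this
    rcases x with _ | x
    · exact hz
    · simp [qc] at this
  · have hfc : Tendsto f (𝓝[≠] z) (𝓝 (f z)) := (hf.anal hz).continuousAt.tendsto.mono_left nhdsWithin_le_nhds
    have hfw : ∀ v, Tendsto (fun w => (f w * qc v - pc v)) (𝓝[≠] z) (𝓝 (f z * qc v - pc v)) := by
      intro v
      exact (hfc.mul_const _).sub_const _
    have e1 := (((hfw u).mul_const (dd x y)).mul hl')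
    have e2 := ((hfw x).mul_const (dd y u)).neg
    have e3 := tendsto_nhds_unique_of_eventuallyEq e1 e2 hid
    have : f z * qc x - pc x = 0 := by
      simpa [h2] using e3
    rcases x with _ | x
    · simp [qc, pc] at this
    · simp only [qc, pc, mul_one, sub_eq_zero] at this
      exact ⟨hz, this⟩

lemma conf_of {f : ℂ → ℂ} {P : Set ℂ} (hf : MeromOn f P univ) (ht : ¬ IsRationalFn f P) {a : ZMod 3 → Option ℂ} (ha : Function.Injective a)
    (hfin : ∀ j, (aPoints f P (a j) \ {z | ∃ t : ℝ, 0 < t ∧ z = t * om j}).Finite) :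
    ∃ R E, Conf R E ∧ ∀ j, ∃ α β γ δ, MobRel f (E j) α β γ δ := by
  have n1 : ∀ j : ZMod 3, j ≠ j + 1 := by decide
  have n2 : ∀ j : ZMod 3, j ≠ j + 2 := by decide
  have n3 : ∀ j : ZMod 3, j + 1 ≠ j + 2 := by decide
  have n4 : ∀ j : ZMod 3, j + 1 + 1 = j + 2 := by decide
  have n5 : ∀ j : ZMod 3, j + 1 + 2 = j := by decide
  set M : ZMod 3 → ℂ → ℂ := fun j z => mobM (a j) (a (j+1)) (a (j+2)) (f z) with hM
  have hMm : ∀ j, MeromorphicOn (M j) univ := by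
    intro j z _
    have hfm := hf.merom z
    have hN : ∀ v, MeromorphicAt (fun w => f w * qc v - pc v) z := fun v =>
      (hfm.mul (MeromorphicAt.const _ z)).sub (MeromorphicAt.const _ z)
    exact ((hN _).mul (MeromorphicAt.const _ z)).div ((hN _).mul (MeromorphicAt.const _ z))
  set E : ZMod 3 → ℂ → ℂ := fun j => toMeromorphicNFOn (M j) univ with hE
  have hEM : ∀ j z, E j =ᶠ[𝓝[≠] z] M j := fun j z => (hMm j).toMeromorphicNFOn_eq_self_on_nhdsNE (mem_univ z)
  obtain ⟨R, hR⟩ : ∃ R : ℝ, ∀ j, ∀ z ∈ (aPoints f P (a j) \ {z | ∃ t : ℝ, 0 < t ∧ z = t * om j}), ‖z‖ ≤ R := by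
    obtain ⟨R, hR⟩ := (Set.finite_iUnion hfin).isBounded.exists_norm_le
    exact ⟨R, fun j z hz => hR z (mem_iUnion.2 ⟨j, hz⟩)⟩
  refine ⟨max R 1, E, ⟨?_, ?_, ?_, le_max_right _ _⟩, ?_⟩
  · intro j
    exact meromorphicNFOn_toMeromorphicNFOn _ _
  · intro j z
    filter_upwards [hEM j z, hEM (j+1) z, pole_ev_ne hf ht (a j) z, pole_ev_ne hf ht (a (j+2)) z] with w w1 w2 w3 w4
    rw [w1, w2]
    simp only [hM]
    rw [n4, n5]
    exact mobM_rel (fun h => n1 j (ha h)) (fun h => n3 j (ha h)) w3 w4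
  · intro j z hz hzan hz1
    have hl : Tendsto (M j) (𝓝[≠] z) (𝓝 1) := by
      have := hzan.continuousAt.tendsto.mono_left (nhdsWithin_le_nhds (s := {z}ᶜ))
      rw [hz1] at this
      exact this.congr' (hEM j z)
    have hmem := mobM_one hf ht (fun h => n1 j (ha h)) (fun h => n3 j (ha h)) hl
    by_contra hcon
    have := hR j z ⟨hmem, hcon⟩
    exact absurd (lt_of_le_of_lt (le_max_left R 1) hz) (not_lt.2 this)
  · intro j
    refine ⟨_, _, _, _, mobM_det (x := a j) (y := a (j+1)) (u := a (j+2)) (fun h => n1 j (ha h)) (fun h => n3 j (ha h)) (fun h => n2 j (ha h)), fun z => ?_⟩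
    filter_upwards [hEM j z, pole_ev_ne hf ht (a (j+2)) z] with w w1 w2
    rw [w1]
    exact mobM_mob (fun h => n1 j (ha h)) w2

end

section

lemma poly_asym (p : Polynomial ℂ) : ∃ A : ℂ → ℂ, Tendsto A (comap (fun z : ℂ => ‖z‖) atTop) (𝓝 p.leadingCoeff) ∧
    ∀ z, z ≠ 0 → p.eval z = A z * z ^ p.natDegree := by
  refine ⟨fun z => p.reverse.eval z⁻¹, ?_, ?_⟩
  · rw [← Polynomial.coeff_zero_reverse, Polynomial.coeff_zero_eq_eval_zero]
    refine (p.reverse.continuous.tendsto 0).comp ?_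
    rw [comap_norm_atTop]
    exact tendsto_inv₀_cobounded
  · intro z hz
    let _ := invertibleOfNonzero hz
    have := Polynomial.eval₂_reverse_mul_pow (RingHom.id ℂ) z p
    rw [invOf_eq_inv] at this
    exact this.symm

lemma rat_asym {p q : Polynomial ℂ} (hq : q ≠ 0)
    (h : Tendsto (fun t : ℝ => (p.eval ((Real.exp 1 * t : ℝ) : ℂ) / q.eval ((Real.exp 1 * t : ℝ) : ℂ)) / (p.eval (t : ℂ) / q.eval (t : ℂ))) atTop (𝓝 (Complex.exp 1))) :
    ∃ a : ℂ, a ≠ 0 ∧ Tendsto (fun z : ℂ => p.eval z / q.eval z / (a * z)) (comap (fun z : ℂ => ‖z‖) atTop) (𝓝 1) := by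
  have hp : p ≠ 0 := by
    rintro rfl
    simp only [Polynomial.eval_zero, zero_div] at h
    exact Complex.exp_ne_zero _ (tendsto_nhds_unique h tendsto_const_nhds)
  obtain ⟨A, hA, hA2⟩ := poly_asym p
  obtain ⟨B, hB, hB2⟩ := poly_asym q
  have hp' : p.leadingCoeff ≠ 0 := Polynomial.leadingCoeff_ne_zero.2 hp
  have hq' : q.leadingCoeff ≠ 0 := Polynomial.leadingCoeff_ne_zero.2 hq
  have hc1 : Tendsto (fun t : ℝ => (t : ℂ)) atTop (comap (fun z : ℂ => ‖z‖) atTop) := by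
    rw [tendsto_comap_iff]
    refine tendsto_id.congr' ?_
    filter_upwards [eventually_ge_atTop 0] with t ht
    simp [abs_of_nonneg ht]
  have hc2 : Tendsto (fun t : ℝ => ((Real.exp 1 * t : ℝ) : ℂ)) atTop (comap (fun z : ℂ => ‖z‖) atTop) :=
    hc1.comp (tendsto_id.const_mul_atTop (Real.exp_pos 1))
  have hdeg : p.natDegree = q.natDegree + 1 := by
    have h1 := ((hA.comp hc2).div (hB.comp hc2) hq').div ((hA.comp hc1).div (hB.comp hc1) hq') (div_ne_zero hp' hq')
    rw [div_self (div_ne_zero hp' hq')] at h1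
    have h2 := h1.mul_const ((Real.exp 1 : ℂ) ^ p.natDegree / (Real.exp 1 : ℂ) ^ q.natDegree)
    have h3 := tendsto_nhds_unique_of_eventuallyEq h h2 (by
      filter_upwards [eventually_gt_atTop 0] with t ht
      have ht' : (t : ℂ) ≠ 0 := by exact_mod_cast ht.ne'
      have he : (Real.exp 1 : ℂ) ≠ 0 := by exact_mod_cast (Real.exp_pos 1).ne'
      have het : ((Real.exp 1 * t : ℝ) : ℂ) ≠ 0 := by rw [Complex.ofReal_mul]; exact mul_ne_zero he ht'
      rw [hA2 _ ht', hB2 _ ht', hA2 _ het, hB2 _ het]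
      show _ = A ((Real.exp 1 * t : ℝ) : ℂ) / B ((Real.exp 1 * t : ℝ) : ℂ) / (A (t : ℂ) / B (t : ℂ)) * _
      generalize A ((Real.exp 1 * t : ℝ) : ℂ) = a1
      generalize B ((Real.exp 1 * t : ℝ) : ℂ) = b1
      generalize A (t : ℂ) = a2
      generalize B (t : ℂ) = b2
      rw [Complex.ofReal_mul, mul_pow, mul_pow]
      generalize (Real.exp 1 : ℂ) = e at *
      have := pow_ne_zero p.natDegree ht'
      have := pow_ne_zero q.natDegree ht'
      generalize (t : ℂ) ^ p.natDegree = x at *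
      generalize (t : ℂ) ^ q.natDegree = y at *
      generalize e ^ p.natDegree = u at *
      generalize e ^ q.natDegree = v at *
      simp only [div_eq_mul_inv, mul_inv, inv_inv]
      calc a1 * (u * x) * (b1⁻¹ * (v⁻¹ * y⁻¹)) * (a2⁻¹ * x⁻¹ * (b2 * y)) = a1 * b1⁻¹ * (a2⁻¹ * b2) * (u * v⁻¹) * (x * x⁻¹) * (y * y⁻¹) := by ring
        _ = _ := by rw [mul_inv_cancel₀ ‹_›, mul_inv_cancel₀ ‹_›]; ring)
    rw [one_mul, Complex.ofReal_exp, Complex.ofReal_one, ← Complex.exp_nat_mul, ← Complex.exp_nat_mul, ← Complex.exp_sub, mul_one, mul_one] at h3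
    have h4 : Real.exp 1 = Real.exp (p.natDegree - q.natDegree) := by
      have h6 : ((Real.exp 1 : ℝ) : ℂ) = ((Real.exp (p.natDegree - q.natDegree) : ℝ) : ℂ) := by
        rw [Complex.ofReal_exp, Complex.ofReal_exp]
        push_cast
        exact h3
      exact Complex.ofReal_injective h6
    have h5 := Real.exp_injective h4
    have : (p.natDegree : ℝ) = (q.natDegree + 1 : ℕ) := by push_cast; linarith
    exact_mod_cast this
  refine ⟨p.leadingCoeff / q.leadingCoeff, div_ne_zero hp' hq', ?_⟩
  have h1 := (hA.div hB hq').div_const (p.leadingCoeff / q.leadingCoeff)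
  rw [div_self (div_ne_zero hp' hq')] at h1
  refine h1.congr' ?_
  filter_upwards [(tendsto_comap (f := fun z : ℂ => ‖z‖)).eventually_gt_atTop 0] with z hz
  have hz' : z ≠ 0 := norm_pos_iff.1 hz
  rw [hA2 z hz', hB2 z hz', hdeg, pow_succ]
  have := pow_ne_zero q.natDegree hz'
  generalize z ^ q.natDegree = x at *
  rw [Pi.div_apply]
  field_simp

theorem main0 {f : ℂ → ℂ} {P : Set ℂ} (hf : MeromOn f P univ) (ht : ¬ IsRationalFn f P) {a : ZMod 3 → Option ℂ} (ha : Function.Injective a)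
    (hfin : ∀ j, (aPoints f P (a j) \ {z | ∃ t : ℝ, 0 < t ∧ z = t * om j}).Finite) :
    {z : ℂ | z ∉ P ∧ deriv f z = 0}.Finite ∧ {z ∈ P | ¬ SimpleP f z}.Finite ∧
    ∃ a : ℂ, a ≠ 0 ∧ ∃ p q : Polynomial ℂ, q ≠ 0 ∧
      (∀ z : ℂ, z ∉ P → deriv f z ≠ 0 → q.eval z ≠ 0 →
        Schwarzian f z = p.eval z / q.eval z) ∧
      Tendsto (fun z : ℂ => p.eval z / q.eval z / (a * z))
        (Filter.comap (fun z : ℂ => ‖z‖) Filter.atTop) (nhds 1) := by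
  obtain ⟨R, E, hE, hmob⟩ := conf_of hf ht ha hfin
  obtain ⟨k, hk, hke⟩ := hE.sys
  have hnr : ∀ j, ¬ RatF (E j) := by
    intro j hr
    obtain ⟨α, β, γ, δ, hm⟩ := hmob j
    exact ht (hm.rat hf (hE.nf j).meromorphicOn hr)
  have ho := hE.main hk hke hnr
  obtain ⟨⟨R', hR', C, N, hb⟩, hc, hlim⟩ := hE.core hk hke ho
  have hdne : ∀ z, R' < ‖z‖ → z ∉ P → deriv f z ≠ 0 := by
    intro z hz hzP
    obtain ⟨j, h1, h2, -⟩ := hb z hz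
    obtain ⟨α, β, γ, δ, hm⟩ := hmob j
    exact hm.crit hf hzP h1 h2
  have hsim : ∀ z, R' < ‖z‖ → z ∈ P → SimpleP f z := by
    intro z hz hzP
    obtain ⟨j, h1, h2, -⟩ := hb z hz
    obtain ⟨α, β, γ, δ, hm⟩ := hmob j
    exact hm.simple hf hzP h1 h2
  have hdm : MeromorphicOn (deriv f) univ := fun z _ => (hf.merom z).deriv
  have hdisc : ∀ z, ∀ᶠ w in 𝓝[≠] z, deriv f w ≠ 0 := by
    set z0 : ℂ := ((R' + 1 : ℝ) : ℂ) with hz0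
    have hz0n : R' < ‖z0‖ := by
      rw [hz0, Complex.norm_real, Real.norm_of_nonneg (by linarith)]; linarith
    have h0 : ∀ᶠ w in 𝓝[≠] z0, deriv f w ≠ 0 := by
      filter_upwards [hf.disc z0, mem_nhdsWithin_of_mem_nhds (continuous_norm.continuousAt.eventually_const_lt hz0n)] with w h1 h2
      exact hdne w h2 h1
    intro z
    rw [← meromorphicOrderAt_ne_top_iff_eventually_ne_zero (hdm z (mem_univ z))]
    rw [← meromorphicOrderAt_ne_top_iff_eventually_ne_zero (hdm z0 (mem_univ z0))] at h0
    exact hdm.meromorphicOrderAt_ne_top_of_isPreconnected isPreconnected_univ (mem_univ z0) (mem_univ z) h0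
  refine ⟨?_, ?_, ?_⟩
  · refine fin_of_bdd (R := R') (fun z => ?_) (fun z hz => ?_)
    · filter_upwards [hdisc z] with w hw hw2
      exact hw hw2.2
    · by_contra hcon
      exact hdne z (not_le.1 hcon) hz.1 hz.2
  · refine fin_of_bdd (R := R') (fun z => ?_) (fun z hz => ?_)
    · filter_upwards [hf.disc z] with w hw hw2
      exact hw hw2.1
    · by_contra hcon
      exact hz.2 (hsim z (not_le.1 hcon) hz.1)
  · have hSm : MeromorphicOn (Schwarzian f) univ := fun z _ => schw_mer (hf.merom z)
    set g := toMeromorphicNFOn (Schwarzian f) univ with hg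
    have hgS : ∀ z, g =ᶠ[𝓝[≠] z] Schwarzian f := fun z => hSm.toMeromorphicNFOn_eq_self_on_nhdsNE (mem_univ z)
    have hgn : MeromorphicNFOn g univ := meromorphicNFOn_toMeromorphicNFOn _ _
    have hgE : ∀ j z, AnalyticAt ℂ (E j) z → deriv (E j) z ≠ 0 → AnalyticAt ℂ g z ∧ g z = Schwarzian (E j) z := by
      intro j z h1 h2
      obtain ⟨α, β, γ, δ, hm⟩ := hmob j
      refine nf_of_tendsto (hgn (mem_univ z)) ?_
      have := (schw_an h1 h2).continuousAt.tendsto.mono_left (nhdsWithin_le_nhds (s := {z}ᶜ))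
      exact this.congr' ((EventuallyEq.symm (hm.schw h1 h2)).trans (hgS z).symm)
    have hgf : ∀ z, z ∉ P → deriv f z ≠ 0 → AnalyticAt ℂ g z ∧ g z = Schwarzian f z := by
      intro z h1 h2
      refine nf_of_tendsto (hgn (mem_univ z)) ?_
      have := (schw_an (hf.anal h1) h2).continuousAt.tendsto.mono_left (nhdsWithin_le_nhds (s := {z}ᶜ))
      exact this.congr' (hgS z).symm
    have hrat : RatF g := by
      refine rat_of_bound (R := R') (C := C) (N := N) hgn ?_ ?_
      · intro z hz
        obtain ⟨j, h1, h2, -⟩ := hb z hz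
        exact (hgE j z h1 h2).1
      · apply Eventually.frequently
        filter_upwards [eventually_gt_atTop R'] with r hr z hz
        obtain ⟨j, h1, h2, h3⟩ := hb z (by rw [hz]; exact hr)
        rw [(hgE j z h1 h2).2, ← hz]
        exact h3
    obtain ⟨p, q, hq, hpq⟩ := hrat
    have hqe : ∀ᶠ t : ℝ in atTop, q.eval (t : ℂ) ≠ 0 := by
      have hfin : {w | q.eval w = 0}.Finite := by
        refine (q.roots.toFinset.finite_toSet).subset fun w hw => ?_
        simpa [hq] using hw
      obtain ⟨B, hB⟩ := hfin.isBounded.exists_norm_le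
      filter_upwards [eventually_gt_atTop B, eventually_ge_atTop 0] with t h1 h2 h3
      have := hB _ h3
      rw [Complex.norm_real, Real.norm_of_nonneg h2] at this
      linarith
    have hSE : ∀ᶠ t : ℝ in atTop, Schwarzian (E 0) (t : ℂ) = p.eval (t : ℂ) / q.eval (t : ℂ) := by
      filter_upwards [hqe, hc] with t h1 h2
      obtain ⟨h3, h4⟩ := hgE 0 t h2.1 h2.2
      rw [← h4, hpq _ h3 h1]
    have hSE2 := (tendsto_id.const_mul_atTop (Real.exp_pos 1)).eventually hSE
    have hlim2 := hlim.congr' (f₂ := fun t : ℝ => (p.eval ((Real.exp 1 * t : ℝ) : ℂ) / q.eval ((Real.exp 1 * t : ℝ) : ℂ)) / (p.eval (t : ℂ) / q.eval (t : ℂ))) (by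
      filter_upwards [hSE, hSE2] with t h1 h2
      simp only [id] at h2
      rw [h1, h2])
    obtain ⟨a', ha', hl⟩ := rat_asym hq hlim2
    refine ⟨a', ha', p, q, hq, fun z h1 h2 h3 => ?_, hl⟩
    obtain ⟨h4, h5⟩ := hgf z h1 h2
    rw [← h5, hpq z h4 h3]

end

section

lemma tendsto_rot {ρ : ℂ} (hρ : ρ ≠ 0) (z : ℂ) : Tendsto (fun w => ρ * w) (𝓝[≠] z) (𝓝[≠] (ρ * z)) := by
  apply tendsto_nhdsWithin_of_tendsto_nhds_of_eventually_within
  · exact ((continuous_const.mul continuous_id).tendsto z).mono_left nhdsWithin_le_nhds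
  · filter_upwards [self_mem_nhdsWithin] with w hw h
    exact hw (mul_left_cancel₀ hρ h)

lemma poly_rot {ρ : ℂ} (hρ : ρ ≠ 0) {q : Polynomial ℂ} (hq : q ≠ 0) : q.comp (Polynomial.C ρ * Polynomial.X) ≠ 0 := by
  intro h
  apply hq
  apply Polynomial.funext
  intro z
  have := congrArg (fun r => Polynomial.eval (ρ⁻¹ * z) r) h
  simpa [mul_inv_cancel_left₀ hρ] using this

lemma poly_rot_eval (ρ z : ℂ) (q : Polynomial ℂ) : (q.comp (Polynomial.C ρ * Polynomial.X)).eval z = q.eval (ρ * z) := by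
  simp

lemma schw_rot {ρ : ℂ} (hρ : ρ ≠ 0) (f : ℂ → ℂ) (z : ℂ) : Schwarzian (fun w => f (ρ * w)) z = ρ ^ 2 * Schwarzian f (ρ * z) := by
  have h1 : ∀ F : ℂ → ℂ, deriv (fun w => F (ρ * w)) = fun w => ρ * deriv F (ρ * w) := by
    intro F; funext w; rw [deriv_comp_mul_left, smul_eq_mul]
  have h2 : deriv (deriv (fun w => f (ρ * w))) = fun w => ρ * (ρ * deriv (deriv f) (ρ * w)) := by
    rw [h1 f]
    funext w
    rw [deriv_const_mul_field, h1 (deriv f)]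
  have h3 : (fun w => deriv (deriv (fun w => f (ρ * w))) w / deriv (fun w => f (ρ * w)) w) =
      fun w => ρ * (fun v => deriv (deriv f) v / deriv f v) (ρ * w) := by
    funext w
    rw [h2, h1 f]
    simp only
    rw [mul_div_mul_left _ _ hρ, mul_div_assoc]
  have h4 : deriv (deriv (fun w => f (ρ * w))) z / deriv (fun w => f (ρ * w)) z = ρ * (deriv (deriv f) (ρ * z) / deriv f (ρ * z)) := congrFun h3 z
  unfold Schwarzian
  rw [h4, h3, deriv_const_mul_field, congrFun (h1 (fun v => deriv (deriv f) v / deriv f v)) z]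
  ring

lemma MeromOn.rot {f : ℂ → ℂ} {P : Set ℂ} (hf : MeromOn f P univ) {ρ : ℂ} (hρ : ρ ≠ 0) :
    MeromOn (fun z => f (ρ * z)) {z | ρ * z ∈ P} univ := by
  refine ⟨subset_univ _, fun z hz => ?_, fun z hz => ?_, fun z _ => ?_⟩
  · have : AnalyticAt ℂ f (ρ * z) := hf.anal hz.2
    exact this.fun_comp (f := fun w => ρ * w) (by fun_prop)
  · exact (hf.2.2.1 _ hz).comp (tendsto_rot hρ z)
  · rw [accPt_iff_frequently_nhdsNE]
    have := (tendsto_rot hρ z).eventually (hf.disc (ρ * z))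
    simpa using this

lemma aPoints_rot (f : ℂ → ℂ) (P : Set ℂ) (ρ : ℂ) (x : Option ℂ) :
    aPoints (fun z => f (ρ * z)) {z | ρ * z ∈ P} x = (fun z => ρ * z) ⁻¹' aPoints f P x := by
  rcases x with _ | x <;> rfl

lemma simple_rot {f : ℂ → ℂ} {ρ : ℂ} (hρ : ρ ≠ 0) {z : ℂ} (h : SimpleP (fun z => f (ρ * z)) (ρ⁻¹ * z)) : poleOrder f z ≤ 1 := by
  obtain ⟨h, h1, h2, h3⟩ := h
  refine Nat.sInf_le ⟨fun w => ρ * h (ρ⁻¹ * w), ?_, mul_ne_zero hρ h2, ?_⟩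
  · exact analyticAt_const.mul (h1.fun_comp (f := fun w => ρ⁻¹ * w) (by fun_prop))
  · filter_upwards [(tendsto_rot (inv_ne_zero hρ) z).eventually h3, self_mem_nhdsWithin] with w hw hw2
    rw [mul_inv_cancel_left₀ hρ] at hw
    rw [hw, pow_one, ← mul_sub]
    have : w - z ≠ 0 := sub_ne_zero.2 hw2
    field_simp

theorem main1
    (θ : ℝ) (f : ℂ → ℂ) (P : Set ℂ)
    (hf : MeromOn f P Set.univ) (htrans : ¬ IsRationalFn f P)
    (a₁ a₂ a₃ : Option ℂ) (h12 : a₁ ≠ a₂) (h13 : a₁ ≠ a₃) (h23 : a₂ ≠ a₃)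
    (h1 : (aPoints f P a₁ \ Ray θ).Finite)
    (h2 : (aPoints f P a₂ \ Ray (θ + 2 * Real.pi / 3)).Finite)
    (h3 : (aPoints f P a₃ \ Ray (θ + 4 * Real.pi / 3)).Finite) :
    {z : ℂ | z ∉ P ∧ deriv f z = 0}.Finite ∧
    {z ∈ P | 2 ≤ poleOrder f z}.Finite ∧
    ∃ a : ℂ, a ≠ 0 ∧ ∃ p q : Polynomial ℂ, q ≠ 0 ∧
      (∀ z : ℂ, z ∉ P → deriv f z ≠ 0 → q.eval z ≠ 0 →
        Schwarzian f z = p.eval z / q.eval z) ∧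
      Tendsto (fun z : ℂ => p.eval z / q.eval z / (a * z))
        (Filter.comap (fun z : ℂ => ‖z‖) Filter.atTop) (nhds 1) := by
  set ρ : ℂ := Complex.exp ((θ : ℂ) * I) with hρd
  have hρ : ρ ≠ 0 := Complex.exp_ne_zero _
  have hρ' : ρ⁻¹ ≠ 0 := inv_ne_zero hρ
  have hρn : ‖ρ⁻¹‖ = 1 := by rw [norm_inv, hρd, Complex.norm_exp_ofReal_mul_I, inv_one]
  have hinj : Function.Injective (fun z : ℂ => ρ * z) := fun x y h => mul_left_cancel₀ hρ h
  have hinj' : Function.Injective (fun z : ℂ => ρ⁻¹ * z) := fun x y h => mul_left_cancel₀ hρ' h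
  have hf1 := hf.rot hρ
  have ht1 : ¬ IsRationalFn (fun z => f (ρ * z)) {z | ρ * z ∈ P} := by
    rintro ⟨p, q, hq, he⟩
    apply htrans
    refine ⟨p.comp (Polynomial.C ρ⁻¹ * Polynomial.X), q.comp (Polynomial.C ρ⁻¹ * Polynomial.X), poly_rot hρ' hq, fun z hz hz2 => ?_⟩
    rw [poly_rot_eval] at hz2 ⊢
    rw [poly_rot_eval]
    have := he (ρ⁻¹ * z) (by simpa [mul_inv_cancel_left₀ hρ] using hz) hz2
    simpa [mul_inv_cancel_left₀ hρ] using this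
  set a : ZMod 3 → Option ℂ := fun j => if j = 0 then a₁ else if j = 1 then a₂ else a₃ with ha
  have n10 : (1 : ZMod 3) ≠ 0 := by decide
  have n20 : (2 : ZMod 3) ≠ 0 := by decide
  have n21 : (2 : ZMod 3) ≠ 1 := by decide
  have a0 : a 0 = a₁ := by simp [ha]
  have a1 : a 1 = a₂ := by simp [ha]
  have a2 : a 2 = a₃ := by simp [ha, n20, n21]
  have hcase : ∀ j : ZMod 3, j = 0 ∨ j = 1 ∨ j = 2 := by decide
  have hainj : Function.Injective a := by
    intro i j hij
    rcases hcase i with rfl | rfl | rfl <;> rcases hcase j with rfl | rfl | rfl <;> first | rfl | skip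
    all_goals
      simp only [a0, a1, a2] at hij
      first
      | exact absurd hij h12 | exact absurd hij h13 | exact absurd hij h23
      | exact absurd hij.symm h12 | exact absurd hij.symm h13 | exact absurd hij.symm h23
  have hray : ∀ (j : ZMod 3) (φ : ℝ), Complex.exp ((φ : ℂ) * I) = ρ * om j → ∀ x, (aPoints f P x \ Ray φ).Finite →
      (aPoints (fun z => f (ρ * z)) {z | ρ * z ∈ P} x \ {z | ∃ t : ℝ, 0 < t ∧ z = t * om j}).Finite := by
    intro j φ hφ x hx
    refine (hx.preimage (hinj.injOn)).subset ?_
    rintro z ⟨hz1, hz2⟩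
    rw [aPoints_rot] at hz1
    refine ⟨hz1, fun hz3 => hz2 ?_⟩
    obtain ⟨t, ht, he⟩ := hz3
    refine ⟨t, ht, mul_left_cancel₀ hρ ?_⟩
    have he' : ρ * z = t * Complex.exp ((φ : ℂ) * I) := he
    rw [he', hφ]; ring
  have hfin : ∀ j, (aPoints (fun z => f (ρ * z)) {z | ρ * z ∈ P} (a j) \ {z | ∃ t : ℝ, 0 < t ∧ z = t * om j}).Finite := by
    intro j
    rcases hcase j with rfl | rfl | rfl
    · rw [a0]
      exact hray 0 θ (by rw [om_zero, mul_one]) _ h1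
    · rw [a1]
      refine hray 1 _ ?_ _ h2
      rw [om_one, hρd, ← Complex.exp_add]
      congr 1; unfold ww; push_cast; ring
    · rw [a2]
      refine hray 2 _ ?_ _ h3
      rw [om_two, om_one, hρd, ← Complex.exp_add, ← Complex.exp_add]
      congr 1; unfold ww; push_cast; ring
  obtain ⟨c1, c2, b, hb, p, q, hq, hs, hl⟩ := main0 hf1 ht1 hainj hfin
  have hdr : ∀ z, deriv (fun z => f (ρ * z)) (ρ⁻¹ * z) = ρ * deriv f z := by
    intro z; rw [deriv_comp_mul_left, smul_eq_mul, mul_inv_cancel_left₀ hρ]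
  refine ⟨?_, ?_, ρ⁻¹ ^ 3 * b, mul_ne_zero (pow_ne_zero 3 hρ') hb, Polynomial.C (ρ⁻¹ ^ 2) * p.comp (Polynomial.C ρ⁻¹ * Polynomial.X),
    q.comp (Polynomial.C ρ⁻¹ * Polynomial.X), poly_rot hρ' hq, ?_, ?_⟩
  · refine (c1.preimage (hinj'.injOn)).subset ?_
    rintro z ⟨hz1, hz2⟩
    refine ⟨?_, ?_⟩
    · show ¬ (ρ * (ρ⁻¹ * z) ∈ P)
      rwa [mul_inv_cancel_left₀ hρ]
    · rw [hdr, hz2, mul_zero]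
  · refine (c2.preimage (hinj'.injOn)).subset ?_
    rintro z ⟨hz1, hz2⟩
    refine ⟨?_, fun hsm => ?_⟩
    · show ρ * (ρ⁻¹ * z) ∈ P
      rwa [mul_inv_cancel_left₀ hρ]
    · have := simple_rot hρ hsm
      omega
  · intro z hz1 hz2 hz3
    rw [poly_rot_eval] at hz3
    have := hs (ρ⁻¹ * z) (by show ¬ (ρ * (ρ⁻¹ * z) ∈ P); rwa [mul_inv_cancel_left₀ hρ]) (by rw [hdr]; exact mul_ne_zero hρ hz2) hz3
    rw [schw_rot hρ, mul_inv_cancel_left₀ hρ] at this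
    rw [Polynomial.eval_mul, Polynomial.eval_C, poly_rot_eval, poly_rot_eval, mul_div_assoc, ← this, ← mul_assoc, ← mul_pow,
      inv_mul_cancel₀ hρ, one_pow, one_mul]
  · have hT : Tendsto (fun z : ℂ => ρ⁻¹ * z) (comap (fun z : ℂ => ‖z‖) atTop) (comap (fun z : ℂ => ‖z‖) atTop) := by
      rw [tendsto_comap_iff]
      refine tendsto_comap.congr fun z => ?_
      simp only [Function.comp, norm_mul, hρn, one_mul]
    refine (hl.comp hT).congr fun z => ?_
    simp only [Function.comp]
    rw [Polynomial.eval_mul, Polynomial.eval_C, poly_rot_eval, poly_rot_eval]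
    have hpz := pow_ne_zero 2 hρ'
    rw [show ρ⁻¹ ^ 3 * b * z = ρ⁻¹ ^ 2 * (b * (ρ⁻¹ * z)) by ring, mul_div_assoc, mul_div_mul_left _ _ hpz]

end

/-- If `f` is a transcendental meromorphic function having three distinct values `a₁, a₂, a₃`
on the Riemann sphere such that all but finitely many `aⱼ`-points lie on the three equally
spaced rays with angles `θ`, `θ + 2π/3`, `θ + 4π/3`, then `f` has only finitely many critical
points, and `S(f)` is a rational function `Q` with `Q(z) ~ a z` as `z → ∞` for some
`a ≠ 0`. -/
theorem finitely_many_critical_points_and_schwarzian_rational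
    (θ : ℝ) (f : ℂ → ℂ) (P : Set ℂ)
    (hf : MeromOn f P Set.univ) (htrans : ¬ IsRationalFn f P)
    (a₁ a₂ a₃ : Option ℂ) (h12 : a₁ ≠ a₂) (h13 : a₁ ≠ a₃) (h23 : a₂ ≠ a₃)
    (h1 : (aPoints f P a₁ \ Ray θ).Finite)
    (h2 : (aPoints f P a₂ \ Ray (θ + 2 * Real.pi / 3)).Finite)
    (h3 : (aPoints f P a₃ \ Ray (θ + 4 * Real.pi / 3)).Finite) :
    {z : ℂ | z ∉ P ∧ deriv f z = 0}.Finite ∧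
    {z ∈ P | 2 ≤ poleOrder f z}.Finite ∧
    ∃ a : ℂ, a ≠ 0 ∧ ∃ p q : Polynomial ℂ, q ≠ 0 ∧
      (∀ z : ℂ, z ∉ P → deriv f z ≠ 0 → q.eval z ≠ 0 →
        Schwarzian f z = p.eval z / q.eval z) ∧
      Tendsto (fun z : ℂ => p.eval z / q.eval z / (a * z))
        (Filter.comap (fun z : ℂ => ‖z‖) Filter.atTop) (nhds 1) := by
  exact main1 θ f P hf htrans a₁ a₂ a₃ h12 h13 h23 h1 h2 h3
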